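/- Let X be a polytopal complex in ℝ^d all of whose polytopes are integral. Then there exists a positive integer c such that for every integer c' ≥ c there is a triangulation of the set ⋃_{Q ∈ X} c'·Q into unimodular simplices which refines c'·X, i.e., every simplex of the triangulation is contained in c'·Q for some Q ∈ X, and the simplices contained in a fixed c'·Q form a unimodular triangulation of c'·Q. -/

import Mathlib

open Pointwise

/-- A point of `ℝ^d` with integer coordinates. -/
def IsLatticePt {d : ℕ} (x : Fin d → ℝ) : Prop := ∀ i, ∃ z : ℤ, x i = (z : ℝ)

/-- The subgroup `ℤ^d` of integral points of `ℝ^d`. -/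
def intLattice (d : ℕ) : AddSubgroup (Fin d → ℝ) where
  carrier := {x | IsLatticePt x}
  zero_mem' := fun i => ⟨0, by simp⟩
  add_mem' := by
    rintro a b ha hb i
    obtain ⟨z, hz⟩ := ha i
    obtain ⟨w, hw⟩ := hb i
    exact ⟨z + w, by simp [hz, hw]⟩
  neg_mem' := by
    rintro a ha i
    obtain ⟨z, hz⟩ := ha i
    exact ⟨-z, by simp [hz]⟩

/-- A polytope: the convex hull of a nonempty finite set of points. -/
def IsPolytope {d : ℕ} (P : Set (Fin d → ℝ)) : Prop :=
  ∃ V : Finset (Fin d → ℝ), V.Nonempty ∧ P = convexHull ℝ (V : Set (Fin d → ℝ))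

/-- An integral polytope: the convex hull of a nonempty finite set of integral points. -/
def IsIntegralPolytope {d : ℕ} (P : Set (Fin d → ℝ)) : Prop :=
  ∃ V : Finset (Fin d → ℝ), V.Nonempty ∧ (∀ v ∈ V, IsLatticePt v) ∧
    P = convexHull ℝ (V : Set (Fin d → ℝ))

/-- A simplex: the convex hull of a nonempty affinely independent finite set. -/
def IsSimplex {d : ℕ} (P : Set (Fin d → ℝ)) : Prop :=
  ∃ V : Finset (Fin d → ℝ), V.Nonempty ∧
    AffineIndependent ℝ (Subtype.val : ↥(V : Set (Fin d → ℝ)) → (Fin d → ℝ)) ∧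
    P = convexHull ℝ (V : Set (Fin d → ℝ))

/-- An integral simplex. -/
def IsIntegralSimplex {d : ℕ} (P : Set (Fin d → ℝ)) : Prop :=
  ∃ V : Finset (Fin d → ℝ), V.Nonempty ∧ (∀ v ∈ V, IsLatticePt v) ∧
    AffineIndependent ℝ (Subtype.val : ↥(V : Set (Fin d → ℝ)) → (Fin d → ℝ)) ∧
    P = convexHull ℝ (V : Set (Fin d → ℝ))

/-- The set of differences of vertices (= extreme points) of a polytope. -/
def vertexDiffs {d : ℕ} (P : Set (Fin d → ℝ)) : Set (Fin d → ℝ) :=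
  {w | ∃ u ∈ P.extremePoints ℝ, ∃ v ∈ P.extremePoints ℝ, w = u - v}

/-- `L(P)`: the subgroup of `ℤ^d` generated by differences of vertices of `P`. -/
def latL {d : ℕ} (P : Set (Fin d → ℝ)) : AddSubgroup (Fin d → ℝ) :=
  AddSubgroup.closure (vertexDiffs P)

/-- `N(P)`: the intersection of the real span of `L(P)` with `ℤ^d`. -/
def latN {d : ℕ} (P : Set (Fin d → ℝ)) : AddSubgroup (Fin d → ℝ) :=
  (Submodule.span ℝ (vertexDiffs P)).toAddSubgroup ⊓ intLattice d

/-- The (normalized) index of an integral polytope: the group index `[N(P) : L(P)]`. -/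
noncomputable def polyIndex {d : ℕ} (P : Set (Fin d → ℝ)) : ℕ :=
  ((latL P).addSubgroupOf (latN P)).index

/-- A unimodular simplex: an integral simplex of index 1. -/
def IsUnimodularSimplex {d : ℕ} (P : Set (Fin d → ℝ)) : Prop :=
  IsIntegralSimplex P ∧ polyIndex P = 1

/-- `F` is a face of `P`: the (nonempty) set of maximizers on `P` of a linear functional. -/
def IsFaceOf {d : ℕ} (F P : Set (Fin d → ℝ)) : Prop :=
  F.Nonempty ∧ ∃ φ : (Fin d → ℝ) →ₗ[ℝ] ℝ, F = {x ∈ P | ∀ y ∈ P, φ y ≤ φ x}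

/-- A triangulation of `Q`: a finite, face-closed collection of simplices with union `Q`,
any two of which meet in a (possibly empty) common face. -/
def IsTriangulation {d : ℕ} (T : Set (Set (Fin d → ℝ))) (Q : Set (Fin d → ℝ)) : Prop :=
  T.Finite ∧ (∀ S ∈ T, IsSimplex S) ∧ ⋃₀ T = Q ∧
    (∀ S ∈ T, ∀ F, IsFaceOf F S → F ∈ T) ∧
    ∀ S₁ ∈ T, ∀ S₂ ∈ T, S₁ ∩ S₂ = ∅ ∨ (IsFaceOf (S₁ ∩ S₂) S₁ ∧ IsFaceOf (S₁ ∩ S₂) S₂)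

/-- A unimodular triangulation: all of its simplices are unimodular. -/
def IsUnimodularTriangulation {d : ℕ} (T : Set (Set (Fin d → ℝ))) (Q : Set (Fin d → ℝ)) : Prop :=
  IsTriangulation T Q ∧ ∀ S ∈ T, IsUnimodularSimplex S

/-- A polytopal complex: a finite, face-closed set of polytopes in which distinct members
have disjoint relative interiors. -/
def IsPolytopalComplex {d : ℕ} (X : Set (Set (Fin d → ℝ))) : Prop :=
  X.Finite ∧ (∀ P ∈ X, IsPolytope P) ∧
    (∀ P ∈ X, ∀ F, IsFaceOf F P → F ∈ X) ∧
    ∀ P ∈ X, ∀ Q ∈ X, P ≠ Q → intrinsicInterior ℝ P ∩ intrinsicInterior ℝ Q = ∅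

namespace UnimodularTriangulation

open scoped Classical

section StarTheory

variable {E : Type*} [AddCommGroup E] [Module ℝ E]

/-- The linear combination of vectors with the given coefficients. -/
noncomputable def lc : (E →₀ ℝ) →ₗ[ℝ] E := Finsupp.linearCombination ℝ id

lemma lc_single (v : E) (t : ℝ) : lc (Finsupp.single v t) = t • v := by
  simp [lc]

lemma lc_eq_sum (f : E →₀ ℝ) {S : Finset E} (h : f.support ⊆ S) :
    lc f = ∑ v ∈ S, f v • v := by
  rw [lc, Finsupp.linearCombination_apply, Finsupp.sum_of_support_subset f h _ (by simp)]
  rfl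

/-- A finite simplicial fan: cones over the members of `J`, with generators in the lattice `L`. -/
structure IsFan (L : AddSubgroup E) (J : Set (Finset E)) : Prop where
  finite : J.Finite
  down : ∀ S ∈ J, ∀ S' ⊆ S, S' ∈ J
  uniq : ∀ S ∈ J, ∀ S' ∈ J, ∀ f f' : E →₀ ℝ, 0 ≤ f → 0 ≤ f' → f.support ⊆ S →
    f'.support ⊆ S' → lc f = lc f' → f = f'
  mem : ∀ S ∈ J, ∀ v ∈ S, v ∈ L

/-- The point `p` lies in one of the cones over members of `J`. -/
def InFan (J : Set (Finset E)) (p : E) : Prop :=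
  ∃ f : E →₀ ℝ, f.support ∈ J ∧ 0 ≤ f ∧ lc f = p

/-- Lattice points of the half-open parallelepiped spanned by `S`. -/
def box (L : AddSubgroup E) (S : Finset E) : Set E :=
  {x | x ∈ L ∧ ∃ β : E →₀ ℝ, β.support ⊆ S ∧ 0 ≤ β ∧ (∀ v, β v < 1) ∧ lc β = x}

/-- The stellar subdivision of `J` at `lc α`, a point in the relative interior of the cone over
`α.support`. -/
def star (J : Set (Finset E)) (α : E →₀ ℝ) : Set (Finset E) :=
  {S | S ∈ J ∧ ¬ α.support ⊆ S} ∪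
    {S | ∃ R, ¬ α.support ⊆ R ∧ R ∪ α.support ∈ J ∧ S = insert (lc α) R}

/-- Coefficients admissible for a stellar subdivision. -/
structure StarDatum (L : AddSubgroup E) (J : Set (Finset E)) (α : E →₀ ℝ) : Prop where
  supp : α.support ∈ J
  card : 2 ≤ α.support.card
  nonneg : 0 ≤ α
  le_one : ∀ v, α v ≤ 1
  mem : lc α ∈ L

variable {L : AddSubgroup E} {J : Set (Finset E)} {α : E →₀ ℝ}

lemma IsFan.linInd (hJ : IsFan L J) {S : Finset E} (hS : S ∈ J) {g h : E →₀ ℝ}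
    (hg : g.support ⊆ S) (hh : h.support ⊆ S) (hgh : lc g = lc h) : g = h := by
  have key : ∀ k : E →₀ ℝ, k.support ⊆ S → lc k = 0 → k = 0 := by
    intro k hk hk0
    let p : E →₀ ℝ := k.mapRange (fun t => max t 0) (by simp)
    let q : E →₀ ℝ := k.mapRange (fun t => max (-t) 0) (by simp)
    have hpq : k = p - q := by
      ext v
      simp only [p, q, Finsupp.sub_apply, Finsupp.mapRange_apply]
      rcases le_total (k v) 0 with h | h <;> simp [h]
    have : p = q := by
      apply hJ.uniq S hS S hS p q
      · intro v; simp [p]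
      · intro v; simp [q]
      · exact (Finsupp.support_mapRange).trans hk
      · exact (Finsupp.support_mapRange).trans hk
      · rw [hpq, map_sub] at hk0
        exact sub_eq_zero.1 hk0
    rw [hpq, this, sub_self]
  have := key (g - h) ((Finsupp.support_sub).trans (Finset.union_subset hg hh))
    (by rw [map_sub, hgh, sub_self])
  exact sub_eq_zero.1 this

lemma StarDatum.notMem (hα : StarDatum L J α) (hJ : IsFan L J) {S : Finset E} (hS : S ∈ J) :
    lc α ∉ S := by
  intro hy
  have : α = Finsupp.single (lc α) 1 := by
    apply hJ.uniq _ hα.supp S hS _ _ hα.nonneg (by simp) subset_rfl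
    · exact (Finsupp.support_single_subset).trans (by simpa using hy)
    · rw [lc_single, one_smul]
  have h2 := hα.card
  rw [this, Finsupp.support_single _ one_ne_zero] at h2
  simp at h2

lemma mem_star_cases (hJ : IsFan L J) {S : Finset E} (hS : S ∈ star J α) :
    (S ∈ J ∧ ¬ α.support ⊆ S) ∨
      ∃ S', S' ∈ J ∧ ¬ α.support ⊆ S' ∧ S' ∪ α.support ∈ J ∧ S = insert (lc α) S' := by
  rcases hS with h | ⟨S', h1, h2, h3⟩
  · exact Or.inl h
  · exact Or.inr ⟨S', hJ.down _ h2 _ Finset.subset_union_left, h1, h2, h3⟩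

lemma mem_star_vertex (hJ : IsFan L J) {S : Finset E} (hS : S ∈ star J α) {v : E}
    (hv : v ∈ S) : v = lc α ∨ ∃ S' ∈ J, v ∈ S' := by
  rcases mem_star_cases hJ hS with h | ⟨S', h1, -, -, rfl⟩
  · exact Or.inr ⟨S, h.1, hv⟩
  · rcases Finset.mem_insert.1 hv with h | h
    · exact Or.inl h
    · exact Or.inr ⟨S', h1, h⟩

lemma mem_of_mem_star_of_notMem (hJ : IsFan L J) {S : Finset E} (hS : S ∈ star J α)
    (hy : lc α ∉ S) : S ∈ J ∧ ¬ α.support ⊆ S := by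
  rcases mem_star_cases hJ hS with h | ⟨S', h1, -, -, rfl⟩
  · exact h
  · simp at hy

lemma StarDatum.inFan_star (hα : StarDatum L J α) (hJ : IsFan L J) {p : E} (hp : InFan J p) :
    InFan (star J α) p := by
  obtain ⟨f, hf, hf0, rfl⟩ := hp
  by_cases hF : α.support ⊆ f.support
  · have hne : α.support.Nonempty := Finset.card_pos.1 (by have := hα.card; omega)
    obtain ⟨a, ha, hmin⟩ := Finset.exists_min_image α.support (fun v => f v / α v) hne
    have hpos : ∀ v ∈ α.support, 0 < α v := fun v hv =>
      lt_of_le_of_ne (hα.nonneg v) (Ne.symm (Finsupp.mem_support_iff.1 hv))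
    set t := f a / α a with ht
    have ht0 : 0 < t := div_pos (lt_of_le_of_ne (hf0 a)
      (Ne.symm (Finsupp.mem_support_iff.1 (hF ha)))) (hpos a ha)
    have hle : ∀ v, t * α v ≤ f v := by
      intro v
      by_cases hv : v ∈ α.support
      · exact (le_div_iff₀ (hpos v hv)).1 (hmin v hv)
      · rw [Finsupp.notMem_support_iff.1 hv]; simpa using hf0 v
    set g := f - t • α with hg
    have hg0 : 0 ≤ g := fun v => by simpa [hg] using hle v
    have hga : g a = 0 := by
      simp [hg, ht, div_mul_cancel₀ _ (hpos a ha).ne']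
    have hgs : g.support ⊆ f.support := by
      intro v hv
      rw [Finsupp.mem_support_iff] at hv ⊢
      intro h0
      apply hv
      have h1 := hle v
      have h2 := mul_nonneg ht0.le (hα.nonneg v)
      simp only [hg, Finsupp.sub_apply, Finsupp.smul_apply, smul_eq_mul]
      linarith
    have hyg : lc α ∉ g.support := hα.notMem hJ (hJ.down _ hf _ hgs)
    refine ⟨g + Finsupp.single (lc α) t, ?_, ?_, ?_⟩
    · right
      refine ⟨g.support, fun h => ?_, ?_, ?_⟩
      · exact Finsupp.mem_support_iff.1 (h ha) hga
      · exact hJ.down _ hf _ (Finset.union_subset hgs hF)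
      · rw [Finsupp.support_add_eq, Finsupp.support_single _ ht0.ne', Finset.union_comm]
        · rfl
        · rw [Finsupp.support_single _ ht0.ne']
          simpa using hyg
    · exact add_nonneg hg0 (by simp [ht0.le])
    · rw [map_add, lc_single, hg, map_sub, map_smul]; abel
  · exact ⟨f, Or.inl ⟨hf, hF⟩, hf0, rfl⟩

/-- Every nonnegative combination over a cone of the subdivision is normalised as a multiple of
the new ray plus a combination over a cone of `J` missing a ray of `α.support`. -/
lemma StarDatum.decompose (hα : StarDatum L J α) (hJ : IsFan L J) {S : Finset E}
    (hS : S ∈ star J α) {f : E →₀ ℝ} (hf : 0 ≤ f) (hfS : f.support ⊆ S) :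
    ∃ g : E →₀ ℝ, ∃ D ∈ J, 0 ≤ g ∧ f = Finsupp.single (lc α) (f (lc α)) + g ∧
      (f (lc α) • α + g).support ⊆ D ∧ ∃ a ∈ α.support, g a = 0 := by
  refine ⟨f.erase (lc α), ?_⟩
  have h0 : 0 ≤ f.erase (lc α) := fun v => by
    rw [Finsupp.erase_apply]; split_ifs; exacts [le_rfl, hf v]
  rcases mem_star_cases hJ hS with ⟨h1, h2⟩ | ⟨S', h1, h2, h3, rfl⟩
  · have hy : f (lc α) = 0 := Finsupp.notMem_support_iff.1 fun h => hα.notMem hJ h1 (hfS h)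
    obtain ⟨a, ha, ha'⟩ := Finset.not_subset.1 h2
    refine ⟨S, h1, h0, (Finsupp.single_add_erase _ _).symm, ?_, a, ha, ?_⟩
    · rw [hy, zero_smul, zero_add, Finsupp.support_erase]
      exact (Finset.erase_subset _ _).trans hfS
    · rw [Finsupp.erase_apply]; split_ifs
      · rfl
      · exact Finsupp.notMem_support_iff.1 fun h => ha' (hfS h)
  · obtain ⟨a, ha, ha'⟩ := Finset.not_subset.1 h2
    have hsub : (f.erase (lc α)).support ⊆ S' := by
      rw [Finsupp.support_erase]
      intro v hv
      exact (Finset.mem_insert.1 (hfS (Finset.mem_of_mem_erase hv))).resolve_left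
        (Finset.ne_of_mem_erase hv)
    refine ⟨_, h3, h0, (Finsupp.single_add_erase _ _).symm, ?_, a, ha, ?_⟩
    · refine Finsupp.support_add.trans (Finset.union_subset ?_ ?_)
      · exact Finsupp.support_smul.trans Finset.subset_union_right
      · exact hsub.trans Finset.subset_union_left
    · exact Finsupp.notMem_support_iff.1 fun h => ha' (hsub h)

lemma StarDatum.isFan_star (hα : StarDatum L J α) (hJ : IsFan L J) : IsFan L (star J α) where
  finite := by
    refine (hJ.finite.subset fun S h => h.1).union ?_
    refine (hJ.finite.image (insert (lc α))).subset ?_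
    rintro S ⟨S', -, h2, rfl⟩
    exact ⟨S', hJ.down _ h2 _ Finset.subset_union_left, rfl⟩
  down := by
    intro S hS S' hS'
    rcases hS with ⟨h1, h2⟩ | ⟨R, h1, h2, rfl⟩
    · exact Or.inl ⟨hJ.down _ h1 _ hS', fun h => h2 (h.trans hS')⟩
    · have hsub : S'.erase (lc α) ⊆ R := by
        intro v hv
        exact (Finset.mem_insert.1 (hS' (Finset.mem_of_mem_erase hv))).resolve_left
          (Finset.ne_of_mem_erase hv)
      by_cases hy : lc α ∈ S'
      · refine Or.inr ⟨S'.erase (lc α), fun h => h1 (h.trans hsub), ?_, ?_⟩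
        · exact hJ.down _ h2 _ (Finset.union_subset_union_left hsub)
        · rw [Finset.insert_erase hy]
      · rw [Finset.erase_eq_of_notMem hy] at hsub
        exact Or.inl ⟨hJ.down _ h2 _ (hsub.trans Finset.subset_union_left),
          fun h => h1 (h.trans hsub)⟩
  uniq := by
    have key : ∀ S ∈ star J α, ∀ S' ∈ star J α, ∀ f f' : E →₀ ℝ, 0 ≤ f → 0 ≤ f' →
        f.support ⊆ S → f'.support ⊆ S' → lc f = lc f' → f (lc α) ≤ f' (lc α) → f = f' := by
      intro S hS S' hS' f f' hf hf' hfS hfS' he hle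
      obtain ⟨g, D, hD, hg, hfg, hgD, a, ha, hga⟩ := hα.decompose hJ hS hf hfS
      obtain ⟨g', D', hD', hg', hfg', hgD', -⟩ := hα.decompose hJ hS' hf' hfS'
      set t := f (lc α)
      set t' := f' (lc α)
      have h := hJ.uniq D hD D' hD' _ _ (add_nonneg (smul_nonneg (hf _) hα.nonneg) hg)
        (add_nonneg (smul_nonneg (hf' _) hα.nonneg) hg') hgD hgD' (by
          rw [map_add, map_add, map_smul, map_smul, ← lc_single, ← lc_single, ← map_add,
            ← map_add, ← hfg, ← hfg', he])
      have ht : t = t' := by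
        refine le_antisymm hle ?_
        have h1 := DFunLike.congr_fun h a
        simp only [Finsupp.add_apply, Finsupp.smul_apply, smul_eq_mul, hga] at h1
        have h2 := hg' a
        have h3 : 0 < α a := lt_of_le_of_ne (hα.nonneg a) (Ne.symm (Finsupp.mem_support_iff.1 ha))
        simp at h2
        exact le_of_mul_le_mul_right (by linarith) h3
      have h' : t' • α + g = t' • α + g' := by rw [← h, ← ht]
      rw [hfg, hfg', ht, add_left_cancel h']
    intro S hS S' hS' f f' hf hf' hfS hfS' he
    rcases le_total (f (lc α)) (f' (lc α)) with h | h
    · exact key S hS S' hS' f f' hf hf' hfS hfS' he h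
    · exact (key S' hS' S hS f' f hf' hf hfS' hfS he.symm h).symm
  mem := by
    intro S hS v hv
    rcases mem_star_vertex hJ hS hv with rfl | ⟨S', h, h'⟩
    exacts [hα.mem, hJ.mem _ h _ h']

lemma box_mono {S S' : Finset E} (h : S ⊆ S') : box L S ⊆ box L S' := by
  rintro x ⟨h1, β, h2, h3⟩
  exact ⟨h1, β, h2.trans h, h3⟩

/-- Reducing coefficients modulo one. -/
noncomputable def fr (γ : E →₀ ℝ) : E →₀ ℝ := γ.mapRange Int.fract (by simp)

lemma lc_fr_mem {D : Finset E} (hD : ∀ v ∈ D, v ∈ L) {γ : E →₀ ℝ} (hγ : γ.support ⊆ D)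
    (hx : lc γ ∈ L) : lc (fr γ) ∈ box L D := by
  have hs : (fr γ).support ⊆ D := Finsupp.support_mapRange.trans hγ
  refine ⟨?_, fr γ, hs, fun v => by simp [fr],
    fun v => by simpa [fr] using Int.fract_lt_one _, rfl⟩
  have : lc (fr γ) = lc γ - ∑ v ∈ D, (⌊γ v⌋ : ℤ) • v := by
    rw [lc_eq_sum _ hs, lc_eq_sum _ hγ, ← Finset.sum_sub_distrib]
    refine Finset.sum_congr rfl fun v _ => ?_
    rw [← Int.cast_smul_eq_zsmul ℝ, ← sub_smul]
    rfl
  rw [this]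
  exact L.sub_mem hx (L.sum_mem fun v hv => L.zsmul_mem (hD v hv) _)

lemma exists_box_injection (hJ : IsFan L J) {D : Finset E} (hD : D ∈ J) (hαD : α.support ⊆ D)
    (hα0 : 0 ≤ α) (hα1 : ∀ v, α v ≤ 1) (hy : lc α ∉ D) {a : E}
    (ha : a ∈ α.support) :
    ∃ i : E → E, Set.MapsTo i (box L (insert (lc α) (D.erase a))) (box L D) ∧
      Set.InjOn i (box L (insert (lc α) (D.erase a))) ∧
      (α a < 1 → lc (fr α) ∉ i '' box L (insert (lc α) (D.erase a))) := by
  set B := box L (insert (lc α) (D.erase a)) with hB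
  have hapos : 0 < α a := lt_of_le_of_ne (hα0 a) (Ne.symm (Finsupp.mem_support_iff.1 ha))
  have hya : a ≠ lc α := fun h => hy (h ▸ hαD ha)
  have h1 : ∀ x ∈ B, ∃ β : E →₀ ℝ, β.support ⊆ insert (lc α) (D.erase a) ∧ 0 ≤ β ∧
    (∀ v, β v < 1) ∧ lc β = x := fun x hx => hx.2
  choose! β hβs hβ0 hβ1 hβx using h1
  let γ : E → E →₀ ℝ := fun x => β x (lc α) • α + (β x).erase (lc α)
  have hγx : ∀ x ∈ B, lc (γ x) = x := by
    intro x hx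
    conv_rhs => rw [← hβx x hx, ← Finsupp.single_add_erase (lc α) (β x), map_add, lc_single]
    simp only [γ, map_add, map_smul]
  have hγD : ∀ x ∈ B, (γ x).support ⊆ D := by
    intro x hx
    refine Finsupp.support_add.trans (Finset.union_subset (Finsupp.support_smul.trans hαD) ?_)
    rw [Finsupp.support_erase]
    intro v hv
    exact Finset.mem_of_mem_erase ((Finset.mem_insert.1 (hβs x hx
      (Finset.mem_of_mem_erase hv))).resolve_left (Finset.ne_of_mem_erase hv))
  have hγa : ∀ x ∈ B, γ x a = β x (lc α) * α a := by
    intro x hx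
    have : β x a = 0 := Finsupp.notMem_support_iff.1 fun h => by
      have := hβs x hx h
      simp [hya] at this
    simp [γ, hya, this]
  have hfra : ∀ x ∈ B, fr (γ x) a = β x (lc α) * α a := by
    intro x hx
    simp only [fr, Finsupp.mapRange_apply]
    rw [hγa x hx, Int.fract_eq_self]
    refine ⟨mul_nonneg (hβ0 x hx _) hapos.le, ?_⟩
    have := hβ1 x hx (lc α)
    have h2 := hα1 a
    have h3 := hβ0 x hx (lc α)
    simp at h3
    nlinarith
  have hfrs : ∀ x ∈ B, (fr (γ x)).support ⊆ D := fun x hx =>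
    Finsupp.support_mapRange.trans (hγD x hx)
  refine ⟨fun x => lc (fr (γ x)), ?_, ?_, ?_⟩
  · intro x hx
    exact lc_fr_mem (hJ.mem D hD) (hγD x hx) (by rw [hγx x hx]; exact hx.1)
  · intro x hx x' hx' he
    have he' : fr (γ x) = fr (γ x') := hJ.linInd hD (hfrs x hx) (hfrs x' hx') he
    have hyy : β x (lc α) = β x' (lc α) := by
      have := DFunLike.congr_fun he' a
      rw [hfra x hx, hfra x' hx'] at this
      exact mul_right_cancel₀ hapos.ne' this
    have hβ : β x = β x' := by
      ext v
      by_cases hv : v = lc α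
      · rw [hv, hyy]
      · have := DFunLike.congr_fun he' v
        simp only [fr, Finsupp.mapRange_apply, γ, Finsupp.add_apply, Finsupp.smul_apply,
          Finsupp.erase_ne hv, hyy] at this
        obtain ⟨z, hz⟩ := Int.fract_eq_fract.1 this
        have hz' : β x v - β x' v = z := by linarith
        have b1 := hβ1 x hx v
        have b2 := hβ1 x' hx' v
        have b3 := hβ0 x hx v
        have b4 := hβ0 x' hx' v
        simp at b3 b4
        have z1 : (z : ℝ) < 1 := by linarith
        have z2 : (-1 : ℝ) < z := by linarith
        have z0 : z = 0 := by
          have : z < 1 := by exact_mod_cast z1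
          have : -1 < z := by exact_mod_cast z2
          omega
        rw [z0] at hz'
        simp at hz'
        linarith
    rw [← hβx x hx, ← hβx x' hx', hβ]
  · rintro hlt ⟨x, hx, he⟩
    have he' : fr (γ x) = fr α :=
      hJ.linInd hD (hfrs x hx) (Finsupp.support_mapRange.trans hαD) he
    have := DFunLike.congr_fun he' a
    rw [hfra x hx] at this
    simp only [fr, Finsupp.mapRange_apply] at this
    rw [Int.fract_eq_self.2 ⟨hapos.le, hlt⟩] at this
    have h2 := hβ1 x hx (lc α)
    nlinarith

lemma box_encard_le (hJ : IsFan L J) {D : Finset E} (hD : D ∈ J) (hαD : α.support ⊆ D)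
    (hα : StarDatum L J α) {a : E} (ha : a ∈ α.support) :
    (box L (insert (lc α) (D.erase a))).encard ≤ (box L D).encard := by
  obtain ⟨i, h1, h2, -⟩ := exists_box_injection hJ hD hαD hα.nonneg hα.le_one
    (hα.notMem hJ hD) ha
  exact Set.encard_le_encard_of_injOn h1 h2

lemma box_encard_lt (hJ : IsFan L J) {D : Finset E} (hD : D ∈ J) (hαD : α.support ⊆ D)
    (hα : StarDatum L J α) {a : E} (ha : a ∈ α.support) (ha1 : α a < 1)
    {N : ℕ} (hN : (box L D).encard ≤ N) :
    (box L (insert (lc α) (D.erase a))).encard < N := by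
  obtain ⟨i, h1, h2, h3⟩ := exists_box_injection hJ hD hαD hα.nonneg hα.le_one
    (hα.notMem hJ hD) ha
  refine lt_of_lt_of_le ?_ hN
  rw [← h2.encard_image]
  have hfin : (box L D).Finite := Set.finite_of_encard_le_coe hN
  refine (hfin.subset h1.image_subset).encard_lt_encard ⟨h1.image_subset, fun h => ?_⟩
  exact h3 ha1 (h (lc_fr_mem (hJ.mem D hD) hαD hα.mem))

/-- Cones of a stellar subdivision with at least as many box points as the maximum before. -/
lemma StarDatum.large_cases (hα : StarDatum L J α) (hJ : IsFan L J) {N : ℕ}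
    (hN : ∀ S ∈ J, (box L S).encard ≤ N) {S : Finset E} (hS : S ∈ star J α)
    (hbad : N ≤ (box L S).encard) :
    (S ∈ J ∧ ¬ α.support ⊆ S) ∨
      (lc α ∈ S ∧ ¬ α.support ⊆ S ∧ S.erase (lc α) ∪ α.support ∈ J ∧
        N ≤ (box L (S.erase (lc α) ∪ α.support)).encard ∧ ∀ a ∈ α.support, a ∉ S → α a = 1) := by
  rcases mem_star_cases hJ hS with h | ⟨S', h1, h2, h3, rfl⟩
  · exact Or.inl h
  · right
    have hy : lc α ∉ S' := hα.notMem hJ h1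
    have hyF : lc α ∉ α.support := hα.notMem hJ hα.supp
    have hsub : ∀ a ∈ α.support, a ∉ S' →
        insert (lc α) S' ⊆ insert (lc α) ((S' ∪ α.support).erase a) := by
      intro a ha ha'
      refine Finset.insert_subset_insert _ fun v hv => ?_
      rw [Finset.mem_erase]
      exact ⟨fun h => ha' (h ▸ hv), Finset.mem_union_left _ hv⟩
    rw [Finset.erase_insert hy]
    refine ⟨Finset.mem_insert_self _ _, ?_, h3, ?_, ?_⟩
    · intro h
      refine h2 fun v hv => ?_
      exact (Finset.mem_insert.1 (h hv)).resolve_left fun h => hyF (h ▸ hv)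
    · obtain ⟨a, ha, ha'⟩ := Finset.not_subset.1 h2
      exact hbad.trans ((Set.encard_le_encard (box_mono (hsub a ha ha'))).trans
        (box_encard_le hJ h3 Finset.subset_union_right hα ha))
    · intro a ha ha'
      by_contra hne
      have ha'' : a ∉ S' := fun h => ha' (Finset.mem_insert_of_mem h)
      have := box_encard_lt hJ h3 Finset.subset_union_right hα ha
        (lt_of_le_of_ne (hα.le_one a) hne) (hN _ h3)
      exact absurd (hbad.trans (Set.encard_le_encard (box_mono (hsub a ha ha'')))) (not_le.2 this)

lemma StarDatum.box_le (hα : StarDatum L J α) (hJ : IsFan L J) {N : ℕ}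
    (hN : ∀ S ∈ J, (box L S).encard ≤ N) {S : Finset E} (hS : S ∈ star J α) :
    (box L S).encard ≤ N := by
  rcases mem_star_cases hJ hS with h | ⟨S', h1, h2, h3, rfl⟩
  · exact hN _ h.1
  · obtain ⟨a, ha, ha'⟩ := Finset.not_subset.1 h2
    refine le_trans (Set.encard_le_encard (box_mono ?_))
      ((box_encard_le hJ h3 Finset.subset_union_right hα ha).trans (hN _ h3))
    refine Finset.insert_subset_insert _ fun v hv => ?_
    rw [Finset.mem_erase]
    exact ⟨fun h => ha' (h ▸ hv), Finset.mem_union_left _ hv⟩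

/-- A set closed under nonnegative linear combinations. -/
def IsCone (K : Set E) : Prop := ∀ f : E →₀ ℝ, 0 ≤ f → (∀ v ∈ f.support, v ∈ K) → lc f ∈ K

/-- The properties of a fan that stellar subdivisions maintain: bounded boxes, refinement of a
family of cones, and covering of a set of points. -/
structure Good (L : AddSubgroup E) (N : ℕ) (𝒦 : Set (Set E)) (Z : Set E) (J : Set (Finset E)) :
    Prop where
  fan : IsFan L J
  box_le : ∀ S ∈ J, (box L S).encard ≤ N
  refines : ∀ S ∈ J, ∃ K ∈ 𝒦, ∀ v ∈ S, v ∈ K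
  cover : ∀ p ∈ Z, InFan J p

lemma Good.star {N : ℕ} {𝒦 : Set (Set E)} {Z : Set E} (h𝒦 : ∀ K ∈ 𝒦, IsCone K)
    (hJ : Good L N 𝒦 Z J) (hα : StarDatum L J α) : Good L N 𝒦 Z (star J α) where
  fan := hα.isFan_star hJ.fan
  box_le := fun _ hS => hα.box_le hJ.fan hJ.box_le hS
  refines := by
    intro S hS
    rcases mem_star_cases hJ.fan hS with h | ⟨S', h1, h2, h3, rfl⟩
    · exact hJ.refines _ h.1
    · obtain ⟨K, hK, hv⟩ := hJ.refines _ h3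
      refine ⟨K, hK, fun v hv' => ?_⟩
      rcases Finset.mem_insert.1 hv' with rfl | h
      · exact h𝒦 K hK α hα.nonneg fun w hw => hv w (Finset.mem_union_right _ hw)
      · exact hv v (Finset.mem_union_left _ h)
  cover := fun p hp => hα.inFan_star hJ.fan (hJ.cover p hp)

/-- Repeated stellar subdivision terminates when every newly created active face has smaller rank
than the face subdivided. -/
lemma exists_forall_not_active (P : Set (Finset E) → Prop) (Act : (E →₀ ℝ) → Prop)
    (rank : Finset E → ℕ) (hfan : ∀ J, P J → IsFan L J)
    (hdat : ∀ J, P J → ∀ α, α.support ∈ J → Act α → StarDatum L J α)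
    (hstep : ∀ J, P J → ∀ α, α.support ∈ J → Act α → P (star J α))
    (hrank : ∀ J, P J → ∀ α, α.support ∈ J → Act α → ∀ α', Act α' → α'.support ∈ star J α →
      lc α ∈ α'.support → rank α'.support < rank α.support)
    (hJ : P J) : ∃ J', P J' ∧ ∀ α, Act α → α.support ∉ J' := by
  let A : Set (Finset E) → Set (Finset E) := fun J => {F | F ∈ J ∧ ∃ α, Act α ∧ α.support = F}
  have hA : ∀ J, P J → (A J).Finite := fun J h => (hfan J h).finite.subset fun F hF => hF.1
  let M : Set (Finset E) → Multiset ℕ := fun J =>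
    if h : P J then (hA J h).toFinset.val.map rank else 0
  induction hM : M J using (Multiset.wellFounded_isDershowitzMannaLT (α := ℕ)).induction
    generalizing J with
  | _ s ih =>
    subst hM
    by_cases hact : ∃ α, Act α ∧ α.support ∈ J
    · obtain ⟨α, hα, hαJ⟩ := hact
      have hd := hdat J hJ α hαJ hα
      have hP' := hstep J hJ α hαJ hα
      refine ih (M (star J α)) ?_ hP' rfl
      set B := (hA J hJ).toFinset with hB
      set B' := (hA _ hP').toFinset with hB'
      refine ⟨(B ∩ B').val.map rank, (B' \ B).val.map rank, (B \ B').val.map rank, ?_, ?_, ?_, ?_⟩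
      · have : α.support ∈ B \ B' := by
          rw [Finset.mem_sdiff, hB, hB', Set.Finite.mem_toFinset, Set.Finite.mem_toFinset]
          refine ⟨⟨hαJ, α, hα, rfl⟩, fun h => ?_⟩
          rcases mem_star_cases (hfan J hJ) h.1 with h | ⟨S', h1, h2, h3, h4⟩
          · exact h.2 subset_rfl
          · exact hd.notMem (hfan J hJ) hαJ (h4 ▸ Finset.mem_insert_self _ _)
        intro h0
        rw [Multiset.empty_eq_zero, Multiset.map_eq_zero, Finset.val_eq_zero] at h0
        rw [h0] at this
        simp at this
      · simp only [M, hP', dif_pos]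
        rw [← Multiset.map_add, ← hB']
        congr 1
        rw [Finset.inter_comm, add_comm]
        rw [← Finset.disjUnion_val _ _ (Finset.disjoint_sdiff_inter B' B),
          Finset.disjUnion_eq_union, Finset.sdiff_union_inter]
      · simp only [M, hJ, dif_pos]
        rw [← Multiset.map_add, ← hB]
        congr 1
        rw [add_comm]
        rw [← Finset.disjUnion_val _ _ (Finset.disjoint_sdiff_inter B B'),
          Finset.disjUnion_eq_union, Finset.sdiff_union_inter]
      · intro y hy
        obtain ⟨F, hF, rfl⟩ := Multiset.mem_map.1 hy
        rw [Finset.mem_val, Finset.mem_sdiff, hB, hB', Set.Finite.mem_toFinset,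
          Set.Finite.mem_toFinset] at hF
        obtain ⟨⟨hF1, α', hα', rfl⟩, hF2⟩ := hF
        refine ⟨rank α.support, Multiset.mem_map.2 ⟨α.support, ?_, rfl⟩, ?_⟩
        · rw [Finset.mem_val, Finset.mem_sdiff, hB, hB', Set.Finite.mem_toFinset,
            Set.Finite.mem_toFinset]
          refine ⟨⟨hαJ, α, hα, rfl⟩, fun h => ?_⟩
          rcases mem_star_cases (hfan J hJ) h.1 with h | ⟨S', h1, h2, h3, h4⟩
          · exact h.2 subset_rfl
          · exact hd.notMem (hfan J hJ) hαJ (h4 ▸ Finset.mem_insert_self _ _)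
        · refine hrank J hJ α hαJ hα α' hα' hF1 ?_
          by_contra hy
          exact hF2 ⟨(mem_of_mem_star_of_notMem (hfan J hJ) hF1 hy).1, α', hα', rfl⟩
    · push Not at hact
      exact ⟨J, hJ, hact⟩

end StarTheory

end UnimodularTriangulation

namespace UnimodularTriangulation

open scoped Classical

lemma floor_lt_floor_of_add_one_le {x y : ℝ} (hy : 0 ≤ y) (h : y + 1 ≤ x) : ⌊y⌋₊ < ⌊x⌋₊ := by
  rw [Nat.lt_iff_add_one_le, ← Nat.floor_add_one hy]
  exact Nat.floor_mono h

section Pair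

variable {E : Type*}

/-- The coefficients of the sum of two vectors. -/
noncomputable def pair (z v : E) : E →₀ ℝ := Finsupp.single z 1 + Finsupp.single v 1

lemma support_pair {z v : E} (h : z ≠ v) : (pair z v).support = {z, v} := by
  ext w
  simp only [pair, Finsupp.mem_support_iff, Finsupp.add_apply, Finsupp.single_apply,
    Finset.mem_insert, Finset.mem_singleton]
  grind

variable [AddCommGroup E] [Module ℝ E] {L : AddSubgroup E} {J : Set (Finset E)}

lemma lc_pair (z v : E) : lc (pair z v) = z + v := by
  simp [pair, lc_single]

lemma starDatum_pair (hJ : IsFan L J) {z v : E} (h : z ≠ v) (hzv : (pair z v).support ∈ J) :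
    StarDatum L J (pair z v) where
  supp := hzv
  card := by rw [support_pair h, Finset.card_pair h]
  nonneg := by
    intro w
    simp only [pair, Finsupp.add_apply, Finsupp.single_apply, Finsupp.coe_zero, Pi.zero_apply]
    split_ifs <;> norm_num
  le_one := by
    intro w
    simp only [pair, Finsupp.add_apply, Finsupp.single_apply]
    grind
  mem := by
    rw [lc_pair]
    rw [support_pair h] at hzv
    exact L.add_mem (hJ.mem _ hzv _ (by simp)) (hJ.mem _ hzv _ (by simp))

lemma map_lc (φ : E →ₗ[ℝ] ℝ) (f : E →₀ ℝ) : φ (lc f) = ∑ v ∈ f.support, f v * φ v := by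
  rw [lc_eq_sum f subset_rfl, map_sum]
  simp

lemma map_lc_of_subset (φ : E →ₗ[ℝ] ℝ) (f : E →₀ ℝ) {S : Finset E} (h : f.support ⊆ S) :
    φ (lc f) = ∑ v ∈ S, f v * φ v := by
  rw [lc_eq_sum f h, map_sum]
  simp

end Pair

section Join

variable {E : Type*} [AddCommGroup E] [Module ℝ E] {L : AddSubgroup E} {T : Set (Finset E)}

/-- All unions of a member of `T` with a subset of `U`. -/
def join (T : Set (Finset E)) (U : Finset E) : Set (Finset E) :=
  {S | ∃ A ∈ T, ∃ B ⊆ U, S = A ∪ B}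

/-- Integral functionals exhibiting the members of `U` as independent from `T`. -/
structure Separates (L : AddSubgroup E) (T : Set (Finset E)) (U : Finset E)
    (φ : E → E →ₗ[ℝ] ℝ) : Prop where
  self : ∀ u ∈ U, ∀ u' ∈ U, φ u u' = if u' = u then 1 else 0
  zero : ∀ u ∈ U, ∀ A ∈ T, ∀ v ∈ A, φ u v = 0
  int : ∀ u ∈ U, ∀ x ∈ L, ∃ z : ℤ, φ u x = z
  mem : ∀ u ∈ U, u ∈ L

variable {U : Finset E} {φ : E → E →ₗ[ℝ] ℝ}

lemma Separates.apply_lc (h : Separates L T U φ) {A B : Finset E} (hA : A ∈ T) (hB : B ⊆ U)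
    {f : E →₀ ℝ} (hf : f.support ⊆ A ∪ B) {u : E} (hu : u ∈ U) : φ u (lc f) = f u := by
  have huA : u ∉ A := fun hh => by
    have h1 := h.zero u hu A hA u hh
    have h2 := h.self u hu u hu
    simp [h1] at h2
  rw [map_lc_of_subset _ f hf]
  by_cases huB : u ∈ B
  · rw [Finset.sum_eq_single u]
    · rw [h.self u hu u hu]; simp
    · intro v hv hvu
      rcases Finset.mem_union.1 hv with hv | hv
      · rw [h.zero u hu A hA v hv, mul_zero]
      · rw [h.self u hu v (hB hv), if_neg hvu, mul_zero]
    · intro hh; exact absurd (Finset.mem_union_right _ huB) hh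
  · have : f u = 0 := Finsupp.notMem_support_iff.1 fun hh => by
      rcases Finset.mem_union.1 (hf hh) with h' | h'
      exacts [huA h', huB h']
    rw [this]
    refine Finset.sum_eq_zero fun v hv => ?_
    rcases Finset.mem_union.1 hv with hv | hv
    · rw [h.zero u hu A hA v hv, mul_zero]
    · have hne : v ≠ u := fun hh => huB (hh ▸ hv)
      rw [h.self u hu v (hB hv), if_neg hne, mul_zero]

lemma Separates.isFan_join (h : Separates L T U φ) (hT : IsFan L T) : IsFan L (join T U) where
  finite := by
    refine ((hT.finite.prod U.powerset.finite_toSet).image fun p => p.1 ∪ p.2).subset ?_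
    rintro S ⟨A, hA, B, hB, rfl⟩
    exact ⟨(A, B), ⟨hA, by simpa using hB⟩, rfl⟩
  down := by
    rintro S ⟨A, hA, B, hB, rfl⟩ S' hS'
    refine ⟨S' ∩ A, hT.down _ hA _ Finset.inter_subset_right, S' ∩ B,
      Finset.inter_subset_right.trans hB, ?_⟩
    rw [← Finset.inter_union_distrib_left, Finset.inter_eq_left.2 hS']
  uniq := by
    rintro S ⟨A, hA, B, hB, rfl⟩ S' ⟨A', hA', B', hB', rfl⟩ f f' hf hf' hfs hfs' he
    have hU : ∀ u ∈ U, f u = f' u := fun u hu => by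
      rw [← h.apply_lc hA hB hfs hu, he, h.apply_lc hA' hB' hfs' hu]
    have hg : f.filter (· ∈ U) = f'.filter (· ∈ U) := by
      ext v
      simp only [Finsupp.filter_apply]
      split_ifs with hv
      exacts [hU v hv, rfl]
    have hsub : ∀ {A B : Finset E} {f : E →₀ ℝ}, B ⊆ U → f.support ⊆ A ∪ B →
        (f.filter (¬ · ∈ U)).support ⊆ A := by
      intro A B f hB hf v hv
      rw [Finsupp.support_filter, Finset.mem_filter] at hv
      exact (Finset.mem_union.1 (hf hv.1)).resolve_right fun hh => hv.2 (hB hh)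
    have hnn : ∀ {f : E →₀ ℝ}, 0 ≤ f → 0 ≤ f.filter (¬ · ∈ U) := by
      intro f hf v
      simp only [Finsupp.filter_apply]
      split_ifs
      exacts [le_rfl, hf v]
    have := hT.uniq A hA A' hA' _ _ (hnn hf) (hnn hf') (hsub hB hfs) (hsub hB' hfs') (by
      rw [← Finsupp.filter_add_filter_not f (· ∈ U),
        ← Finsupp.filter_add_filter_not f' (· ∈ U), map_add, map_add, hg] at he
      exact add_left_cancel he)
    rw [← Finsupp.filter_add_filter_not f (· ∈ U),
        ← Finsupp.filter_add_filter_not f' (· ∈ U), hg, this]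
  mem := by
    rintro S ⟨A, hA, B, hB, rfl⟩ v hv
    rcases Finset.mem_union.1 hv with hv | hv
    exacts [hT.mem A hA v hv, h.mem v (hB hv)]

lemma Separates.support_subset (h : Separates L T U φ) {A B : Finset E} (hA : A ∈ T) (hB : B ⊆ U)
    {f : E →₀ ℝ} (hf : f.support ⊆ A ∪ B) (hf0 : 0 ≤ f) (hf1 : ∀ v, f v < 1) (hL : lc f ∈ L) :
    f.support ⊆ A := by
  intro v hv
  refine (Finset.mem_union.1 (hf hv)).resolve_right fun hvB => ?_
  obtain ⟨z, hz⟩ := h.int v (hB hvB) _ hL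
  rw [h.apply_lc hA hB hf (hB hvB)] at hz
  have h1 := hf1 v
  have h2 : 0 < f v := lt_of_le_of_ne (hf0 v) (Ne.symm (Finsupp.mem_support_iff.1 hv))
  rw [hz] at h1 h2
  have : z < 1 := by exact_mod_cast h1
  have : 0 < z := by exact_mod_cast h2
  omega

lemma Separates.box_subset (h : Separates L T U φ) {A B : Finset E} (hA : A ∈ T) (hB : B ⊆ U) :
    box L (A ∪ B) ⊆ box L A := by
  rintro x ⟨hx, β, h1, h2, h3, rfl⟩
  exact ⟨hx, β, h.support_subset hA hB h1 h2 h3 hx, h2, h3, rfl⟩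

lemma InFan.join {p : E} (hp : InFan T p) {g : E →₀ ℝ} (hg : 0 ≤ g) (hgU : g.support ⊆ U) :
    InFan (join T U) (p + lc g) := by
  obtain ⟨f, h1, h2, rfl⟩ := hp
  refine ⟨f + g, ⟨f.support, h1, g.support, hgU, ?_⟩, add_nonneg h2 hg, map_add _ _ _⟩
  ext v
  have hfv := h2 v
  have hgv := hg v
  simp only [Finset.mem_union, Finsupp.mem_support_iff, Finsupp.add_apply, Finsupp.coe_zero,
    Pi.zero_apply] at *
  grind

end Join

/-- Integral coordinates on `E` together with a dual system of lattice vectors. -/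
structure Grading {E : Type*} [AddCommGroup E] [Module ℝ E] (L : AddSubgroup E) where
  co : ℕ → E →ₗ[ℝ] ℝ
  e : ℕ → E
  co_e : ∀ c c', co c (e c') = if c = c' then 1 else 0
  e_mem : ∀ c, e c ∈ L
  int : ∀ c, ∀ x ∈ L, ∃ z : ℤ, co c x = z

namespace Grading

variable {E : Type*} [AddCommGroup E] [Module ℝ E] {L : AddSubgroup E} (G : Grading L)

/-- `v` has coordinates those of the `c`-th unit vector. -/
def IsPart (c : ℕ) (v : E) : Prop := ∀ c', G.co c' v = if c' = c then 1 else 0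

/-- `z` has coordinates those of a unit vector with index in `[b + m, b + m + M)`, apart from
nonpositive coordinates with index in `[b, b + m)`. -/
def IsNode (b m M : ℕ) (z : E) : Prop :=
  (∃ c < M, ∀ c', (c' < b ∨ b + m ≤ c') → G.co c' z = if c' = b + m + c then 1 else 0) ∧
    ∀ i < m, G.co (b + i) z ≤ 0

variable {G} {b m M : ℕ}

lemma IsPart.not_isNode {i : ℕ} (hi : i < m) {v : E} (hv : G.IsPart (b + i) v) :
    ¬ G.IsNode b m M v := by
  rintro ⟨⟨c, -, hc⟩, -⟩
  have h1 := hc (b + m + c) (Or.inr (by omega))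
  rw [hv, if_neg (by omega), if_pos rfl] at h1
  norm_num at h1

lemma IsPart.co_nonneg {c : ℕ} {v : E} (hv : G.IsPart c v) (c' : ℕ) : 0 ≤ G.co c' v := by
  rw [hv]; split_ifs <;> norm_num

/-- Subtracting lattice weights from a node preserves nodes as long as the weights stay
nonnegative. -/
lemma IsNode.add {z x : E} (hz : G.IsNode b m M z)
    (hx : ∀ c', (c' < b ∨ b + m ≤ c') → G.co c' x = 0)
    (hzx : ∀ i < m, G.co (b + i) z + G.co (b + i) x ≤ 0) : G.IsNode b m M (z + x) := by
  obtain ⟨⟨c, hc, h1⟩, -⟩ := hz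
  refine ⟨⟨c, hc, fun c' hc' => ?_⟩, fun i hi => ?_⟩
  · rw [map_add, hx c' hc', add_zero, h1 c' hc']
  · rw [map_add]; exact hzx i hi

/-- All vertices of `J` are parts or nodes. -/
def Graded (G : Grading L) (b m M : ℕ) (J : Set (Finset E)) : Prop :=
  ∀ S ∈ J, ∀ v ∈ S, (∃ i < m, G.IsPart (b + i) v) ∨ G.IsNode b m M v

lemma Graded.star {J : Set (Finset E)} {α : E →₀ ℝ} (hG : G.Graded b m M J) (hJ : IsFan L J)
    (hy : G.IsNode b m M (lc α)) : G.Graded b m M (star J α) := by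
  intro S hS v hv
  rcases mem_star_vertex hJ hS hv with rfl | ⟨S', h1, h2⟩
  exacts [Or.inr hy, hG _ h1 _ h2]

lemma node_zero_of_ancestor {J : Set (Finset E)} {α : E →₀ ℝ} (hG : G.Graded b m M J)
    (hα : StarDatum L J α) (hy : G.IsNode b m M (lc α)) {S : Finset E}
    {i : ℕ} (hi : i < m)
    (hz : ∀ z ∈ S.erase (lc α) ∪ α.support, G.IsNode b m M z → G.co (b + i) z = 0) :
    ∀ z ∈ S, G.IsNode b m M z → G.co (b + i) z = 0 := by
  intro z hzS hzN
  by_cases h : z = lc α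
  · subst h
    refine le_antisymm (hy.2 i hi) ?_
    rw [map_lc]
    refine Finset.sum_nonneg fun v hv => mul_nonneg (hα.nonneg v) ?_
    rcases hG _ hα.supp v hv with ⟨j, -, hj⟩ | hN
    · exact hj.co_nonneg _
    · rw [hz v (Finset.mem_union_right _ hv) hN]
  · exact hz z (Finset.mem_union_left _ (Finset.mem_erase.2 ⟨h, hzS⟩)) hzN

/-- Every node of `S` has vanishing `i`-th weight, where `v ∈ S` belongs to part `i`. -/
def Done (G : Grading L) (b m M : ℕ) (A : Set E) (S : Finset E) : Prop :=
  ∃ i < m, ∃ v ∈ S, v ∈ A ∧ G.IsPart (b + i) v ∧ ∀ z ∈ S, G.IsNode b m M z → G.co (b + i) z = 0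

/-- The subdivision at `z + v`, with `z` a node of positive weight at the part of `v`, keeps
simplices done. -/
lemma done_star_pair {J : Set (Finset E)} (hG : G.Graded b m M J) (hJ : IsFan L J) {A : Set E}
    {z v : E} {i : ℕ} (hi : i < m) (hz : G.IsNode b m M z) (hv : G.IsPart (b + i) v)
    (hzv : (pair z v).support ∈ J) (hw : G.co (b + i) z < 0)
    (hy : G.IsNode b m M (lc (pair z v))) {S : Finset E}
    (hS : G.Done b m M A (S.erase (lc (pair z v)) ∪ (pair z v).support)) : G.Done b m M A S := by
  have hne : z ≠ v := fun h => (hv.not_isNode hi) (h ▸ hz)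
  obtain ⟨i', hi', v', hv'S, hv'A, hv', h0⟩ := hS
  refine ⟨i', hi', v', ?_, hv'A, hv',
    node_zero_of_ancestor hG (starDatum_pair hJ hne hzv) hy hi' h0⟩
  rcases Finset.mem_union.1 hv'S with h | h
  · exact Finset.mem_of_mem_erase h
  · exfalso
    rw [support_pair hne] at h
    rcases Finset.mem_insert.1 h with rfl | h
    · exact hv'.not_isNode hi' hz
    · rw [Finset.mem_singleton] at h
      subst h
      have h1 := hv (b + i)
      rw [hv', if_pos rfl] at h1
      have h2 : b + i = b + i' := by by_contra hh; rw [if_neg hh] at h1; norm_num at h1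
      have := h0 z (Finset.mem_union_right _ (by simp [support_pair hne])) hz
      rw [← h2] at this
      linarith

lemma isNode_pair {z v : E} {i : ℕ} (hi : i < m) (hz : G.IsNode b m M z) (hzL : z ∈ L)
    (hv : G.IsPart (b + i) v) (hw : G.co (b + i) z < 0) : G.IsNode b m M (lc (pair z v)) := by
  rw [lc_pair]
  refine hz.add (fun c' hc' => by rw [hv, if_neg (by omega)]) fun j hj => ?_
  rw [hv]
  split_ifs with h
  · rw [h]
    obtain ⟨w, hw'⟩ := G.int (b + i) z hzL
    rw [hw'] at hw ⊢
    have : w < 0 := by exact_mod_cast hw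
    have : w + 1 ≤ 0 := by omega
    exact_mod_cast this
  · rw [add_zero]; exact hz.2 j hj

/-- Merging parts into nodes: subdivide at `z + v` for all nodes `z` of positive weight at the
part of `v`. -/
lemma exists_merge {J : Set (Finset E)} {N : ℕ} {𝒦 : Set (Set E)} {Z : Set E}
    (h𝒦 : ∀ K ∈ 𝒦, IsCone K) (hJ : Good L N 𝒦 Z J) (hG : G.Graded b m M J)
    (hdone : ∀ S ∈ J, N ≤ (box L S).encard → G.Done b m M Set.univ S) :
    ∃ J', Good L N 𝒦 Z J' ∧ G.Graded b m M J' ∧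
      (∀ S ∈ J', N ≤ (box L S).encard → G.Done b m M Set.univ S) ∧
      ∀ S ∈ J', ∀ i < m, ∀ v ∈ S, ∀ z ∈ S, G.IsPart (b + i) v → G.IsNode b m M z →
        G.co (b + i) z = 0 := by
  refine (exists_forall_not_active (L := L) (J := J)
    (fun J => Good L N 𝒦 Z J ∧ G.Graded b m M J ∧
      ∀ S ∈ J, N ≤ (box L S).encard → G.Done b m M Set.univ S)
    (fun α => ∃ i < m, ∃ v z, G.IsPart (b + i) v ∧ G.IsNode b m M z ∧ z ∈ L ∧
      G.co (b + i) z < 0 ∧ α = pair z v)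
    (fun F => ∑ z ∈ F, ∑ i ∈ Finset.range m, ⌊-G.co (b + i) z⌋₊)
    (fun J h => h.1.fan) ?_ ?_ ?_ ⟨hJ, hG, hdone⟩).elim fun J' ⟨hJ', hact⟩ => ?_
  rotate_left 3
  · refine ⟨J', hJ'.1, hJ'.2.1, hJ'.2.2, ?_⟩
    intro S hS i hi v hv z hz hvp hzn
    by_contra hne
    have hzv : z ≠ v := fun h => hvp.not_isNode hi (h ▸ hzn)
    refine hact (pair z v) ⟨i, hi, v, z, hvp, hzn, hJ'.1.fan.mem S hS z hz,
      lt_of_le_of_ne (hzn.2 i hi) hne, rfl⟩ (hJ'.1.fan.down S hS _ ?_)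
    rw [support_pair hzv]
    exact Finset.insert_subset hz (Finset.singleton_subset_iff.2 hv)
  · rintro J hJ _ hα ⟨i, hi, v, z, hv, hz, hzL, hw, rfl⟩
    exact starDatum_pair hJ.1.fan (fun h => hv.not_isNode hi (h ▸ hz)) hα
  · rintro J ⟨hJ, hG, hdone⟩ _ hα ⟨i, hi, v, z, hv, hz, hzL, hw, rfl⟩
    have hd := starDatum_pair hJ.fan (fun h => hv.not_isNode hi (h ▸ hz)) hα
    have hy := isNode_pair hi hz hzL hv hw
    refine ⟨hJ.star h𝒦 hd, hG.star hJ.fan hy, fun S hS hbad => ?_⟩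
    rcases hd.large_cases hJ.fan hJ.box_le hS hbad with h | ⟨h1, h2, h3, h4, -⟩
    · exact hdone S h.1 hbad
    · exact done_star_pair hG hJ.fan hi hz hv hα hw hy (hdone _ h3 h4)
  · rintro J ⟨hJ, hG, hdone⟩ _ hα ⟨i, hi, v, z, hv, hz, hzL, hw, rfl⟩ _
      ⟨i', hi', v', z', hv', hz', hzL', hw', rfl⟩ hmem hlc
    have hzv : z ≠ v := fun h => hv.not_isNode hi (h ▸ hz)
    have hzv' : z' ≠ v' := fun h => hv'.not_isNode hi' (h ▸ hz')
    have hy := isNode_pair hi hz hzL hv hw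
    have hvz : ∀ {i v}, G.IsPart (b + i) v → ∀ j, ⌊-G.co (b + j) v⌋₊ = 0 := by
      intro i v hv j
      exact Nat.floor_of_nonpos (by have := hv.co_nonneg (b + j); linarith)
    rw [support_pair hzv'] at hlc ⊢
    rw [support_pair hzv, Finset.sum_pair hzv, Finset.sum_pair hzv',
      Finset.sum_eq_zero fun j _ => hvz hv j, Finset.sum_eq_zero fun j _ => hvz hv' j]
    have hz'' : z' = z + v := by
      rcases Finset.mem_insert.1 hlc with h | h
      · rw [← h, lc_pair]
      · rw [Finset.mem_singleton] at h
        exact absurd (h ▸ hy) (hv'.not_isNode hi')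
    rw [add_zero, add_zero, hz'']
    refine Finset.sum_lt_sum (fun j _ => Nat.floor_mono ?_) ⟨i, Finset.mem_range.2 hi, ?_⟩
    · rw [map_add]; have := hv.co_nonneg (b + j); linarith
    · have h1 := hy.2 i hi
      rw [lc_pair] at h1
      refine floor_lt_floor_of_add_one_le (by linarith) ?_
      rw [map_add, hv, if_pos rfl]
      linarith

/-- After merging, the simplices all of whose vertices are nodes of weight zero form a fan with
smaller boxes. -/
lemma exists_merged_fan {J : Set (Finset E)} {N : ℕ} {𝒦 : Set (Set E)} {Z : Set E}
    (h𝒦 : ∀ K ∈ 𝒦, IsCone K) (hJ : Good L N 𝒦 Z J) (hG : G.Graded b m M J)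
    (hdone : ∀ S ∈ J, N ≤ (box L S).encard → G.Done b m M Set.univ S) :
    ∃ T, IsFan L T ∧ (∀ S ∈ T, (box L S).encard < N) ∧
      (∀ S ∈ T, ∃ K ∈ 𝒦, ∀ v ∈ S, v ∈ K) ∧
      (∀ S ∈ T, ∀ v ∈ S, ∃ c < M, G.IsPart (b + m + c) v) ∧
      ∀ p ∈ Z, (∀ i < m, G.co (b + i) p = 0) → InFan T p := by
  obtain ⟨J', hJ', hG', hdone', hzero⟩ := exists_merge h𝒦 hJ hG hdone
  refine ⟨{S | S ∈ J' ∧ ∀ z ∈ S, G.IsNode b m M z ∧ ∀ i < m, G.co (b + i) z = 0},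
    ⟨hJ'.fan.finite.subset fun S h => h.1, ?_, ?_, fun S h => hJ'.fan.mem S h.1⟩, ?_,
    fun S h => hJ'.refines S h.1, ?_, ?_⟩
  · intro S hS S' hS'
    exact ⟨hJ'.fan.down S hS.1 S' hS', fun z hz => hS.2 z (hS' hz)⟩
  · intro S hS S' hS'
    exact hJ'.fan.uniq S hS.1 S' hS'.1
  · intro S hS
    by_contra hlt
    obtain ⟨i, hi, v, hv, -, hvp, -⟩ := hdone' S hS.1 (not_lt.1 hlt)
    exact hvp.not_isNode hi (hS.2 v hv).1
  · intro S hS v hv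
    obtain ⟨⟨⟨c, hc, h1⟩, h2⟩, h3⟩ := hS.2 v hv
    refine ⟨c, hc, fun c' => ?_⟩
    by_cases h : c' < b ∨ b + m ≤ c'
    · exact h1 c' h
    · obtain ⟨i, rfl⟩ := Nat.exists_eq_add_of_le (show b ≤ c' by omega)
      rw [h3 i (by omega), if_neg (by omega)]
  · intro p hp hp0
    obtain ⟨f, hf, hf0, rfl⟩ := hJ'.cover p hp
    have hpos : ∀ v ∈ f.support, 0 < f v := fun v hv =>
      lt_of_le_of_ne (hf0 v) (Ne.symm (Finsupp.mem_support_iff.1 hv))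
    have hnode : ∀ v ∈ f.support, G.IsNode b m M v := by
      intro v hv
      rcases hG' _ hf v hv with ⟨i, hi, hvp⟩ | h
      · exfalso
        have h0 := hp0 i hi
        rw [map_lc] at h0
        have : ∀ w ∈ f.support, 0 ≤ f w * G.co (b + i) w := by
          intro w hw
          refine mul_nonneg (hf0 w) ?_
          rcases hG' _ hf w hw with ⟨j, hj, hwp⟩ | h
          · exact hwp.co_nonneg _
          · rw [hzero _ hf i hi v hv w hw hvp h]
        have := (Finset.sum_eq_zero_iff_of_nonneg this).1 h0 v hv
        rw [hvp, if_pos rfl, mul_one] at this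
        exact (hpos v hv).ne' this
      · exact h
    refine ⟨f, ⟨hf, fun z hz => ⟨hnode z hz, fun i hi => ?_⟩⟩, hf0, rfl⟩
    have h0 := hp0 i hi
    rw [map_lc] at h0
    have := (Finset.sum_eq_zero_iff_of_nonpos fun w hw =>
      mul_nonpos_of_nonneg_of_nonpos (hf0 w) ((hnode w hw).2 i hi)).1 h0 z hz
    exact (mul_eq_zero.1 this).resolve_left (hpos z hz).ne'

end Grading

end UnimodularTriangulation

namespace UnimodularTriangulation

open scoped Classical

open Nat (factorial)

variable {E : Type*} [AddCommGroup E] [Module ℝ E] {L : AddSubgroup E}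

namespace Grading

variable (G : Grading L)

/-- The node with unit coordinate `b + m + c` and weights `w`. -/
noncomputable def nd (b m c : ℕ) (w : ℕ → ℕ) : E :=
  G.e (b + m + c) - ∑ i ∈ Finset.range m, w i • G.e (b + i)

variable {b m : ℕ}

lemma nd_mem (c : ℕ) (w : ℕ → ℕ) : G.nd b m c w ∈ L :=
  L.sub_mem (G.e_mem _) (L.sum_mem fun _ _ => L.nsmul_mem (G.e_mem _) _)

lemma co_nd_low (c : ℕ) (w : ℕ → ℕ) {i : ℕ} (hi : i < m) :
    G.co (b + i) (G.nd b m c w) = -(w i : ℝ) := by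
  rw [nd, map_sub, map_sum, G.co_e, if_neg (by omega), Finset.sum_eq_single i]
  · rw [map_nsmul, G.co_e, if_pos rfl]; simp
  · intro j _ hj
    rw [map_nsmul, G.co_e, if_neg (by omega), smul_zero]
  · intro h; exact absurd (Finset.mem_range.2 hi) h

lemma co_nd_high (c : ℕ) (w : ℕ → ℕ) {c' : ℕ} (hc' : c' < b ∨ b + m ≤ c') :
    G.co c' (G.nd b m c w) = if c' = b + m + c then 1 else 0 := by
  rw [nd, map_sub, map_sum, G.co_e, Finset.sum_eq_zero, sub_zero]
  intro i hi
  have := Finset.mem_range.1 hi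
  rw [map_nsmul, G.co_e, if_neg (by omega), smul_zero]

lemma isNode_nd {M c : ℕ} (hc : c < M) (w : ℕ → ℕ) : G.IsNode b m M (G.nd b m c w) :=
  ⟨⟨c, hc, fun _ h => G.co_nd_high c w h⟩, fun i hi => by
    rw [G.co_nd_low c w hi, neg_nonpos]; exact Nat.cast_nonneg _⟩

end Grading

/-- Weights of the `j`-th unshifted node. -/
def uw (n j i : ℕ) : ℕ := if j ≤ i then factorial n * n ^ (i - j) else 0

/-- Weights of the `j`-th shifted node. -/
def ow (n j i : ℕ) : ℕ := uw n j i + if i = j then 1 else 0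

lemma factorial_dvd_uw (n j i : ℕ) : ∃ a, uw n j i = a * factorial n := by
  unfold uw; split_ifs
  · exact ⟨n ^ (i - j), mul_comm _ _⟩
  · exact ⟨0, by simp⟩

lemma mul_uw_le (n j : ℕ) (hn : 1 ≤ n) {i i' : ℕ} (h : i < i') : n * uw n j i ≤ uw n j i' := by
  unfold uw; split_ifs with h1 h2
  · calc n * (factorial n * n ^ (i - j)) = factorial n * n ^ (i - j + 1) := by ring
      _ ≤ factorial n * n ^ (i' - j) :=
        Nat.mul_le_mul_left _ (Nat.pow_le_pow_right hn (by omega))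
  · omega
  · simp
  · simp

/-- The data of one round of the index reduction: a fan `T` with vertices in parts
`0, …, m - 1`, an ordering `rk` of its vertices compatible with the parts, and the bound `N` on
the boxes to be improved. -/
structure Stage (G : Grading L) where
  b : ℕ
  m : ℕ
  n : ℕ
  N : ℕ
  T : Set (Finset E)
  rk : E → ℕ
  𝒦 : Set (Set E)
  Z : Set E
  cone : ∀ K ∈ 𝒦, IsCone K
  fan : IsFan L T
  part : ∀ S ∈ T, ∀ v ∈ S, ∃ i < m, G.IsPart (b + i) v
  card : ∀ S ∈ T, S.card ≤ n
  n_pos : 1 ≤ n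
  rk_inj : ∀ S ∈ T, ∀ S' ∈ T, ∀ v ∈ S, ∀ v' ∈ S', rk v = rk v' → v = v'
  rk_lt : ∀ S ∈ T, ∀ S' ∈ T, ∀ v ∈ S, ∀ v' ∈ S', ∀ i i', G.IsPart (b + i) v →
    G.IsPart (b + i') v' → i < i' → rk v < rk v'

namespace Stage

variable {G : Grading L} (s : Stage G)

/-- Vertices of the fan `T`. -/
def V : Set E := {v | ∃ S ∈ s.T, v ∈ S}

/-- Nodes. -/
def Node (z : E) : Prop := G.IsNode s.b s.m (2 * s.m) z

/-- The shifted node of part `j`. -/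
noncomputable def o (j : ℕ) : E := G.nd s.b s.m (2 * j) (ow s.n j)

/-- The unshifted node of part `j`. -/
noncomputable def u (j : ℕ) : E := G.nd s.b s.m (2 * j + 1) (uw s.n j)

/-- Coefficients of a nonzero box point. -/
structure Sig (α : E →₀ ℝ) : Prop where
  supp : α.support ∈ s.T
  ne : α.support.Nonempty
  nonneg : 0 ≤ α
  lt_one : ∀ v, α v < 1
  mem : lc α ∈ L

/-- Nodes of the original join and their merges with vertices of rank below `k`. -/
def Clean (k : ℕ) (z : E) : Prop :=
  ∃ j < s.m, z = s.o j ∨ z = s.u j ∨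
    ∃ v ∈ s.V, G.IsPart (s.b + j) v ∧ s.rk v < k ∧ z = s.o j + v

/-- Simplices with a vertex of rank below `k` all of whose nodes have weight zero at its part. -/
def DoneAt (k : ℕ) (S : Finset E) : Prop :=
  G.Done s.b s.m (2 * s.m) {v | v ∈ s.V ∧ s.rk v < k} S

/-- Simplices containing the carrier of a box point with ranks at least `k`, with clean nodes. -/
def Pend (k l : ℕ) (S : Finset E) : Prop :=
  ∃ α, s.Sig α ∧ α.support ⊆ S ∧ (∀ v ∈ α.support, k ≤ s.rk v) ∧ ∀ z ∈ S, s.Node z → s.Clean l z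

/-- The invariant maintained through the whole stage. -/
structure Inv (J : Set (Finset E)) : Prop where
  good : Good L s.N s.𝒦 s.Z J
  graded : ∀ S ∈ J, ∀ v ∈ S, v ∈ s.V ∨ s.Node v

variable {s}

lemma isPart_of_mem {v : E} (hv : v ∈ s.V) : ∃ i < s.m, G.IsPart (s.b + i) v := by
  obtain ⟨S, hS, hvS⟩ := hv
  exact s.part S hS v hvS

lemma not_node {v : E} (hv : v ∈ s.V) : ¬ s.Node v := by
  obtain ⟨i, hi, h⟩ := isPart_of_mem hv
  exact h.not_isNode hi

lemma Inv.isGraded {J : Set (Finset E)} (h : s.Inv J) : G.Graded s.b s.m (2 * s.m) J := by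
  intro S hS v hv
  exact (h.graded S hS v hv).imp isPart_of_mem id

lemma Inv.star {J : Set (Finset E)} (h : s.Inv J) {α : E →₀ ℝ} (hα : StarDatum L J α)
    (hy : s.Node (lc α)) : s.Inv (star J α) where
  good := h.good.star s.cone hα
  graded := by
    intro S hS v hv
    rcases mem_star_vertex h.good.fan hS hv with rfl | ⟨S', h1, h2⟩
    exacts [Or.inr hy, h.graded _ h1 _ h2]

lemma Sig.mem_V {α : E →₀ ℝ} (hα : s.Sig α) {v : E} (hv : v ∈ α.support) : v ∈ s.V :=
  ⟨_, hα.supp, hv⟩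

lemma Sig.pos {α : E →₀ ℝ} (hα : s.Sig α) {v : E} (hv : v ∈ α.support) : 0 < α v :=
  lt_of_le_of_ne (hα.nonneg v) (Ne.symm (Finsupp.mem_support_iff.1 hv))

lemma Sig.co_zero {α : E →₀ ℝ} (hα : s.Sig α) {c : ℕ} (hc : c < s.b ∨ s.b + s.m ≤ c) :
    G.co c (lc α) = 0 := by
  rw [map_lc]
  refine Finset.sum_eq_zero fun v hv => ?_
  obtain ⟨i, hi, h⟩ := isPart_of_mem (hα.mem_V hv)
  rw [h, if_neg (by omega), mul_zero]

lemma Sig.co_nonneg {α : E →₀ ℝ} (hα : s.Sig α) (c : ℕ) : 0 ≤ G.co c (lc α) := by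
  rw [map_lc]
  refine Finset.sum_nonneg fun v hv => mul_nonneg (hα.nonneg v) ?_
  obtain ⟨i, hi, h⟩ := isPart_of_mem (hα.mem_V hv)
  exact h.co_nonneg _

lemma Sig.exists_nat {α : E →₀ ℝ} (hα : s.Sig α) (c : ℕ) :
    ∃ k : ℕ, G.co c (lc α) = k ∧ k ≤ s.n := by
  obtain ⟨z, hz⟩ := G.int c _ hα.mem
  have h0 := hα.co_nonneg c
  have h1 : G.co c (lc α) ≤ s.n := by
    rw [map_lc]
    refine (Finset.sum_le_card_nsmul _ _ 1 fun v hv => ?_).trans ?_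
    · obtain ⟨i, hi, h⟩ := isPart_of_mem (hα.mem_V hv)
      have := hα.lt_one v
      rw [h]
      split_ifs <;> linarith
    · rw [nsmul_eq_mul, mul_one]
      exact_mod_cast s.card _ hα.supp
  rw [hz] at h0 h1
  have h0' : 0 ≤ z := by exact_mod_cast h0
  refine ⟨z.toNat, ?_, ?_⟩
  · rw [hz]
    exact_mod_cast (Int.toNat_of_nonneg h0').symm
  · have : z ≤ s.n := by exact_mod_cast h1
    omega

lemma Sig.co_pos {α : E →₀ ℝ} (hα : s.Sig α) {v : E} (hv : v ∈ α.support) {c : ℕ}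
    (hc : G.IsPart c v) : 0 < G.co c (lc α) := by
  rw [map_lc]
  refine Finset.sum_pos' (fun w hw => mul_nonneg (hα.nonneg w) ?_) ⟨v, hv, ?_⟩
  · obtain ⟨i, hi, h⟩ := isPart_of_mem (hα.mem_V hw)
    exact h.co_nonneg _
  · rw [hc, if_pos rfl, mul_one]; exact hα.pos hv

lemma Sig.co_zero_of_lt {α : E →₀ ℝ} (hα : s.Sig α) {v : E} (hv : v ∈ α.support) {i i' : ℕ}
    (hi : G.IsPart (s.b + i) v) (hmin : ∀ w ∈ α.support, s.rk v ≤ s.rk w) (hii' : i' < i) :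
    G.co (s.b + i') (lc α) = 0 := by
  rw [map_lc]
  refine Finset.sum_eq_zero fun w hw => ?_
  obtain ⟨j, hj, h⟩ := isPart_of_mem (hα.mem_V hw)
  rw [h, if_neg, mul_zero]
  intro hij
  have : i' = j := by omega
  subst this
  exact absurd (s.rk_lt _ hα.supp _ hα.supp w hw v hv _ _ h hi hii') (not_lt.2 (hmin w hw))

lemma node_o {j : ℕ} (hj : j < s.m) : s.Node (s.o j) := G.isNode_nd (by omega) _

lemma node_u {j : ℕ} (hj : j < s.m) : s.Node (s.u j) := G.isNode_nd (by omega) _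

lemma co_o (j : ℕ) {i : ℕ} (hi : i < s.m) :
    G.co (s.b + i) (s.o j) = -(uw s.n j i : ℝ) - if i = j then 1 else 0 := by
  rw [o, G.co_nd_low _ _ hi, ow]
  push_cast
  ring

lemma co_u (j : ℕ) {i : ℕ} (hi : i < s.m) : G.co (s.b + i) (s.u j) = -(uw s.n j i : ℝ) := by
  rw [u, G.co_nd_low _ _ hi]

lemma co_o_neg {i : ℕ} (hi : i < s.m) : G.co (s.b + i) (s.o i) < 0 := by
  rw [co_o _ hi, if_pos rfl]
  have : (0 : ℝ) ≤ uw s.n i i := Nat.cast_nonneg _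
  linarith

lemma co_o_add {j : ℕ} {v : E} (hv : G.IsPart (s.b + j) v) {i : ℕ} (hi : i < s.m) :
    G.co (s.b + i) (s.o j + v) = -(uw s.n j i : ℝ) := by
  rw [map_add, co_o _ hi, hv]
  by_cases h : i = j <;> simp [h]

lemma node_o_add {j : ℕ} (hj : j < s.m) {v : E} (hv : G.IsPart (s.b + j) v) :
    s.Node (s.o j + v) := by
  have := Grading.isNode_pair hj (node_o hj) (G.nd_mem _ _) hv (co_o_neg hj)
  rwa [lc_pair] at this

lemma Clean.node {k : ℕ} {z : E} (hz : s.Clean k z) : s.Node z := by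
  obtain ⟨j, hj, rfl | rfl | ⟨v, -, hv, -, rfl⟩⟩ := hz
  exacts [node_o hj, node_u hj, node_o_add hj hv]

lemma Clean.mono {k k' : ℕ} {z : E} (hz : s.Clean k z) (h : k ≤ k') : s.Clean k' z := by
  obtain ⟨j, hj, h1 | h1 | ⟨v, h1, h2, h3, h4⟩⟩ := hz
  exacts [⟨j, hj, Or.inl h1⟩, ⟨j, hj, Or.inr (Or.inl h1)⟩,
    ⟨j, hj, Or.inr (Or.inr ⟨v, h1, h2, h3.trans_le h, h4⟩)⟩]

lemma Clean.weights {k : ℕ} {z : E} (hz : s.Clean k z) : ∃ j,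
    (∀ i < s.m, G.co (s.b + i) z ≤ -(uw s.n j i : ℝ)) ∧
    ∀ i < s.m, z ≠ s.o i → G.co (s.b + i) z = -(uw s.n j i : ℝ) := by
  obtain ⟨j, hj, rfl | rfl | ⟨v, -, hv, -, rfl⟩⟩ := hz
  · refine ⟨j, fun i hi => ?_, fun i hi hne => ?_⟩
    · rw [co_o _ hi]; split_ifs <;> linarith
    · rw [co_o _ hi, if_neg (fun h => hne (by rw [h])), sub_zero]
  · exact ⟨j, fun i hi => (co_u _ hi).le, fun i hi _ => co_u _ hi⟩
  · exact ⟨j, fun i hi => (co_o_add hv hi).le, fun i hi _ => co_o_add hv hi⟩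

lemma DoneAt.mono {k k' : ℕ} {S : Finset E} (h : s.DoneAt k S) (hk : k ≤ k') : s.DoneAt k' S := by
  obtain ⟨i, hi, v, h1, h2, h3⟩ := h
  exact ⟨i, hi, v, h1, ⟨h2.1, h2.2.trans_le hk⟩, h3⟩

end Stage

end UnimodularTriangulation

namespace UnimodularTriangulation

open scoped Classical

open Nat (factorial)

section Shift

variable {E : Type*} [AddCommGroup E]

/-- The coefficients of `lc α + o` in which `v` is replaced by `o + v`. -/
noncomputable def shiftCoeff (α : E →₀ ℝ) (o v : E) : E →₀ ℝ :=
  α.erase v + Finsupp.single (o + v) (α v) + Finsupp.single o (1 - α v)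

lemma shiftCoeff_apply {α : E →₀ ℝ} {o v : E} (ho : o ∉ α.support) (hov : o + v ∉ α.support)
    (hv : v ≠ 0) (w : E) : shiftCoeff α o v w =
      if w = o + v then α v else if w = o then 1 - α v else if w = v then 0 else α w := by
  have h1 := Finsupp.notMem_support_iff.1 ho
  have h2 := Finsupp.notMem_support_iff.1 hov
  have h3 : o ≠ o + v := fun h => hv (by simpa using h)
  simp only [shiftCoeff, Finsupp.add_apply, Finsupp.single_apply, Finsupp.erase_apply]
  grind

lemma support_shiftCoeff {α : E →₀ ℝ} {o v : E} (ho : o ∉ α.support) (hov : o + v ∉ α.support)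
    (hv : v ≠ 0) (h0 : α v ≠ 0) (h1 : α v ≠ 1) :
    (shiftCoeff α o v).support = insert (o + v) (insert o (α.support.erase v)) := by
  ext w
  simp only [Finsupp.mem_support_iff, shiftCoeff_apply ho hov hv, Finset.mem_insert,
    Finset.mem_erase]
  grind

lemma lc_shiftCoeff [Module ℝ E] (α : E →₀ ℝ) (o v : E) : lc (shiftCoeff α o v) = lc α + o := by
  conv_rhs => rw [← Finsupp.single_add_erase v α]
  simp only [shiftCoeff, map_add, lc_single, smul_add, sub_smul, one_smul]
  abel

end Shift

variable {E : Type*} [AddCommGroup E] [Module ℝ E] {L : AddSubgroup E} {G : Grading L}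

namespace Stage

variable {s : Stage G} {v : E} {α : E →₀ ℝ} {i : ℕ} {J : Set (Finset E)}

variable (s) in
/-- Box points whose carrier has `v` as its vertex of smallest rank. -/
structure SigAt (v : E) (α : E →₀ ℝ) : Prop where
  sig : s.Sig α
  mem : v ∈ α.support
  min : ∀ w ∈ α.support, s.rk v ≤ s.rk w

variable (s) in
/-- Simplices obtained by dropping `v`, and possibly the shifted node, from a simplex containing
the carrier of a box point. -/
def Half (v : E) (i : ℕ) (J : Set (Finset E)) (S : Finset E) : Prop :=
  ∃ α, s.SigAt v α ∧ ∃ R ∈ J, s.o i + v ∈ R ∧ s.o i ∈ R ∧ α.support.erase v ⊆ R ∧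
    R.erase (s.o i) ⊆ S ∧ S ⊆ R

lemma separated_star (hJ : s.Inv J) {α : E →₀ ℝ} (hv : v ∈ s.V)
    (hy : s.Node (lc α)) (hyo : lc α ≠ s.o i)
    (hsep : ∀ S ∈ J, v ∈ S → s.o i ∉ S) : ∀ S ∈ star J α, v ∈ S → s.o i ∉ S := by
  intro S hS hvS hoS
  rcases mem_star_cases hJ.good.fan hS with h | ⟨S', h1, -, -, rfl⟩
  · exact hsep S h.1 hvS hoS
  · refine hsep S' h1 ((Finset.mem_insert.1 hvS).resolve_left ?_)
      ((Finset.mem_insert.1 hoS).resolve_left hyo.symm)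
    rintro rfl
    exact not_node hv hy

/-- Subdividing at `o i + v` separates `v` from the shifted node. -/
lemma exists_separated (hJ : s.Inv J) (hv : v ∈ s.V) (hi : i < s.m) (hvi : G.IsPart (s.b + i) v)
    (hbad : ∀ S ∈ J, s.N ≤ (box L S).encard → s.DoneAt (s.rk v) S ∨ s.Pend (s.rk v) (s.rk v) S) :
    ∃ J', s.Inv J' ∧ (∀ S ∈ J', v ∈ S → s.o i ∉ S) ∧ ∀ S ∈ J', s.N ≤ (box L S).encard →
      s.DoneAt (s.rk v) S ∨ s.Pend (s.rk v) (s.rk v + 1) S ∨ s.Half v i J' S := by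
  have hpend : ∀ {S}, s.Pend (s.rk v) (s.rk v) S → s.Pend (s.rk v) (s.rk v + 1) S := by
    rintro S ⟨α, h1, h2, h3, h4⟩
    exact ⟨α, h1, h2, h3, fun z hz hzn => (h4 z hz hzn).mono (by omega)⟩
  have hne : s.o i ≠ v := fun h => not_node hv (h ▸ node_o hi)
  by_cases hF : (pair (s.o i) v).support ∈ J
  · have hd := starDatum_pair hJ.good.fan hne hF
    have hy : s.Node (lc (pair (s.o i) v)) := by rw [lc_pair]; exact node_o_add hi hvi
    have hyv : lc (pair (s.o i) v) ≠ v := fun h => not_node hv (h ▸ hy)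
    have hyo : lc (pair (s.o i) v) ≠ s.o i := fun h =>
      hd.notMem hJ.good.fan hF (by rw [h, support_pair hne]; simp)
    have hoF : s.o i ∈ (pair (s.o i) v).support := by simp [support_pair hne]
    have hvF : v ∈ (pair (s.o i) v).support := by simp [support_pair hne]
    have hFc : ∀ w ∈ (pair (s.o i) v).support, w = s.o i ∨ w = v := by simp [support_pair hne]
    refine ⟨star J (pair (s.o i) v), hJ.star hd hy, ?_, ?_⟩
    · intro S hS hvS hoS
      rcases mem_star_cases hJ.good.fan hS with h | ⟨S', h1, h2, -, rfl⟩
      · refine h.2 fun w hw => ?_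
        rcases hFc w hw with rfl | rfl
        exacts [hoS, hvS]
      · refine h2 fun w hw => ?_
        rcases hFc w hw with rfl | rfl
        · exact (Finset.mem_insert.1 hoS).resolve_left hyo.symm
        · exact (Finset.mem_insert.1 hvS).resolve_left hyv.symm
    · intro S hS hb
      rcases hd.large_cases hJ.good.fan hJ.good.box_le hS hb with h | ⟨h1, h2, h3, h4, -⟩
      · exact (hbad S h.1 hb).imp id fun h => Or.inl (hpend h)
      · rcases hbad _ h3 h4 with h | ⟨α, hα, hαS, hαr, hαc⟩
        · left
          exact Grading.done_star_pair hJ.isGraded hJ.good.fan hi (node_o hi) hvi hF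
            (co_o_neg hi) hy h
        · right
          by_cases hvv : v ∈ α.support ∧ v ∉ S
          · right
            refine ⟨α, ⟨hα, hvv.1, hαr⟩, insert (lc (pair (s.o i) v))
              ((S.erase (lc (pair (s.o i) v)) ∪ (pair (s.o i) v).support).erase v), ?_, ?_, ?_,
              ?_, ?_, ?_⟩
            · refine Or.inr ⟨_, fun h => by simpa using h hvF, ?_, rfl⟩
              refine hJ.good.fan.down _ h3 _ (Finset.union_subset (Finset.erase_subset _ _)
                Finset.subset_union_right)
            · rw [lc_pair]; exact Finset.mem_insert_self _ _
            · exact Finset.mem_insert_of_mem (Finset.mem_erase.2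
                ⟨hne, Finset.mem_union_right _ hoF⟩)
            · exact (Finset.erase_subset_erase _ hαS).trans (Finset.subset_insert _ _)
            · intro w hw
              obtain ⟨hwo, hw⟩ := Finset.mem_erase.1 hw
              rcases Finset.mem_insert.1 hw with rfl | hw
              · exact h1
              · obtain ⟨hwv, hw⟩ := Finset.mem_erase.1 hw
                rcases Finset.mem_union.1 hw with hw | hw
                · exact Finset.mem_of_mem_erase hw
                · rcases hFc w hw with h | h
                  exacts [absurd h hwo, absurd h hwv]
            · intro w hw
              by_cases hwy : w = lc (pair (s.o i) v)
              · rw [hwy]; exact Finset.mem_insert_self _ _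
              · refine Finset.mem_insert_of_mem (Finset.mem_erase.2 ⟨?_,
                  Finset.mem_union_left _ (Finset.mem_erase.2 ⟨hwy, hw⟩)⟩)
                rintro rfl
                exact hvv.2 hw
          · left
            refine ⟨α, hα, fun w hw => ?_, hαr, ?_⟩
            · rcases Finset.mem_union.1 (hαS hw) with h | h
              · exact Finset.mem_of_mem_erase h
              · rcases hFc w h with rfl | rfl
                · exact absurd (node_o hi) (not_node (hα.mem_V hw))
                · by_contra h'
                  exact hvv ⟨hw, h'⟩
            · intro z hz hzn
              by_cases hzy : z = lc (pair (s.o i) v)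
              · exact ⟨i, hi, Or.inr (Or.inr ⟨v, hv, hvi, Nat.lt_succ_self _, by
                  rw [hzy, lc_pair]⟩)⟩
              · exact (hαc z (Finset.mem_union_left _ (Finset.mem_erase.2 ⟨hzy, hz⟩))
                  hzn).mono (by omega)
  · refine ⟨J, hJ, fun S hS hvS hoS => hF (hJ.good.fan.down S hS _ ?_), fun S hS hb =>
      (hbad S hS hb).imp id fun h => Or.inl (hpend h)⟩
    rw [support_pair hne]
    exact Finset.insert_subset hoS (Finset.singleton_subset_iff.2 hvS)

lemma SigAt.notMem {α : E →₀ ℝ} (hα : s.SigAt v α) {z : E} (hz : s.Node z) : z ∉ α.support :=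
  fun h => not_node (hα.sig.mem_V h) hz

lemma SigAt.node_add (hα : s.SigAt v α) (hi : i < s.m) (hvi : G.IsPart (s.b + i) v) :
    s.Node (s.o i + lc α) := by
  refine (node_o hi).add (fun c' hc' => hα.sig.co_zero hc') fun i' hi' => ?_
  rw [co_o _ hi']
  rcases lt_or_ge i' i with h | h
  · rw [hα.sig.co_zero_of_lt hα.mem hvi hα.min h, if_neg (by omega)]
    have : (0 : ℝ) ≤ uw s.n i i' := Nat.cast_nonneg _
    linarith
  · obtain ⟨k, hk, hkn⟩ := hα.sig.exists_nat (s.b + i')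
    rw [hk]
    have h1 : s.n ≤ uw s.n i i' := by
      rw [uw, if_pos h]
      exact (Nat.self_le_factorial _).trans (Nat.le_mul_of_pos_right _ (pow_pos s.n_pos _))
    have : (k : ℝ) ≤ uw s.n i i' := by exact_mod_cast hkn.trans h1
    split_ifs <;> linarith

lemma isPart_ne_zero {c : ℕ} (h : G.IsPart c v) : v ≠ 0 := by
  rintro rfl
  have := h c
  simp at this

lemma SigAt.support_shift (hα : s.SigAt v α) (hi : i < s.m) (hvi : G.IsPart (s.b + i) v) :
    (shiftCoeff α (s.o i) v).support = insert (s.o i + v) (insert (s.o i) (α.support.erase v)) :=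
  support_shiftCoeff (hα.notMem (node_o hi)) (hα.notMem (node_o_add hi hvi))
    (isPart_ne_zero hvi) (hα.sig.pos hα.mem).ne' (hα.sig.lt_one v).ne

lemma SigAt.shift_lt_one (hα : s.SigAt v α) (hi : i < s.m) (hvi : G.IsPart (s.b + i) v) (w : E) :
    shiftCoeff α (s.o i) v w < 1 := by
  rw [shiftCoeff_apply (hα.notMem (node_o hi)) (hα.notMem (node_o_add hi hvi))
    (isPart_ne_zero hvi)]
  have := hα.sig.pos hα.mem
  have := hα.sig.lt_one v
  have := hα.sig.lt_one w
  split_ifs <;> linarith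

lemma SigAt.shift_datum (hα : s.SigAt v α) (hi : i < s.m) (hvi : G.IsPart (s.b + i) v)
    (hF : (shiftCoeff α (s.o i) v).support ∈ J) : StarDatum L J (shiftCoeff α (s.o i) v) where
  supp := hF
  card := by
    rw [hα.support_shift hi hvi, Nat.succ_le_iff, Finset.one_lt_card]
    exact ⟨_, Finset.mem_insert_self _ _, _,
      Finset.mem_insert_of_mem (Finset.mem_insert_self _ _), fun h =>
      isPart_ne_zero hvi (by simpa using h)⟩
  nonneg w := by
    rw [shiftCoeff_apply (hα.notMem (node_o hi)) (hα.notMem (node_o_add hi hvi))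
      (isPart_ne_zero hvi)]
    have := hα.sig.pos hα.mem
    have := hα.sig.lt_one v
    have := hα.sig.nonneg w
    simp only [Finsupp.coe_zero, Pi.zero_apply] at *
    split_ifs <;> linarith
  le_one w := (hα.shift_lt_one hi hvi w).le
  mem := by
    rw [lc_shiftCoeff]
    exact L.add_mem hα.sig.mem (G.nd_mem _ _)

/-- Subdividing at all `o i + lc α` with `v` the vertex of smallest rank of the carrier of `lc α`
removes the exceptional large simplices. -/
lemma exists_no_half (hJ : s.Inv J) (hi : i < s.m) (hv : v ∈ s.V) (hvi : G.IsPart (s.b + i) v)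
    (hsep : ∀ S ∈ J, v ∈ S → s.o i ∉ S)
    (hbad : ∀ S ∈ J, s.N ≤ (box L S).encard →
      s.DoneAt (s.rk v) S ∨ s.Pend (s.rk v) (s.rk v + 1) S ∨ s.Half v i J S) :
    ∃ J', s.Inv J' ∧ (∀ S ∈ J', v ∈ S → s.o i ∉ S) ∧ ∀ S ∈ J', s.N ≤ (box L S).encard →
      s.DoneAt (s.rk v) S ∨ s.Pend (s.rk v) (s.rk v + 1) S := by
  have hyo : ∀ {J α}, IsFan L J → s.SigAt v α → (shiftCoeff α (s.o i) v).support ∈ J →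
      lc (shiftCoeff α (s.o i) v) ≠ s.o i ∧ lc (shiftCoeff α (s.o i) v) ≠ s.o i + v := by
    intro J α hJ hα hF
    have := (hα.shift_datum hi hvi hF).notMem hJ hF
    constructor
    · intro h
      rw [h, hα.support_shift hi hvi] at this
      simp at this
    · intro h
      rw [h, hα.support_shift hi hvi] at this
      simp at this
  have hnode : ∀ {α}, s.SigAt v α → s.Node (lc (shiftCoeff α (s.o i) v)) := by
    intro α hα
    rw [lc_shiftCoeff, add_comm]
    exact hα.node_add hi hvi
  refine (exists_forall_not_active (L := L) (J := J)
    (fun J => s.Inv J ∧ (∀ S ∈ J, v ∈ S → s.o i ∉ S) ∧ ∀ S ∈ J, s.N ≤ (box L S).encard →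
      s.DoneAt (s.rk v) S ∨ s.Pend (s.rk v) (s.rk v + 1) S ∨ s.Half v i J S)
    (fun γ => ∃ α, s.SigAt v α ∧ γ = shiftCoeff α (s.o i) v) (fun _ => 0)
    (fun J h => h.1.good.fan) ?_ ?_ ?_ ⟨hJ, hsep, hbad⟩).elim fun J' ⟨hJ', hact⟩ => ?_
  rotate_left 3
  · refine ⟨J', hJ'.1, hJ'.2.1, fun S hS hb => ?_⟩
    rcases hJ'.2.2 S hS hb with h | h | ⟨α, hα, R, hR, h1, h2, h3, -⟩
    · exact Or.inl h
    · exact Or.inr h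
    · refine absurd (hJ'.1.good.fan.down R hR _ ?_) (hact _ ⟨α, hα, rfl⟩)
      rw [hα.support_shift hi hvi]
      exact Finset.insert_subset h1 (Finset.insert_subset h2 h3)
  · rintro J - _ hF ⟨α, hα, rfl⟩
    exact hα.shift_datum hi hvi hF
  · rintro J ⟨hJ, hsep, hbad⟩ _ hF ⟨α, hα, rfl⟩
    have hd := hα.shift_datum hi hvi hF
    refine ⟨hJ.star hd (hnode hα),
      separated_star hJ hv (hnode hα) (hyo hJ.good.fan hα hF).1 hsep, fun S hS hb => ?_⟩
    rcases hd.large_cases hJ.good.fan hJ.good.box_le hS hb with ⟨hSJ, hFS⟩ | ⟨-, h2, -, -, h5⟩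
    · rcases hbad S hSJ hb with h | h | ⟨β, hβ, R, hR, h1, h2, h3, h4, h5⟩
      · exact Or.inl h
      · exact Or.inr (Or.inl h)
      · refine Or.inr (Or.inr ⟨β, hβ, R, Or.inl ⟨hR, fun hFR => ?_⟩, h1, h2, h3, h4, h5⟩)
        have ho : s.o i ∈ (shiftCoeff α (s.o i) v).support := by
          rw [hα.support_shift hi hvi]; simp
        have hoS : s.o i ∉ S := by
          intro hoS
          refine hFS fun w hw => ?_
          by_cases h : w = s.o i
          · rwa [h]
          · exact h4 (Finset.mem_erase.2 ⟨h, hFR hw⟩)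
        refine absurd (hb.trans (Set.encard_le_encard (box_mono fun w hw => ?_))) (not_le.2
          (box_encard_lt hJ.good.fan hR hFR hd ho (hα.shift_lt_one hi hvi _)
            (hJ.good.box_le R hR)))
        exact Finset.mem_insert_of_mem (Finset.mem_erase.2 ⟨fun h => hoS (h ▸ hw), h5 hw⟩)
    · obtain ⟨a, ha, ha'⟩ := Finset.not_subset.1 h2
      exact absurd (h5 a ha ha') (hα.shift_lt_one hi hvi a).ne
  · rintro J ⟨hJ, -, -⟩ _ hF ⟨α, hα, rfl⟩ _ ⟨β, hβ, rfl⟩ - hmem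
    exfalso
    rw [hβ.support_shift hi hvi, Finset.mem_insert, Finset.mem_insert, Finset.mem_erase] at hmem
    rcases hmem with h | h | h
    · exact (hyo hJ.good.fan hα hF).2 h
    · exact (hyo hJ.good.fan hα hF).1 h
    · exact hβ.notMem (hnode hα) h.2

end Stage

end UnimodularTriangulation

namespace UnimodularTriangulation

open scoped Classical

open Nat (factorial)

variable {E : Type*} [AddCommGroup E] [Module ℝ E] {L : AddSubgroup E} {G : Grading L}

namespace Stage

variable {s : Stage G} {v : E} {α : E →₀ ℝ} {i : ℕ} {J : Set (Finset E)}

lemma SigAt.exists_pos (hα : s.SigAt v α) (hvi : G.IsPart (s.b + i) v) :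
    ∃ k : ℕ, G.co (s.b + i) (lc α) = k ∧ 1 ≤ k ∧ k ≤ s.n := by
  obtain ⟨k, hk, hkn⟩ := hα.sig.exists_nat (s.b + i)
  refine ⟨k, hk, ?_, hkn⟩
  have := hα.sig.co_pos hα.mem hvi
  rw [hk] at this
  exact_mod_cast this

lemma Clean.node_step {K l : ℕ} {u : E} (hu : s.Clean K u) (hi : i < s.m) (huo : u ≠ s.o i)
    (hα : s.SigAt v α) (hvi : G.IsPart (s.b + i) v)
    (hneg : G.co (s.b + i) (u + (l : ℝ) • lc α) < 0) : s.Node (u + (l : ℝ) • lc α + lc α) := by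
  obtain ⟨j, h1, h2⟩ := hu.weights
  obtain ⟨k, hk, hk1, hkn⟩ := hα.exists_pos hvi
  rw [map_add, map_smul, h2 i hi huo, hk, smul_eq_mul] at hneg
  have hlt : l * k < uw s.n j i := by
    have : (l * k : ℝ) < uw s.n j i := by linarith
    exact_mod_cast this
  have hle : (l + 1) * k ≤ uw s.n j i := by
    obtain ⟨a, ha⟩ := factorial_dvd_uw s.n j i
    obtain ⟨q, hq⟩ : k ∣ uw s.n j i := ha ▸ (Nat.dvd_factorial hk1 hkn).mul_left a
    rw [hq, mul_comm k q] at hlt ⊢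
    exact Nat.mul_le_mul_right _ (lt_of_mul_lt_mul_right' hlt)
  have heq : u + (l : ℝ) • lc α + lc α = u + ((l + 1 : ℕ) : ℝ) • lc α := by
    push_cast
    rw [add_smul, one_smul, add_assoc]
  rw [heq]
  refine hu.node.add (fun c' hc' => ?_) fun i' hi' => ?_
  · rw [map_smul, hα.sig.co_zero hc', smul_zero]
  · rw [map_smul, smul_eq_mul]
    rcases lt_trichotomy i' i with h | rfl | h
    · rw [hα.sig.co_zero_of_lt hα.mem hvi hα.min h, mul_zero, add_zero]
      exact hu.node.2 i' hi'
    · rw [h2 i' hi' huo, hk]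
      have : (((l + 1 : ℕ) : ℝ) * k) ≤ uw s.n j i' := by exact_mod_cast hle
      linarith
    · obtain ⟨k', hk', hkn'⟩ := hα.sig.exists_nat (s.b + i')
      rw [hk']
      have h3 : (l + 1) * k' ≤ uw s.n j i' := by
        calc (l + 1) * k' ≤ ((l + 1) * k) * s.n :=
              Nat.mul_le_mul (Nat.le_mul_of_pos_right _ hk1) hkn'
          _ ≤ uw s.n j i * s.n := Nat.mul_le_mul_right _ hle
          _ = s.n * uw s.n j i := mul_comm _ _
          _ ≤ _ := mul_uw_le _ _ s.n_pos h
      have : (((l + 1 : ℕ) : ℝ) * k') ≤ uw s.n j i' := by exact_mod_cast h3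
      have := h1 i' hi'
      linarith

lemma Clean.step_ne {K l : ℕ} {u : E} (hu : s.Clean K u) (hi : i < s.m) (huo : u ≠ s.o i)
    (hα : s.SigAt v α) : u + (l : ℝ) • lc α + lc α ≠ s.o i := by
  intro h
  have hc := congrArg (G.co (s.b + s.m + 2 * i)) h
  have hlow := congrArg (G.co (s.b + i)) h
  have hk := hα.sig.co_nonneg (s.b + i)
  have hl : (0 : ℝ) ≤ l := Nat.cast_nonneg _
  rw [map_add, map_add, map_smul, hα.sig.co_zero (Or.inr (by omega)), smul_zero, add_zero,
    add_zero, o, G.co_nd_high _ _ (Or.inr (by omega)), if_pos rfl] at hc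
  obtain ⟨j, hj, rfl | rfl | ⟨w, -, hw, -, rfl⟩⟩ := hu
  · rw [o, G.co_nd_high _ _ (Or.inr (by omega))] at hc
    have : i ≠ j := by rintro rfl; exact huo rfl
    rw [if_neg (by omega)] at hc
    norm_num at hc
  · rw [u, G.co_nd_high _ _ (Or.inr (by omega)), if_neg (by omega)] at hc
    norm_num at hc
  · rw [map_add, o, G.co_nd_high _ _ (Or.inr (by omega)), hw, if_neg (by omega : ¬ _ = s.b + j),
      add_zero] at hc
    have hij : i = j := by
      by_contra hij
      rw [if_neg (by omega)] at hc
      norm_num at hc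
    subst hij
    rw [map_add, map_add, co_o_add hw hi, co_o _ hi, if_pos rfl, map_smul, smul_eq_mul] at hlow
    nlinarith [mul_nonneg hl hk]

variable (s) in
/-- Simplices containing the carrier of a box point with first vertex `v` all of whose nodes are
clean up to multiples of such box points. -/
def Mid (v : E) (i : ℕ) (S : Finset E) : Prop :=
  ∃ α, s.SigAt v α ∧ α.support ⊆ S ∧ ∀ z ∈ S, s.Node z → ∃ u, ∃ l : ℕ, ∃ β,
    s.Clean (s.rk v + 1) u ∧ u ≠ s.o i ∧ s.SigAt v β ∧ β.support ⊆ S ∧ z = u + (l : ℝ) • lc β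

lemma SigAt.support_add (hα : s.SigAt v α) {z : E} (hz : s.Node z) :
    (α + Finsupp.single z 1).support = insert z α.support := by
  have := hα.notMem hz
  rw [Finsupp.notMem_support_iff] at this
  ext w
  simp only [Finsupp.mem_support_iff, Finsupp.add_apply, Finsupp.single_apply, Finset.mem_insert]
  grind

lemma add_single_apply_of_ne {E : Type*} {α : E →₀ ℝ} {z w : E} (hw : w ≠ z) :
    (α + Finsupp.single z (1 : ℝ)) w = α w := by
  simp [hw.symm]

lemma SigAt.add_datum (hα : s.SigAt v α) {z : E} (hz : s.Node z) (hJ : IsFan L J)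
    (hF : (α + Finsupp.single z 1).support ∈ J) : StarDatum L J (α + Finsupp.single z 1) where
  supp := hF
  card := by
    rw [hα.support_add hz, Nat.succ_le_iff, Finset.one_lt_card]
    exact ⟨_, Finset.mem_insert_self _ _, _, Finset.mem_insert_of_mem hα.mem, fun h =>
      hα.notMem hz (h ▸ hα.mem)⟩
  nonneg w := by
    have := hα.sig.nonneg w
    simp only [Finsupp.add_apply, Finsupp.single_apply, Finsupp.coe_zero, Pi.zero_apply] at *
    split_ifs <;> linarith
  le_one w := by
    by_cases h : w = z
    · have := Finsupp.notMem_support_iff.1 (hα.notMem hz)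
      simp [h, this]
    · rw [add_single_apply_of_ne h]; exact (hα.sig.lt_one w).le
  mem := by
    rw [map_add, lc_single, one_smul]
    rw [hα.support_add hz] at hF
    exact L.add_mem hα.sig.mem (hJ.mem _ hF z (Finset.mem_insert_self _ _))

/-- Subdividing at nodes plus box points with first vertex `v` until all weights at the part of
`v` are used up. -/
lemma exists_no_mid (hJ : s.Inv J) (hi : i < s.m) (hv : v ∈ s.V) (hvi : G.IsPart (s.b + i) v)
    (hsep : ∀ S ∈ J, v ∈ S → s.o i ∉ S)
    (hbad : ∀ S ∈ J, s.N ≤ (box L S).encard →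
      s.DoneAt (s.rk v) S ∨ s.Pend (s.rk v) (s.rk v + 1) S) :
    ∃ J', s.Inv J' ∧ ∀ S ∈ J', s.N ≤ (box L S).encard →
      s.DoneAt (s.rk v + 1) S ∨ s.Pend (s.rk v + 1) (s.rk v + 1) S := by
  refine (exists_forall_not_active (L := L) (J := J)
    (fun J => s.Inv J ∧ (∀ S ∈ J, v ∈ S → s.o i ∉ S) ∧ ∀ S ∈ J, s.N ≤ (box L S).encard →
      s.DoneAt (s.rk v) S ∨ s.Pend (s.rk v + 1) (s.rk v + 1) S ∨ s.Mid v i S)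
    (fun γ => ∃ α u, ∃ l : ℕ, s.SigAt v α ∧ s.Clean (s.rk v + 1) u ∧ u ≠ s.o i ∧
      s.Node (u + (l : ℝ) • lc α) ∧ G.co (s.b + i) (u + (l : ℝ) • lc α) < 0 ∧
      γ = α + Finsupp.single (u + (l : ℝ) • lc α) 1)
    (fun F => ∑ z ∈ F, ⌊-G.co (s.b + i) z⌋₊)
    (fun J h => h.1.good.fan) ?_ ?_ ?_ ⟨hJ, hsep, fun S hS hb => ?_⟩).elim
      fun J' ⟨hJ', hact⟩ => ?_
  rotate_left 3
  · rcases hbad S hS hb with h | ⟨α, hα, hαS, hαr, hαc⟩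
    · exact Or.inl h
    · right
      by_cases hvα : v ∈ α.support
      · refine Or.inr ⟨α, ⟨hα, hvα, hαr⟩, hαS, fun z hz hzn => ⟨z, 0, α, hαc z hz hzn, ?_,
          ⟨hα, hvα, hαr⟩, hαS, by simp⟩⟩
        rintro rfl
        exact hsep S hS (hαS hvα) hz
      · refine Or.inl ⟨α, hα, hαS, fun w hw => ?_, hαc⟩
        refine lt_of_le_of_ne (hαr w hw) fun h => hvα ?_
        obtain ⟨S₀, hS₀, hvS₀⟩ := hv
        rwa [s.rk_inj _ hS₀ _ hα.supp v hvS₀ w hw h]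
  · refine ⟨J', hJ'.1, fun S hS hb => ?_⟩
    rcases hJ'.2.2 S hS hb with h | h | ⟨α, hα, hαS, hαc⟩
    · exact Or.inl (h.mono (Nat.le_succ _))
    · exact Or.inr h
    · refine Or.inl ⟨i, hi, v, hαS hα.mem, ⟨hv, Nat.lt_succ_self _⟩, hvi, fun z hz hzn => ?_⟩
      by_contra hne
      obtain ⟨u, l, β, h1, h2, h3, h4, rfl⟩ := hαc z hz hzn
      refine hact _ ⟨β, u, l, h3, h1, h2, hzn, lt_of_le_of_ne (hzn.2 i hi) hne, rfl⟩
        (hJ'.1.good.fan.down S hS _ ?_)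
      rw [h3.support_add hzn]
      exact Finset.insert_subset hz h4
  · rintro J hJ _ hF ⟨α, u, l, h1, -, -, h4, -, rfl⟩
    exact h1.add_datum h4 hJ.1.good.fan hF
  · rintro J ⟨hJ, hsep, hbad⟩ _ hF ⟨α, u, l, hα, hu, huo, hzn, hneg, rfl⟩
    have hd := hα.add_datum hzn hJ.good.fan hF
    have hylc : lc (α + Finsupp.single (u + (l : ℝ) • lc α) 1) = u + (l : ℝ) • lc α + lc α := by
      rw [map_add, lc_single, one_smul, add_comm]
    have hy : s.Node (lc (α + Finsupp.single (u + (l : ℝ) • lc α) 1)) := by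
      rw [hylc]; exact hu.node_step hi huo hα hvi hneg
    refine ⟨hJ.star hd hy, separated_star hJ hv hy (by rw [hylc]; exact hu.step_ne hi huo hα) hsep,
      fun S hS hb => ?_⟩
    rcases hd.large_cases hJ.good.fan hJ.good.box_le hS hb with ⟨hSJ, -⟩ | ⟨h1, h2, h3, h4, h5⟩
    · exact hbad S hSJ hb
    · have hαS : α.support ⊆ S := by
        intro w hw
        by_contra hwS
        have hwz : w ≠ u + (l : ℝ) • lc α := fun h => hα.notMem hzn (h ▸ hw)
        have := h5 w (by rw [hα.support_add hzn]; exact Finset.mem_insert_of_mem hw) hwS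
        rw [add_single_apply_of_ne hwz] at this
        exact (hα.sig.lt_one w).ne this
      have hDS : ∀ w ∈ S.erase (lc (α + Finsupp.single (u + (l : ℝ) • lc α) 1)) ∪
          (α + Finsupp.single (u + (l : ℝ) • lc α) 1).support, w ∈ s.V → w ∈ S := by
        intro w hw hwV
        rcases Finset.mem_union.1 hw with h | h
        · exact Finset.mem_of_mem_erase h
        · rw [hα.support_add hzn, Finset.mem_insert] at h
          rcases h with rfl | h
          · exact absurd hzn (not_node hwV)
          · exact hαS h
      have hmid : (∀ z ∈ S.erase (lc (α + Finsupp.single (u + (l : ℝ) • lc α) 1)), s.Node z →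
          ∃ u, ∃ l : ℕ, ∃ β, s.Clean (s.rk v + 1) u ∧ u ≠ s.o i ∧ s.SigAt v β ∧
            β.support ⊆ S ∧ z = u + (l : ℝ) • lc β) → s.Mid v i S := by
        refine fun h => ⟨α, hα, hαS, fun z hz hzN => ?_⟩
        by_cases hzy : z = lc (α + Finsupp.single (u + (l : ℝ) • lc α) 1)
        · refine ⟨u, l + 1, α, hu, huo, hα, hαS, ?_⟩
          rw [hzy, hylc]
          push_cast
          rw [add_smul, one_smul, add_assoc]
        · exact h z (Finset.mem_erase.2 ⟨hzy, hz⟩) hzN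
      rcases hbad _ h3 h4 with ⟨i', hi', v', hv', hvV, hvp, h0⟩ | ⟨β, hβ, hβS, hβr, hβc⟩ |
        ⟨β, hβ, hβS, hβc⟩
      · exact Or.inl ⟨i', hi', v', hDS v' hv' hvV.1, hvV, hvp,
          Grading.node_zero_of_ancestor hJ.isGraded hd hy hi' h0⟩
      · refine Or.inr (Or.inr (hmid fun z hz hzN => ⟨z, 0, α,
          hβc z (Finset.mem_union_left _ hz) hzN, ?_, hα, hαS, by simp⟩))
        rintro rfl
        exact hsep _ h3 (Finset.mem_union_right _ (by
          rw [hα.support_add hzn]; exact Finset.mem_insert_of_mem hα.mem))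
          (Finset.mem_union_left _ hz)
      · refine Or.inr (Or.inr (hmid fun z hz hzN => ?_))
        obtain ⟨u', l', β', g1, g2, g3, g4, g5⟩ := hβc z (Finset.mem_union_left _ hz) hzN
        exact ⟨u', l', β', g1, g2, g3, fun w hw => hDS w (g4 hw) (g3.sig.mem_V hw), g5⟩
  · rintro J ⟨hJ, -, -⟩ _ hF ⟨α, u, l, hα, hu, huo, hzn, hneg, rfl⟩ _
      ⟨α', u', l', hα', hu', huo', hzn', hneg', rfl⟩ - hmem
    have hylc : lc (α + Finsupp.single (u + (l : ℝ) • lc α) 1) = u + (l : ℝ) • lc α + lc α := by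
      rw [map_add, lc_single, one_smul, add_comm]
    have hy := hu.node_step hi huo hα hvi hneg
    rw [hylc, hα'.support_add hzn', Finset.mem_insert] at hmem
    have hz' := (hmem.resolve_right (hα'.notMem hy)).symm
    have hzero : ∀ {β}, s.SigAt v β → ∑ z ∈ β.support, ⌊-G.co (s.b + i) z⌋₊ = 0 := by
      refine fun hβ => Finset.sum_eq_zero fun w hw => Nat.floor_of_nonpos ?_
      obtain ⟨j, hj, h⟩ := isPart_of_mem (hβ.sig.mem_V hw)
      have := h.co_nonneg (s.b + i)
      linarith
    rw [hα.support_add hzn, hα'.support_add hzn', Finset.sum_insert (hα.notMem hzn),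
      Finset.sum_insert (hα'.notMem hzn'), hzero hα, hzero hα', add_zero, add_zero]
    obtain ⟨k, hk, hk1, -⟩ := hα.exists_pos hvi
    have hk1' : (1 : ℝ) ≤ k := by exact_mod_cast hk1
    refine floor_lt_floor_of_add_one_le (by linarith) ?_
    rw [hz', map_add _ _ (lc α), hk]
    linarith

end Stage

end UnimodularTriangulation

namespace UnimodularTriangulation

open scoped Classical

open Nat (factorial)

variable {E : Type*} [AddCommGroup E] [Module ℝ E] {L : AddSubgroup E}

lemma IsCone.add_mem {K : Set E} (hK : IsCone K) {x y : E} (hx : x ∈ K) (hy : y ∈ K) :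
    x + y ∈ K := by
  have := hK (Finsupp.single x 1 + Finsupp.single y 1) (fun w => ?_) (fun w hw => ?_)
  · simpa [lc_single] using this
  · simp only [Finsupp.add_apply, Finsupp.single_apply, Finsupp.coe_zero, Pi.zero_apply]
    split_ifs <;> norm_num
  · simp only [Finsupp.mem_support_iff, Finsupp.add_apply, Finsupp.single_apply] at hw
    grind

lemma IsCone.zero_mem {K : Set E} (hK : IsCone K) : (0 : E) ∈ K := by
  simpa using hK 0 le_rfl (by simp)

namespace Grading

variable (G : Grading L)

lemma IsPart.eq {G : Grading L} {c c' : ℕ} {v : E} (h : G.IsPart c v) (h' : G.IsPart c' v) :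
    c = c' := by
  by_contra hne
  have h1 := h c
  rw [h' c, if_pos rfl, if_neg hne] at h1
  norm_num at h1

/-- Cones containing all lines spanned by the `e c`, together with a functional vanishing
there. -/
structure ConeSystem (𝒞 : Set (Set E)) (η : E →ₗ[ℝ] ℝ) : Prop where
  cone : ∀ C ∈ 𝒞, IsCone C
  line : ∀ C ∈ 𝒞, ∀ c, ∀ r : ℝ, r • G.e c ∈ C
  apply_e : ∀ c, η (G.e c) = 0

/-- A fan with vertices in the parts `b, …, b + m - 1`, whose boxes have at most `N` points, which
refines `𝒞` and on whose vertices of part `b + i` the functional `η` is `a i`. -/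
structure Leveled (𝒞 : Set (Set E)) (η : E →ₗ[ℝ] ℝ) (b m N : ℕ) (a : ℕ → ℝ)
    (T : Set (Finset E)) : Prop where
  fan : IsFan L T
  part : ∀ S ∈ T, ∀ v ∈ S, ∃ i < m, G.IsPart (b + i) v
  box_le : ∀ S ∈ T, (box L S).encard ≤ N
  refines : ∀ S ∈ T, ∃ C ∈ 𝒞, ∀ v ∈ S, v ∈ C ∧ ∀ i < m, G.IsPart (b + i) v → η v = a i

/-- Nodes with prescribed weights. -/
noncomputable def nodes (b m M : ℕ) (w : ℕ → ℕ → ℕ) : Finset E :=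
  (Finset.range M).image fun c => G.nd b m c (w c)

/-- The levels of the unit coordinates of nodes with weights `w`. -/
noncomputable def nextLevel (m : ℕ) (w : ℕ → ℕ → ℕ) (a : ℕ → ℝ) (c : ℕ) : ℝ :=
  ∑ i ∈ Finset.range m, w c i * a i

/-- A functional that vanishes on the nodes with weights `w` and is `a i` on part `b + i`. -/
noncomputable def level (b m M : ℕ) (w : ℕ → ℕ → ℕ) (a : ℕ → ℝ) : E →ₗ[ℝ] ℝ :=
  ∑ i ∈ Finset.range m, a i • G.co (b + i) +
    ∑ c ∈ Finset.range M, nextLevel m w a c • G.co (b + m + c)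

/-- The members of `𝒞` intersected with the hyperplane `η = ψ`. -/
def slices (𝒞 : Set (Set E)) (η ψ : E →ₗ[ℝ] ℝ) : Set (Set E) :=
  {K | ∃ C ∈ 𝒞, K = {z | z ∈ C ∧ η z = ψ z}}

/-- Points covered by the join of `T` with nodes of weights `w`. -/
def reach (b m M : ℕ) (w : ℕ → ℕ → ℕ) (T : Set (Finset E)) : Set E :=
  {q | ∃ (p : E) (ε : ℕ → ℕ),
    InFan T (p + ∑ i ∈ Finset.range m, (∑ c ∈ Finset.range M, ε c * w c i) • G.e (b + i)) ∧
    q = p + ∑ c ∈ Finset.range M, ε c • G.e (b + m + c)}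

variable {G} {𝒞 : Set (Set E)} {η : E →ₗ[ℝ] ℝ} {b m M N : ℕ} {w : ℕ → ℕ → ℕ} {a : ℕ → ℝ}
  {T : Set (Finset E)}

lemma level_apply_of_isPart_low {i : ℕ} (hi : i < m) {v : E} (hv : G.IsPart (b + i) v) :
    G.level b m M w a v = a i := by
  simp only [level, LinearMap.add_apply, LinearMap.sum_apply, LinearMap.smul_apply, smul_eq_mul]
  rw [Finset.sum_eq_single i, Finset.sum_eq_zero, hv, if_pos rfl]
  · ring
  · intro c _
    rw [hv, if_neg (by omega), mul_zero]
  · intro j _ hj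
    rw [hv, if_neg (by omega), mul_zero]
  · intro h
    exact absurd (Finset.mem_range.2 hi) h

lemma level_apply_of_isPart_high {c : ℕ} (hc : c < M) {v : E} (hv : G.IsPart (b + m + c) v) :
    G.level b m M w a v = nextLevel m w a c := by
  simp only [level, LinearMap.add_apply, LinearMap.sum_apply, LinearMap.smul_apply, smul_eq_mul]
  rw [Finset.sum_eq_zero, Finset.sum_eq_single c, hv, if_pos rfl]
  · ring
  · intro j _ hj
    rw [hv, if_neg (by omega), mul_zero]
  · intro h
    exact absurd (Finset.mem_range.2 hc) h
  · intro j hj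
    have := Finset.mem_range.1 hj
    rw [hv, if_neg (by omega), mul_zero]

lemma level_apply_nd {c : ℕ} (hc : c < M) : G.level b m M w a (G.nd b m c (w c)) = 0 := by
  simp only [level, LinearMap.add_apply, LinearMap.sum_apply, LinearMap.smul_apply, smul_eq_mul]
  rw [Finset.sum_eq_single (s := Finset.range M) c, G.co_nd_high _ _ (Or.inr (by omega)),
    if_pos rfl, nextLevel, mul_one, ← Finset.sum_add_distrib]
  · refine Finset.sum_eq_zero fun i hi => ?_
    rw [G.co_nd_low _ _ (Finset.mem_range.1 hi)]
    ring
  · intro j _ hj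
    rw [G.co_nd_high _ _ (Or.inr (by omega)), if_neg (by omega), mul_zero]
  · intro h
    exact absurd (Finset.mem_range.2 hc) h

lemma ConeSystem.apply_nd (h𝒞 : G.ConeSystem 𝒞 η) (c : ℕ) (w : ℕ → ℕ) :
    η (G.nd b m c w) = 0 := by
  rw [nd, map_sub, map_sum, h𝒞.apply_e, Finset.sum_eq_zero, sub_zero]
  intro i _
  rw [map_nsmul, h𝒞.apply_e, smul_zero]

lemma ConeSystem.nd_mem (h𝒞 : G.ConeSystem 𝒞 η) {C : Set E} (hC : C ∈ 𝒞) (c : ℕ) (w : ℕ → ℕ) :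
    G.nd b m c w ∈ C := by
  have hsum : ∀ I : Finset ℕ, ∑ i ∈ I, -(w i • G.e (b + i)) ∈ C := by
    intro I
    refine Finset.sum_induction _ (· ∈ C) (fun _ _ => (h𝒞.cone C hC).add_mem)
      (h𝒞.cone C hC).zero_mem fun i _ => ?_
    have := h𝒞.line C hC (b + i) (-(w i : ℝ))
    rwa [neg_smul, Nat.cast_smul_eq_nsmul] at this
  rw [nd, sub_eq_add_neg, ← Finset.sum_neg_distrib]
  refine (h𝒞.cone C hC).add_mem ?_ (hsum _)
  simpa using h𝒞.line C hC (b + m + c) 1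

lemma ConeSystem.isCone_slices (h𝒞 : G.ConeSystem 𝒞 η) (ψ : E →ₗ[ℝ] ℝ) :
    ∀ K ∈ slices 𝒞 η ψ, IsCone K := by
  rintro _ ⟨C, hC, rfl⟩ f hf hfK
  refine ⟨h𝒞.cone C hC f hf fun v hv => (hfK v hv).1, ?_⟩
  rw [map_lc, map_lc]
  exact Finset.sum_congr rfl fun v hv => by rw [(hfK v hv).2]

lemma mem_nodes {z : E} : z ∈ G.nodes b m M w ↔ ∃ c < M, z = G.nd b m c (w c) := by
  simp [nodes, eq_comm]

lemma exists_separates (hpart : ∀ S ∈ T, ∀ v ∈ S, ∃ i < m, G.IsPart (b + i) v) :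
    ∃ φ, Separates L T (G.nodes b m M w) φ := by
  have hc : ∀ z : E, ∃ c, z ∈ G.nodes b m M w → z = G.nd b m c (w c) := by
    intro z
    by_cases h : z ∈ G.nodes b m M w
    · obtain ⟨c, -, hc⟩ := mem_nodes.1 h
      exact ⟨c, fun _ => hc⟩
    · exact ⟨0, fun h' => absurd h' h⟩
  choose c hc using hc
  refine ⟨fun z => G.co (b + m + c z), ?_, ?_, fun u _ => G.int _, ?_⟩
  · intro u hu u' hu'
    rw [show G.co (b + m + c u) u' = G.co (b + m + c u) (G.nd b m (c u') (w (c u'))) from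
      congrArg _ (hc u' hu'), G.co_nd_high _ _ (Or.inr (by omega))]
    refine if_congr ⟨fun h => ?_, ?_⟩ rfl rfl
    · rw [hc u hu, hc u' hu', show c u = c u' by omega]
    · rintro rfl; rfl
  · intro u _ A hA v hv
    obtain ⟨i, hi, h⟩ := hpart A hA v hv
    rw [h, if_neg (by omega)]
  · intro u hu
    obtain ⟨c, -, rfl⟩ := mem_nodes.1 hu
    exact G.nd_mem c _

lemma Leveled.good_join (h𝒞 : G.ConeSystem 𝒞 η) (hT : G.Leveled 𝒞 η b m N a T) :
    Good L N (slices 𝒞 η (G.level b m M w a)) (G.reach b m M w T)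
      (join T (G.nodes b m M w)) := by
  obtain ⟨φ, hφ⟩ := exists_separates (M := M) (w := w) hT.part
  refine ⟨hφ.isFan_join hT.fan, ?_, ?_, ?_⟩
  · rintro _ ⟨A, hA, B, hB, rfl⟩
    exact (Set.encard_le_encard (hφ.box_subset hA hB)).trans (hT.box_le A hA)
  · rintro _ ⟨A, hA, B, hB, rfl⟩
    obtain ⟨C, hC, h⟩ := hT.refines A hA
    refine ⟨_, ⟨C, hC, rfl⟩, fun v hv => ?_⟩
    rcases Finset.mem_union.1 hv with hv | hv
    · obtain ⟨i, hi, hvi⟩ := hT.part A hA v hv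
      exact ⟨(h v hv).1, by rw [(h v hv).2 i hi hvi, level_apply_of_isPart_low hi hvi]⟩
    · obtain ⟨c, hc, rfl⟩ := mem_nodes.1 (hB hv)
      exact ⟨h𝒞.nd_mem hC c _, by rw [h𝒞.apply_nd, level_apply_nd hc]⟩
  · rintro _ ⟨p, ε, hp, rfl⟩
    have := hp.join (U := G.nodes b m M w)
      (g := ∑ c ∈ Finset.range M, Finsupp.single (G.nd b m c (w c)) (ε c : ℝ)) ?_ ?_
    · convert this using 1
      rw [map_sum, add_assoc]
      congr 1
      simp only [lc_single, nd, smul_sub, Finset.sum_sub_distrib, Nat.cast_smul_eq_nsmul,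
        Finset.sum_smul, Finset.smul_sum, mul_smul]
      rw [Finset.sum_comm (s := Finset.range m)]
      abel
    · exact Finset.sum_nonneg fun c _ => Finsupp.single_nonneg.2 (Nat.cast_nonneg _)
    · refine Finsupp.support_finsetSum.trans fun z hz => ?_
      obtain ⟨c, hc, hz⟩ := Finset.mem_biUnion.1 hz
      have := Finsupp.support_single_subset hz
      rw [Finset.mem_singleton] at this
      exact mem_nodes.2 ⟨c, Finset.mem_range.1 hc, this⟩

lemma Leveled.graded_join (hT : G.Leveled 𝒞 η b m N a T) :
    G.Graded b m M (join T (G.nodes b m M w)) := by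
  rintro _ ⟨A, hA, B, hB, rfl⟩ v hv
  rcases Finset.mem_union.1 hv with hv | hv
  · exact Or.inl (hT.part A hA v hv)
  · obtain ⟨c, hc, rfl⟩ := mem_nodes.1 (hB hv)
    exact Or.inr (G.isNode_nd hc _)

lemma exists_leveled (h𝒞 : G.ConeSystem 𝒞 η) {J : Set (Finset E)} {Z : Set E}
    (hJ : Good L (N + 1 : ℕ) (slices 𝒞 η (G.level b m M w a)) Z J) (hG : G.Graded b m M J)
    (hdone : ∀ S ∈ J, (N + 1 : ℕ) ≤ (box L S).encard → G.Done b m M Set.univ S) :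
    ∃ T, G.Leveled 𝒞 η (b + m) M N (nextLevel m w a) T ∧
      ∀ p ∈ Z, (∀ i < m, G.co (b + i) p = 0) → InFan T p := by
  obtain ⟨T, h1, h2, h3, h4, h5⟩ := exists_merged_fan (h𝒞.isCone_slices _) hJ hG hdone
  refine ⟨T, ⟨h1, h4, fun S hS => ?_, fun S hS => ?_⟩, h5⟩
  · have := h2 S hS
    rw [Nat.cast_add, Nat.cast_one] at this
    exact Order.le_of_lt_add_one this
  · obtain ⟨_, ⟨C, hC, rfl⟩, h⟩ := h3 S hS
    exact ⟨C, hC, fun v hv => ⟨(h v hv).1, fun c hc hvc =>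
      (h v hv).2.trans (level_apply_of_isPart_high hc hvc)⟩⟩

end Grading

end UnimodularTriangulation

namespace UnimodularTriangulation

open scoped Classical

open Nat (factorial)

variable {E : Type*} [AddCommGroup E] [Module ℝ E] {L : AddSubgroup E} {G : Grading L}

namespace Stage

variable {s : Stage G} {J : Set (Finset E)}

/-- Subdividing until all large simplices are done. -/
lemma exists_done (hJ : s.Inv J) (hbad : ∀ S ∈ J, s.N ≤ (box L S).encard → s.Pend 0 0 S)
    {K : ℕ} (hK : ∀ v ∈ s.V, s.rk v < K) :
    ∃ J', s.Inv J' ∧ ∀ S ∈ J', s.N ≤ (box L S).encard → G.Done s.b s.m (2 * s.m) Set.univ S := by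
  have key : ∀ k, ∃ J', s.Inv J' ∧ ∀ S ∈ J', s.N ≤ (box L S).encard →
      s.DoneAt k S ∨ s.Pend k k S := by
    intro k
    induction k with
    | zero => exact ⟨J, hJ, fun S hS hb => Or.inr (hbad S hS hb)⟩
    | succ k ih =>
      obtain ⟨J₁, hJ₁, hb₁⟩ := ih
      by_cases hv : ∃ v ∈ s.V, s.rk v = k
      · obtain ⟨v, hv, rfl⟩ := hv
        obtain ⟨i, hi, hvi⟩ := isPart_of_mem hv
        obtain ⟨J₂, hJ₂, hs₂, hb₂⟩ := exists_separated hJ₁ hv hi hvi hb₁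
        obtain ⟨J₃, hJ₃, hs₃, hb₃⟩ := exists_no_half hJ₂ hi hv hvi hs₂ hb₂
        exact exists_no_mid hJ₃ hi hv hvi hs₃ hb₃
      · refine ⟨J₁, hJ₁, fun S hS hb => (hb₁ S hS hb).imp (fun h => h.mono (Nat.le_succ k)) ?_⟩
        rintro ⟨α, hα, h1, h2, h3⟩
        refine ⟨α, hα, h1, fun w hw => ?_, fun z hz hzn => (h3 z hz hzn).mono (Nat.le_succ k)⟩
        exact lt_of_le_of_ne (h2 w hw) fun h => hv ⟨w, hα.mem_V hw, h.symm⟩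
  obtain ⟨J', hJ', hb'⟩ := key K
  refine ⟨J', hJ', fun S hS hb => ?_⟩
  rcases hb' S hS hb with ⟨i, hi, v, hv, -, h⟩ | ⟨α, hα, -, h, -⟩
  · exact ⟨i, hi, v, hv, Set.mem_univ v, h⟩
  · obtain ⟨v, hv⟩ := hα.ne
    exact absurd (hK v (hα.mem_V hv)) (not_lt.2 (h v hv))

end Stage

/-- The weights of shifted and unshifted nodes in alternation. -/
def wt (n c : ℕ) : ℕ → ℕ := if c % 2 = 0 then ow n (c / 2) else uw n (c / 2)

lemma wt_even (n j : ℕ) : wt n (2 * j) = ow n j := by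
  simp [wt]

lemma wt_odd (n j : ℕ) : wt n (2 * j + 1) = uw n j := by
  rw [wt, if_neg (by omega), show (2 * j + 1) / 2 = j by omega]

namespace Grading

variable {𝒞 : Set (Set E)} {η : E →ₗ[ℝ] ℝ} {b m N : ℕ} {a : ℕ → ℝ} {T : Set (Finset E)}

lemma exists_rank (hfin : T.Finite) (hpart : ∀ S ∈ T, ∀ v ∈ S, ∃ i < m, G.IsPart (b + i) v) :
    ∃ (rk : E → ℕ) (K : ℕ), (∀ S ∈ T, ∀ v ∈ S, rk v < K) ∧
      (∀ S ∈ T, ∀ S' ∈ T, ∀ v ∈ S, ∀ v' ∈ S', rk v = rk v' → v = v') ∧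
      ∀ S ∈ T, ∀ S' ∈ T, ∀ v ∈ S, ∀ v' ∈ S', ∀ i i', G.IsPart (b + i) v →
        G.IsPart (b + i') v' → i < i' → rk v < rk v' := by
  set V : Finset E := hfin.toFinset.biUnion id with hV
  have hmem : ∀ S ∈ T, ∀ v ∈ S, v ∈ V := fun S hS v hv =>
    Finset.mem_biUnion.2 ⟨S, hfin.mem_toFinset.2 hS, hv⟩
  have he : ∃ e : E → ℕ, (∀ v ∈ V, e v < V.card) ∧ ∀ v ∈ V, ∀ v' ∈ V, e v = e v' → v = v' := by
    refine ⟨fun v => if h : v ∈ V then V.equivFin ⟨v, h⟩ else 0, fun v hv => ?_,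
      fun v hv v' hv' h => ?_⟩
    · simp only [dif_pos hv]; exact Fin.is_lt _
    · simp only [dif_pos hv, dif_pos hv'] at h
      simpa using V.equivFin.injective (Fin.ext h)
  obtain ⟨e, he1, he2⟩ := he
  have hp : ∀ v : E, ∃ i, ∀ S ∈ T, v ∈ S → i < m ∧ G.IsPart (b + i) v := by
    intro v
    by_cases h : ∃ S ∈ T, v ∈ S
    · obtain ⟨S, hS, hv⟩ := h
      obtain ⟨i, h⟩ := hpart S hS v hv
      exact ⟨i, fun _ _ _ => h⟩
    · exact ⟨0, fun S hS hv => absurd ⟨S, hS, hv⟩ h⟩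
  choose p hp using hp
  have hlt : ∀ {i i' e e' : ℕ}, e < V.card → i < i' → i * V.card + e < i' * V.card + e' := by
    intro i i' e e' h1 h2
    have : (i + 1) * V.card ≤ i' * V.card := Nat.mul_le_mul_right _ h2
    rw [add_mul, one_mul] at this
    omega
  refine ⟨fun v => p v * V.card + e v, m * V.card, ?_, ?_, ?_⟩
  · intro S hS v hv
    simpa using hlt (e' := 0) (he1 v (hmem S hS v hv)) (hp v S hS hv).1
  · intro S hS S' hS' v hv v' hv' h
    have h1 := he1 v (hmem S hS v hv)
    have h2 := he1 v' (hmem S' hS' v' hv')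
    refine he2 v (hmem S hS v hv) v' (hmem S' hS' v' hv') ?_
    simp only at h
    rcases lt_trichotomy (p v) (p v') with h3 | h3 | h3
    · exact absurd h (hlt h1 h3).ne
    · rw [h3] at h; omega
    · exact absurd h (hlt h2 h3).ne'
  · intro S hS S' hS' v hv v' hv' i i' h h' hii'
    have h1 : p v = i := by have := (hp v S hS hv).2.eq h; omega
    have h2 : p v' = i' := by have := (hp v' S' hS' hv').2.eq h'; omega
    simp only [h1, h2]
    exact hlt (he1 v (hmem S hS v hv)) hii'

/-- One round of the index reduction. -/
lemma Leveled.step (h𝒞 : G.ConeSystem 𝒞 η) (hT : G.Leveled 𝒞 η b m (N + 2) a T) :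
    ∃ n ≥ 1, ∃ a' T', G.Leveled 𝒞 η (b + m) (2 * m) (N + 1) a' T' ∧
      ∀ p ∈ G.reach b m (2 * m) (wt n) T, (∀ i < m, G.co (b + i) p = 0) → InFan T' p := by
  obtain ⟨rk, K, hrk1, hrk2, hrk3⟩ := exists_rank hT.fan.finite hT.part
  obtain ⟨n, hn⟩ : ∃ n, ∀ S ∈ T, S.card ≤ n := by
    obtain ⟨n, hn⟩ := (hT.fan.finite.image Finset.card).bddAbove
    exact ⟨n, fun S hS => hn ⟨S, hS, rfl⟩⟩
  let s : Stage G :=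
    { b := b, m := m, n := n + 1, N := N + 1 + 1, T := T, rk := rk,
      𝒦 := slices 𝒞 η (G.level b m (2 * m) (wt (n + 1)) a),
      Z := G.reach b m (2 * m) (wt (n + 1)) T,
      cone := h𝒞.isCone_slices _, fan := hT.fan, part := hT.part,
      card := fun S hS => (hn S hS).trans (Nat.le_succ n), n_pos := Nat.le_add_left 1 n,
      rk_inj := hrk2, rk_lt := hrk3 }
  have hjoin := hT.good_join (M := 2 * m) (w := wt (n + 1)) h𝒞
  obtain ⟨φ, hφ⟩ := exists_separates (M := 2 * m) (w := wt (n + 1)) hT.part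
  have hinv : s.Inv (join T (G.nodes b m (2 * m) (wt (n + 1)))) := by
    refine ⟨hjoin, ?_⟩
    rintro _ ⟨A, hA, B, hB, rfl⟩ v hv
    rcases Finset.mem_union.1 hv with hv | hv
    · exact Or.inl ⟨A, hA, hv⟩
    · obtain ⟨c, hc, rfl⟩ := mem_nodes.1 (hB hv)
      exact Or.inr (G.isNode_nd hc _)
  have hpend : ∀ S ∈ join T (G.nodes b m (2 * m) (wt (n + 1))), s.N ≤ (box L S).encard →
      s.Pend 0 0 S := by
    rintro _ ⟨A, hA, B, hB, rfl⟩ hb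
    have hb' : ((N + 1 + 1 : ℕ) : ℕ∞) ≤ (box L A).encard :=
      hb.trans (Set.encard_le_encard (hφ.box_subset hA hB))
    have hone : 1 < (box L A).encard := lt_of_lt_of_le (by exact_mod_cast (by omega)) hb'
    obtain ⟨x, hx, hx0⟩ := (Set.one_lt_encard_iff_nontrivial.1 hone).exists_ne 0
    obtain ⟨hxL, β, h1, h2, h3, rfl⟩ := hx
    refine ⟨β, ⟨hT.fan.down A hA _ h1, ?_, h2, h3, hxL⟩, h1.trans Finset.subset_union_left,
      fun _ _ => Nat.zero_le _, ?_⟩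
    · rw [Finsupp.support_nonempty_iff]
      rintro rfl
      exact hx0 (map_zero _)
    · intro z hz hzn
      rcases Finset.mem_union.1 hz with hz | hz
      · exact absurd hzn (Stage.not_node (s := s) ⟨A, hA, hz⟩)
      · obtain ⟨c, hc, rfl⟩ := mem_nodes.1 (hB hz)
        rcases Nat.even_or_odd' c with ⟨j, rfl | rfl⟩
        · refine ⟨j, show j < m by omega, Or.inl ?_⟩
          rw [wt_even]; rfl
        · refine ⟨j, show j < m by omega, Or.inr (Or.inl ?_)⟩
          rw [wt_odd]; rfl
  obtain ⟨J, hJ, hdone⟩ := Stage.exists_done hinv hpend (K := K)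
    fun v ⟨S, hS, hv⟩ => hrk1 S hS v hv
  obtain ⟨T₁, h1, h2⟩ := exists_leveled (N := N + 1) h𝒞 hJ.good hJ.isGraded hdone
  exact ⟨n + 1, Nat.le_add_left 1 n, _, T₁, h1, h2⟩

/-- The final merge, producing a fan with vertices in a single part. -/
lemma Leveled.merge (h𝒞 : G.ConeSystem 𝒞 η) (hT : G.Leveled 𝒞 η b m 1 a T) (w : ℕ → ℕ) :
    ∃ a' T', G.Leveled 𝒞 η (b + m) 1 1 a' T' ∧
      ∀ p ∈ G.reach b m 1 (fun _ => w) T, (∀ i < m, G.co (b + i) p = 0) → InFan T' p := by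
  have hjoin := hT.good_join (M := 1) (w := fun _ => w) h𝒞
  have hlt : ∀ S ∈ join T (G.nodes b m 1 fun _ => w), ¬ ((2 : ℕ) : ℕ∞) ≤ (box L S).encard := by
    intro S hS h
    have := h.trans (hjoin.box_le S hS)
    norm_num at this
  obtain ⟨T', h1, h2⟩ := exists_leveled (N := 1) h𝒞
    ⟨hjoin.fan, fun S hS => (hjoin.box_le S hS).trans (by norm_num), hjoin.refines, hjoin.cover⟩
    hT.graded_join fun S hS h => absurd h (hlt S hS)
  exact ⟨_, T', h1, h2⟩

end Grading

end UnimodularTriangulation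

namespace UnimodularTriangulation

open scoped Classical

open Nat (factorial)

/-- Rapidly growing sequences. -/
def Grow (C m : ℕ) (w : ℕ → ℕ) : Prop :=
  ∀ i < m, C * (1 + ∑ j ∈ Finset.range i, w j) ≤ w i

lemma exists_mul_add_mul_eq {R A D r : ℕ} (hR : 1 ≤ R) (h : R * D + (R + 1) * (A + R) ≤ r) :
    ∃ x y, A ≤ x ∧ x ≤ A + R ∧ D ≤ y ∧ R * y + (R + 1) * x = r := by
  have hA : A ≤ r := by nlinarith
  obtain ⟨q, t, ht, hq⟩ : ∃ q t, t < R ∧ r = A + (R * q + t) :=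
    ⟨(r - A) / R, (r - A) % R, Nat.mod_lt _ hR, by
      have := Nat.div_add_mod (r - A) R
      omega⟩
  have hle : A + t + D ≤ q := by
    by_contra hlt
    have h1 : q + 1 ≤ A + t + D := by omega
    have := Nat.mul_le_mul_left R h1
    nlinarith
  refine ⟨A + t, q - (A + t), by omega, by omega, by omega, ?_⟩
  obtain ⟨q', rfl⟩ := Nat.exists_eq_add_of_le (le_trans (Nat.le_add_right _ _) hle)
  rw [Nat.add_sub_cancel_left, hq]
  ring

lemma wt_eq_zero {n c i : ℕ} (h : 2 * (i + 1) ≤ c) : wt n c i = 0 := by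
  have h1 : ¬ c / 2 ≤ i := by omega
  have h2 : i ≠ c / 2 := by omega
  rw [wt]
  split_ifs <;> simp [ow, uw, h1, h2]

lemma wt_le {n m c i : ℕ} (hn : 1 ≤ n) (h : c < 2 * i) (him : i ≤ m) :
    wt n c i ≤ factorial n * n ^ m := by
  have h1 : i ≠ c / 2 := by omega
  have h2 : uw n (c / 2) i ≤ factorial n * n ^ m := by
    unfold uw
    split_ifs
    · exact Nat.mul_le_mul_left _ (Nat.pow_le_pow_right hn (by omega))
    · exact Nat.zero_le _
  rw [wt]
  split_ifs
  · simpa [ow, h1] using h2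
  · exact h2

lemma wt_even_self (n i : ℕ) : wt n (2 * i) i = factorial n + 1 := by
  simp [wt_even, ow, uw]

lemma wt_odd_self (n i : ℕ) : wt n (2 * i + 1) i = factorial n := by
  simp [wt_odd, uw]

lemma Grow.congr {C m : ℕ} {w w' : ℕ → ℕ} (h : Grow C m w) (hw : ∀ i < m, w' i = w i) :
    Grow C m w' := by
  intro i hi
  rw [hw i hi, Finset.sum_congr rfl fun j hj => hw j ((Finset.mem_range.1 hj).trans hi)]
  exact h i hi

lemma Grow.succ {C m : ℕ} {w : ℕ → ℕ} (h : Grow C m w)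
    (hm : C * (1 + ∑ j ∈ Finset.range m, w j) ≤ w m) : Grow C (m + 1) w := by
  intro i hi
  rcases Nat.lt_succ_iff_lt_or_eq.1 hi with hi | rfl
  exacts [h i hi, hm]

/-- Rapidly growing weights are combinations of the weights `wt n` with rapidly growing
coefficients. -/
lemma exists_coeffs {n : ℕ} (hn : 1 ≤ n) (m C : ℕ) : ∃ C', ∀ w, Grow C' m w →
    ∃ ε, Grow C (2 * m) ε ∧ ∀ i < m, ∑ c ∈ Finset.range (2 * m), ε c * wt n c i = w i := by
  set R := factorial n with hRdef
  have hR : 1 ≤ R := Nat.factorial_pos n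
  refine ⟨R * n ^ m + R * (C * (1 + C + R)) + (R + 1) * (C + R), fun w hw => ?_⟩
  have key : ∀ k ≤ m, ∃ ε, Grow C (2 * k) ε ∧
      (∀ i < k, ∑ c ∈ Finset.range (2 * k), ε c * wt n c i = w i) ∧
      ∑ c ∈ Finset.range (2 * k), ε c ≤ ∑ i ∈ Finset.range k, w i := by
    intro k
    induction k with
    | zero => exact fun _ => ⟨0, fun i hi => by omega, fun i hi => by omega, by simp⟩
    | succ k ih =>
      intro hk
      obtain ⟨ε, h1, h2, h3⟩ := ih (by omega)
      set S := ∑ c ∈ Finset.range (2 * k), ε c with hS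
      set Λ := ∑ i ∈ Finset.range k, w i
      have hB : ∑ c ∈ Finset.range (2 * k), ε c * wt n c k ≤ Λ * (R * n ^ m) := by
        refine le_trans ?_ (Nat.mul_le_mul_right _ h3)
        rw [hS, Finset.sum_mul]
        exact Finset.sum_le_sum fun c hc => Nat.mul_le_mul_left _
          (wt_le hn (Finset.mem_range.1 hc) (by omega))
      set B := ∑ c ∈ Finset.range (2 * k), ε c * wt n c k
      have hwk := hw k (by omega)
      have hmain : B + (R * (C * (1 + S + (C * (1 + S) + R))) +
          (R + 1) * (C * (1 + S) + R)) ≤ w k := by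
        refine le_trans ?_ hwk
        have e1 : C * (1 + S) + R ≤ (C + R) * (1 + Λ) := by nlinarith
        have e2 : 1 + S + (C * (1 + S) + R) ≤ (1 + C + R) * (1 + Λ) := by nlinarith
        calc B + (R * (C * (1 + S + (C * (1 + S) + R))) + (R + 1) * (C * (1 + S) + R))
            ≤ (1 + Λ) * (R * n ^ m) + (R * (C * ((1 + C + R) * (1 + Λ))) +
              (R + 1) * ((C + R) * (1 + Λ))) := by
              gcongr
              exact hB.trans (Nat.mul_le_mul_right _ (by omega))
          _ = _ := by ring
      obtain ⟨x, y, hx1, hx2, hy, hxy⟩ := exists_mul_add_mul_eq (r := w k - B) hR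
        (Nat.le_sub_of_add_le (by rw [add_comm]; exact hmain))
      have hwk' : B + (R * y + (R + 1) * x) = w k := by omega
      let ε' : ℕ → ℕ := fun c => if c < 2 * k then ε c else if c = 2 * k then x else y
      have hε : ∀ c < 2 * k, ε' c = ε c := fun c hc => if_pos hc
      have hεx : ε' (2 * k) = x := by simp [ε']
      have hεy : ε' (2 * k + 1) = y := by simp [ε']
      have hsum : ∀ g : ℕ → ℕ, ∑ c ∈ Finset.range (2 * (k + 1)), ε' c * g c =
          ∑ c ∈ Finset.range (2 * k), ε c * g c + x * g (2 * k) + y * g (2 * k + 1) := by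
        intro g
        rw [show 2 * (k + 1) = 2 * k + 1 + 1 by ring, Finset.sum_range_succ,
          Finset.sum_range_succ, hεx, hεy]
        congr 2
        exact Finset.sum_congr rfl fun c hc => by rw [hε c (Finset.mem_range.1 hc)]
      have hS' : ∑ c ∈ Finset.range (2 * k), ε' c = S :=
        Finset.sum_congr rfl fun c hc => hε c (Finset.mem_range.1 hc)
      refine ⟨ε', ?_, ?_, ?_⟩
      · refine ((h1.congr hε).succ ?_).succ ?_
        · rw [hS', hεx]; exact hx1
        · rw [Finset.sum_range_succ, hS', hεx, hεy]
          refine le_trans (Nat.mul_le_mul_left _ ?_) hy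
          omega
      · intro i hi
        rw [hsum (fun c => wt n c i)]
        rcases Nat.lt_succ_iff_lt_or_eq.1 hi with hi | rfl
        · rw [h2 i hi, wt_eq_zero (by omega), wt_eq_zero (by omega)]
          simp
        · rw [wt_even_self, wt_odd_self, ← hwk', ← hRdef]
          ring
      · have := hsum (fun _ => 1)
        simp only [mul_one] at this
        rw [this, Finset.sum_range_succ, ← hwk']
        have hRy : y ≤ R * y := Nat.le_mul_of_pos_left _ hR
        have hRx : x ≤ (R + 1) * x := Nat.le_mul_of_pos_left _ (Nat.succ_pos _)
        change S + x + y ≤ Λ + _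
        omega
  obtain ⟨ε, h1, h2, -⟩ := key m le_rfl
  exact ⟨ε, h1, h2⟩

variable {E : Type*} [AddCommGroup E] [Module ℝ E] {L : AddSubgroup E}

namespace Grading

variable {G : Grading L} {𝒞 : Set (Set E)} {η : E →ₗ[ℝ] ℝ} {b m N : ℕ} {a : ℕ → ℝ}
  {T : Set (Finset E)} {P : ℕ → Set E}

variable (G) in
/-- For large `s`, the points of `P s` lifted by suitable rapidly growing weights are covered. -/
def Adequate (P : ℕ → Set E) (b m : ℕ) (T : Set (Finset E)) : Prop :=
  ∀ C, ∃ s₀, ∀ s ≥ s₀, ∃ w, Grow C m w ∧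
    ∀ p ∈ P s, InFan T (p + ∑ i ∈ Finset.range m, w i • G.e (b + i))

lemma co_add_sum_high {p : E} {i M : ℕ} (hp : G.co (b + i) p = 0) (hi : i < m) (ε : ℕ → ℕ) :
    G.co (b + i) (p + ∑ c ∈ Finset.range M, ε c • G.e (b + m + c)) = 0 := by
  rw [map_add, hp, map_sum, Finset.sum_eq_zero, add_zero]
  intro c _
  rw [map_nsmul, G.co_e, if_neg (by omega), smul_zero]

/-- Iterating the index reduction. -/
lemma exists_single_level (h𝒞 : G.ConeSystem 𝒞 η) (hP : ∀ s, ∀ p ∈ P s, ∀ c, G.co c p = 0)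
    (hT : G.Leveled 𝒞 η b m (N + 1) a T) (hA : G.Adequate P b m T) :
    ∃ s₀, ∀ s ≥ s₀, ∃ b' a' T', G.Leveled 𝒞 η b' 1 1 a' T' ∧
      ∀ p ∈ P s, InFan T' (p + G.e b') := by
  induction N generalizing b m a T with
  | zero =>
    obtain ⟨s₀, hs₀⟩ := hA 0
    refine ⟨s₀, fun s hs => ?_⟩
    obtain ⟨w, -, hw⟩ := hs₀ s hs
    obtain ⟨a', T', h1, h2⟩ := hT.merge h𝒞 w
    refine ⟨b + m, a', T', h1, fun p hp => ?_⟩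
    have := h2 (p + ∑ c ∈ Finset.range 1, 1 • G.e (b + m + c)) ⟨p, fun _ => 1, ?_, rfl⟩
      fun i hi => co_add_sum_high (hP s p hp _) hi (fun _ => 1)
    · simpa using this
    · simpa using hw p hp
  | succ N ih =>
    obtain ⟨n, hn, a', T', h1, h2⟩ := hT.step h𝒞
    refine ih h1 fun C => ?_
    obtain ⟨C', hC'⟩ := exists_coeffs hn m C
    obtain ⟨s₀, hs₀⟩ := hA C'
    refine ⟨s₀, fun s hs => ?_⟩
    obtain ⟨w, hw1, hw2⟩ := hs₀ s hs
    obtain ⟨ε, hε1, hε2⟩ := hC' w hw1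
    refine ⟨ε, hε1, fun p hp => h2 _ ⟨p, ε, ?_, rfl⟩
      fun i hi => co_add_sum_high (hP s p hp _) hi ε⟩
    rw [Finset.sum_congr rfl fun i hi => by rw [hε2 i (Finset.mem_range.1 hi)]]
    exact hw2 p hp

end Grading

end UnimodularTriangulation

namespace UnimodularTriangulation

section Degree

variable {V : Type*}

/-- The sum of the coefficients. -/
noncomputable def deg : (V →₀ ℝ) →ₗ[ℝ] ℝ := Finsupp.linearCombination ℝ fun _ => (1 : ℝ)

lemma deg_single (v : V) (t : ℝ) : deg (Finsupp.single v t) = t := by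
  simp [deg]

lemma deg_eq_sum (f : V →₀ ℝ) {S : Finset V} (h : f.support ⊆ S) : deg f = ∑ v ∈ S, f v := by
  rw [deg, Finsupp.linearCombination_apply, Finsupp.sum_of_support_subset f h _ (by simp)]
  simp

lemma eq_zero_of_deg {f : V →₀ ℝ} (hf : 0 ≤ f) (h : deg f = 0) : f = 0 := by
  rw [deg_eq_sum f subset_rfl, Finset.sum_eq_zero_iff_of_nonneg fun v _ => hf v] at h
  ext v
  by_contra hv
  exact hv (h v (Finsupp.mem_support_iff.2 hv))

end Degree

section Polytopes

variable {V : Type*} [NormedAddCommGroup V] [NormedSpace ℝ V]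

lemma exists_supporting [FiniteDimensional ℝ V] {F : Set V} (hF : Convex ℝ F) {p : V} (hp : p ∈ F)
    (hp' : p ∉ intrinsicInterior ℝ F) :
    ∃ φ : V →ₗ[ℝ] ℝ, (∀ y ∈ F, φ y ≤ φ p) ∧ ∃ y ∈ F, φ y < φ p := by
  obtain ⟨z, hz⟩ := Set.Nonempty.intrinsicInterior hF ⟨p, hp⟩
  have hpA := subset_affineSpan ℝ F hp
  have hne : Nonempty (affineSpan ℝ F) := ⟨⟨p, hpA⟩⟩
  let p' : affineSpan ℝ F := ⟨p, hpA⟩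
  let h := (AffineIsometryEquiv.vaddConst ℝ p').toHomeomorph
  have hh : ∀ u, ((h u : affineSpan ℝ F) : V) = u + p := fun u => rfl
  let F₀ : Set (affineSpan ℝ F).direction := h ⁻¹' ((↑) ⁻¹' F)
  have hF₀ : ∀ u, u ∈ F₀ ↔ (u : V) + p ∈ F := fun u => Iff.rfl
  have hconv : Convex ℝ F₀ := by
    intro u hu v hv a b ha hb hab
    rw [hF₀] at *
    have := hF hu hv ha hb hab
    convert this using 1
    simp only [smul_add, Submodule.coe_add, Submodule.coe_smul]
    rw [add_add_add_comm, ← add_smul, hab, one_smul]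
  have hint : ∀ u, u ∈ interior F₀ ↔ (u : V) + p ∈ intrinsicInterior ℝ F := by
    intro u
    rw [← h.preimage_interior, Set.mem_preimage, mem_intrinsicInterior]
    constructor
    · intro hu
      exact ⟨_, hu, rfl⟩
    · rintro ⟨y, hy, hyu⟩
      have : h u = y := Subtype.ext hyu.symm
      rwa [this]
  have h0 : (0 : (affineSpan ℝ F).direction) ∉ interior F₀ := by
    rw [hint]; simpa using hp'
  obtain ⟨φ, hφ⟩ := geometric_hahn_banach_open_point hconv.interior isOpen_interior h0
  obtain ⟨ψ, hψ⟩ := LinearMap.exists_extend φ.toLinearMap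
  have hψ' : ∀ u : (affineSpan ℝ F).direction, ψ u = φ u := fun u =>
    congrArg (fun l => l u) hψ
  have key : ∀ y ∈ F, ∃ u : (affineSpan ℝ F).direction, (u : V) + p = y := fun y hy =>
    ⟨⟨y - p, AffineSubspace.vsub_mem_direction (subset_affineSpan ℝ F hy) hpA⟩, by simp⟩
  obtain ⟨u₀, hu₀⟩ := key z (intrinsicInterior_subset hz)
  have hu₀' : u₀ ∈ interior F₀ := by rw [hint, hu₀]; exact hz
  refine ⟨ψ, fun y hy => ?_, z, intrinsicInterior_subset hz, ?_⟩
  · obtain ⟨u, rfl⟩ := key y hy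
    have hu : u ∈ closure (interior F₀) := by
      rw [hconv.closure_interior_eq_closure_of_nonempty_interior ⟨u₀, hu₀'⟩]
      exact subset_closure hy
    have : φ u ≤ φ 0 := by
      refine closure_minimal (fun v hv => (hφ v hv).le) ?_ hu
      exact isClosed_le φ.continuous continuous_const
    rw [map_add, hψ']
    simpa using this
  · rw [← hu₀, map_add, hψ']
    simpa using hφ u₀ hu₀'

lemma exists_extension {F : Set V} {p q : V} (hp : p ∈ intrinsicInterior ℝ F) (hq : q ∈ F) :
    ∃ δ > (0 : ℝ), p + δ • (p - q) ∈ F := by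
  obtain ⟨y, hy, rfl⟩ := hp
  let q' : affineSpan ℝ F := ⟨q, subset_affineSpan ℝ F hq⟩
  have hne : Nonempty (affineSpan ℝ F) := ⟨q'⟩
  have hcont : Continuous (fun t : ℝ => AffineMap.lineMap (k := ℝ) q' y t) :=
    AffineMap.lineMap_continuous
  have hmem : ∀ᶠ t in nhds (1 : ℝ), AffineMap.lineMap (k := ℝ) q' y t ∈
      interior ((↑) ⁻¹' F : Set (affineSpan ℝ F)) := by
    refine hcont.continuousAt.eventually_mem ?_
    rw [AffineMap.lineMap_apply_one]
    exact isOpen_interior.mem_nhds hy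
  obtain ⟨t, ht1, ht⟩ := hmem.exists_gt
  refine ⟨t - 1, by linarith, ?_⟩
  have := interior_subset ht
  rw [Set.mem_preimage, AffineMap.lineMap_apply] at this
  convert this using 1
  simp only [q', vadd_eq_add, AffineSubspace.coe_vadd, Submodule.coe_smul,
    AffineSubspace.coe_vsub, vsub_eq_sub]
  module

lemma isExtreme_maximizers {F : Set V} (φ : V →ₗ[ℝ] ℝ) :
    IsExtreme ℝ F {x ∈ F | ∀ y ∈ F, φ y ≤ φ x} := by
  refine ⟨Set.sep_subset _ _, ?_⟩
  rintro x hx y hy z ⟨hz, hzm⟩ ⟨a, b, ha, hb, hab, rfl⟩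
  refine ⟨hx, fun w hw => (hzm w hw).trans ?_⟩
  have h1 := hzm y hy
  simp only [map_add, map_smul, smul_eq_mul] at h1 ⊢
  have : b = 1 - a := by linarith
  subst this
  nlinarith

lemma lc_mem_of_convex {Q : Set V} (hQ : Convex ℝ Q) {f : V →₀ ℝ} (hf : 0 ≤ f) (hd : deg f = 1)
    (hfQ : ∀ v ∈ f.support, v ∈ Q) : lc f ∈ Q := by
  rw [lc_eq_sum f subset_rfl]
  exact hQ.sum_mem (fun v _ => hf v) (by rw [← hd, deg_eq_sum f subset_rfl]) hfQ

lemma mem_of_isExtreme {Q R : Set V} (hQ : Convex ℝ Q) (hR : IsExtreme ℝ Q R) {f : V →₀ ℝ}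
    (hf : 0 ≤ f) (hd : deg f = 1) (hfQ : ∀ v ∈ f.support, v ∈ Q)
    (hp : lc f ∈ R) : ∀ v ∈ f.support, v ∈ R := by
  classical
  intro v hv
  have hfv : 0 < f v := lt_of_le_of_ne (hf v) (Ne.symm (Finsupp.mem_support_iff.1 hv))
  have hsplit := Finsupp.single_add_erase v f
  have hg : 0 ≤ f.erase v := fun w => by
    rw [Finsupp.erase_apply]; split_ifs
    exacts [le_rfl, hf w]
  have hgd : 0 ≤ deg (f.erase v) := by
    rw [deg_eq_sum _ subset_rfl]; exact Finset.sum_nonneg fun w _ => hg w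
  rw [← hsplit, map_add, deg_single] at hd
  rw [← hsplit, map_add, lc_single] at hp
  rcases hgd.eq_or_lt with h | h
  · have hv1 : f v = 1 := by linarith
    rw [eq_zero_of_deg hg h.symm, map_zero, hv1, one_smul, add_zero] at hp
    exact hp
  · have hq : lc ((deg (f.erase v))⁻¹ • f.erase v) ∈ Q := by
      refine lc_mem_of_convex hQ (fun w => mul_nonneg (inv_nonneg.2 h.le) (hg w)) ?_ fun w hw => ?_
      · rw [map_smul, smul_eq_mul, inv_mul_cancel₀ h.ne']
      · have := Finsupp.support_smul hw
        rw [Finsupp.support_erase] at this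
        exact hfQ w (Finset.mem_of_mem_erase this)
    refine hR.2 (hfQ v hv) hq hp ⟨f v, _, hfv, h, hd, ?_⟩
    rw [map_smul, smul_smul, mul_inv_cancel₀ h.ne', one_smul]

end Polytopes

end UnimodularTriangulation

namespace UnimodularTriangulation

open scoped Classical

variable {d : ℕ} {X : Set (Set (Fin d → ℝ))} {P Q R : Set (Fin d → ℝ)}

lemma IsPolytope.convex (hP : IsPolytope P) : Convex ℝ P := by
  obtain ⟨V, -, rfl⟩ := hP
  exact convex_convexHull ℝ _

lemma IsPolytope.isCompact (hP : IsPolytope P) : IsCompact P := by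
  obtain ⟨V, -, rfl⟩ := hP
  exact V.finite_toSet.isCompact_convexHull (𝕜 := ℝ)

lemma IsPolytope.nonempty (hP : IsPolytope P) : P.Nonempty := by
  obtain ⟨V, hV, rfl⟩ := hP
  exact (convexHull_nonempty_iff).2 (Finset.coe_nonempty.2 hV)

lemma IsIntegralPolytope.isLatticePt (hP : IsIntegralPolytope P) {v : Fin d → ℝ}
    (hv : v ∈ P.extremePoints ℝ) : IsLatticePt v := by
  obtain ⟨V, -, hV, rfl⟩ := hP
  exact hV v (extremePoints_convexHull_subset hv)

/-- A point of a member `Q` lies in the relative interior of a face of `Q`. -/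
lemma exists_carrier (hX : IsPolytopalComplex X) (hQ : Q ∈ X) {p : Fin d → ℝ} (hp : p ∈ Q) :
    ∃ F ∈ X, IsExtreme ℝ Q F ∧ p ∈ intrinsicInterior ℝ F := by
  have hfin : {F | F ∈ X ∧ IsExtreme ℝ Q F ∧ p ∈ F}.Finite := hX.1.subset fun F hF => hF.1
  obtain ⟨F, hF⟩ := hfin.exists_minimal ⟨Q, hQ, IsExtreme.rfl, hp⟩
  refine ⟨F, hF.1.1, hF.1.2.1, ?_⟩
  by_contra hp'
  obtain ⟨φ, hφ, y, hy, hlt⟩ :=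
    exists_supporting (IsPolytope.convex (hX.2.1 F hF.1.1)) hF.1.2.2 hp'
  have hmem : {x ∈ F | ∀ y ∈ F, φ y ≤ φ x} ∈ {F | F ∈ X ∧ IsExtreme ℝ Q F ∧ p ∈ F} := by
    have hpm : p ∈ {x ∈ F | ∀ y ∈ F, φ y ≤ φ x} := ⟨hF.1.2.2, hφ⟩
    exact ⟨hX.2.2.1 F hF.1.1 _ ⟨⟨p, hpm⟩, φ, rfl⟩, hF.1.2.1.trans (isExtreme_maximizers φ), hpm⟩
  have := hF.2 hmem (Set.sep_subset _ _) hy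
  exact absurd (this.2 p hF.1.2.2) (not_le.2 hlt)

lemma carrier_unique (hX : IsPolytopalComplex X) (hQ : Q ∈ X) (hR : R ∈ X) {p : Fin d → ℝ}
    (hpQ : p ∈ intrinsicInterior ℝ Q) (hpR : p ∈ intrinsicInterior ℝ R) : Q = R := by
  by_contra hne
  exact (hX.2.2.2 Q hQ R hR hne).subset ⟨hpQ, hpR⟩

lemma isExtreme_of_mem (hX : IsPolytopalComplex X) (hQ : Q ∈ X) (hR : R ∈ X) {p : Fin d → ℝ}
    (hpR : p ∈ intrinsicInterior ℝ R) (hpQ : p ∈ Q) : IsExtreme ℝ Q R := by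
  obtain ⟨F, hF, hFQ, hpF⟩ := exists_carrier hX hQ hpQ
  rwa [carrier_unique hX hR hF hpR hpF]

lemma isExtreme_of_subset (hX : IsPolytopalComplex X) (hQ : Q ∈ X) (hR : R ∈ X) (h : R ⊆ Q) :
    IsExtreme ℝ Q R := by
  obtain ⟨p, hp⟩ := Set.Nonempty.intrinsicInterior (IsPolytope.convex (hX.2.1 R hR))
    (IsPolytope.nonempty (hX.2.1 R hR))
  exact isExtreme_of_mem hX hQ hR hp (h (intrinsicInterior_subset hp))

lemma wellFounded_ordering (V : Type*) : WellFounded (WellOrderingRel (α := V)) :=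
  WellOrderingRel.isWellOrder.wf

/-- The first vertex of a polytope in a fixed order of the ambient points. -/
noncomputable def apex (Q : Set (Fin d → ℝ)) : Fin d → ℝ :=
  if h : (Q.extremePoints ℝ).Nonempty then (wellFounded_ordering _).min _ h else 0

lemma apex_mem_extremePoints (hQ : IsPolytope Q) : apex Q ∈ Q.extremePoints ℝ := by
  have h := (IsPolytope.isCompact hQ).extremePoints_nonempty (IsPolytope.nonempty hQ)
  rw [apex, dif_pos h]
  exact WellFounded.min_mem _ _ _

lemma apex_mem (hQ : IsPolytope Q) : apex Q ∈ Q := (apex_mem_extremePoints hQ).1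

lemma not_lt_apex {v : Fin d → ℝ} (hv : v ∈ Q.extremePoints ℝ) :
    ¬ WellOrderingRel v (apex Q) := by
  rw [apex, dif_pos ⟨v, hv⟩]
  exact (wellFounded_ordering _).not_lt_min _ hv

lemma apex_eq (hX : IsPolytopalComplex X) (hQ : Q ∈ X) (hR : R ∈ X) (h : R ⊆ Q)
    (hv : apex Q ∈ R) : apex R = apex Q := by
  have hext := isExtreme_of_subset hX hQ hR h
  have h1 : apex R ∈ Q.extremePoints ℝ :=
    hext.extremePoints_subset_extremePoints (apex_mem_extremePoints (hX.2.1 R hR))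
  have h2 : apex Q ∈ R.extremePoints ℝ := by
    rw [hext.extremePoints_eq]
    exact ⟨hv, apex_mem_extremePoints (hX.2.1 Q hQ)⟩
  rcases trichotomous_of WellOrderingRel (apex R) (apex Q) with h | h | h
  · exact absurd h (not_lt_apex h1)
  · exact h
  · exact absurd h (not_lt_apex h2)

/-- The simplices of the pulling triangulation of `Q`. -/
inductive Pulling (X : Set (Set (Fin d → ℝ))) : Set (Fin d → ℝ) → Finset (Fin d → ℝ) → Prop
  | nil {Q : Set (Fin d → ℝ)} : Q ∈ X → Pulling X Q ∅
  | single {Q : Set (Fin d → ℝ)} : Q ∈ X → Pulling X Q {apex Q}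
  | mono {Q R : Set (Fin d → ℝ)} {S : Finset (Fin d → ℝ)} :
      Q ∈ X → R ⊆ Q → Pulling X R S → Pulling X Q S
  | cons {Q R : Set (Fin d → ℝ)} {S : Finset (Fin d → ℝ)} : Q ∈ X → R ⊆ Q → apex Q ∉ R →
      Pulling X R S → Pulling X Q (insert (apex Q) S)

variable {S S' : Finset (Fin d → ℝ)}

lemma Pulling.mem (h : Pulling X Q S) : Q ∈ X := by cases h <;> assumption

lemma Pulling.extreme (hX : IsPolytopalComplex X) (h : Pulling X Q S) :
    ∀ v ∈ S, v ∈ Q.extremePoints ℝ := by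
  induction h with
  | nil => simp
  | single hQ => simpa using apex_mem_extremePoints (hX.2.1 _ hQ)
  | mono hQ hR h ih =>
    exact fun v hv =>
      (isExtreme_of_subset hX hQ h.mem hR).extremePoints_subset_extremePoints (ih v hv)
  | cons hQ hR ha h ih =>
    intro v hv
    rcases Finset.mem_insert.1 hv with rfl | hv
    · exact apex_mem_extremePoints (hX.2.1 _ hQ)
    · exact (isExtreme_of_subset hX hQ h.mem hR).extremePoints_subset_extremePoints (ih v hv)

lemma Pulling.subset (h : Pulling X Q S) : ∀ S' ⊆ S, Pulling X Q S' := by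
  induction h with
  | nil hQ =>
    intro S' hS'
    rw [Finset.subset_empty.1 hS']
    exact .nil hQ
  | single hQ =>
    intro S' hS'
    rcases Finset.subset_singleton_iff.1 hS' with rfl | rfl
    · exact .nil hQ
    · exact .single hQ
  | mono hQ hR h ih => exact fun S' hS' => .mono hQ hR (ih S' hS')
  | @cons Q R S hQ hR ha h ih =>
    intro S' hS'
    by_cases hv : apex Q ∈ S'
    · rw [← Finset.insert_erase hv]
      exact .cons hQ hR ha (ih _ (by rw [← Finset.subset_insert_iff]; exact hS'))
    · exact .mono hQ hR (ih _ ((Finset.subset_insert_iff_of_notMem hv).1 hS'))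

lemma Pulling.decompose (hX : IsPolytopalComplex X) (h : Pulling X Q S) (hS : S.Nonempty) :
    ∃ Q' ∈ X, ∃ R S', Convex ℝ R ∧ IsExtreme ℝ Q' R ∧ apex Q' ∉ R ∧ (∀ v ∈ S', v ∈ R) ∧
      S = insert (apex Q') S' := by
  induction h with
  | nil => simp at hS
  | @single Q hQ =>
    exact ⟨Q, hQ, ∅, ∅, convex_empty, ⟨Set.empty_subset _, by simp⟩, by simp, by simp, by simp⟩
  | mono hQ hR h ih => exact ih hS
  | @cons Q R S hQ hR ha h ih =>
    exact ⟨Q, hQ, R, S, IsPolytope.convex (hX.2.1 R h.mem), isExtreme_of_subset hX hQ h.mem hR, ha,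
      fun v hv => (h.extreme hX v hv).1, rfl⟩

lemma isCompact_ray (hQ : IsCompact Q) (x : Fin d → ℝ) {u : Fin d → ℝ} (hu : u ≠ 0) :
    IsCompact {t : ℝ | x + t • u ∈ Q} := by
  have hcont : Continuous fun t : ℝ => x + t • u := by fun_prop
  refine Metric.isCompact_of_isClosed_isBounded (hQ.isClosed.preimage hcont) ?_
  obtain ⟨B, hB⟩ := hQ.isBounded.exists_norm_le
  refine isBounded_iff_forall_norm_le.2 ⟨(B + ‖x‖) / ‖u‖, fun t ht => ?_⟩
  rw [le_div_iff₀ (norm_pos_iff.2 hu), ← norm_smul]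
  have := hB _ ht
  calc ‖t • u‖ = ‖(x + t • u) - x‖ := by simp
    _ ≤ ‖x + t • u‖ + ‖x‖ := norm_sub_le _ _
    _ ≤ _ := by linarith

lemma exists_pulling (hX : IsPolytopalComplex X) (hQ : Q ∈ X) {p : Fin d → ℝ} (hp : p ∈ Q) :
    ∃ S, Pulling X Q S ∧ p ∈ convexHull ℝ (S : Set (Fin d → ℝ)) := by
  induction h : (hX.1.subset (Set.sep_subset X (· ⊆ Q))).toFinset.card using
    Nat.strong_induction_on generalizing Q p with
  | _ n ih =>
  subst h
  have hpoly := hX.2.1 Q hQ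
  have ha := apex_mem hpoly
  by_cases hpa : p = apex Q
  · exact ⟨_, .single hQ, by simp [hpa]⟩
  · -- follow the ray from the apex through `p` until it leaves `Q`
    have hK : IsCompact {t : ℝ | apex Q + t • (p - apex Q) ∈ Q} :=
      isCompact_ray (IsPolytope.isCompact hpoly) _ (sub_ne_zero.2 hpa)
    obtain ⟨t, ht, htmax⟩ := hK.exists_isGreatest ⟨1, by simpa using hp⟩
    have ht1 : 1 ≤ t := htmax (by simpa using hp)
    obtain ⟨F, hF, hFQ, hpF⟩ := exists_carrier hX hQ ht
    have haF : apex Q ∉ F := by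
      intro haF
      obtain ⟨δ, hδ, hmem⟩ := exists_extension hpF haF
      have : t + δ * t ≤ t := by
        refine htmax ?_
        have := hFQ.subset hmem
        rw [Set.mem_ofPred_eq]
        convert this using 1
        module
      nlinarith
    obtain ⟨S, hS, hpS⟩ := ih _ (Finset.card_lt_card (by
      refine Finset.ssubset_iff_subset_ne.2 ⟨fun R hR => ?_, fun heq => ?_⟩
      · simp only [Set.Finite.mem_toFinset, Set.mem_sep_iff] at hR ⊢
        exact ⟨hR.1, hR.2.trans hFQ.subset⟩
      · have : Q ∈ (hX.1.subset (Set.sep_subset X (· ⊆ F))).toFinset := by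
          rw [heq]; simp [hQ]
        simp only [Set.Finite.mem_toFinset, Set.mem_sep_iff] at this
        exact haF (this.2 ha))) hF (intrinsicInterior_subset hpF) rfl
    refine ⟨_, .cons hQ hFQ.subset haF hS, ?_⟩
    have hc := convex_convexHull ℝ ((insert (apex Q) S : Finset (Fin d → ℝ)) : Set (Fin d → ℝ))
    have h1 : apex Q ∈ convexHull ℝ ((insert (apex Q) S : Finset (Fin d → ℝ)) : Set (Fin d → ℝ)) :=
      subset_convexHull _ _ (by simp)
    have h2 := convexHull_mono (𝕜 := ℝ) (Finset.coe_subset.2 (Finset.subset_insert (apex Q) S)) hpS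
    have ht0 : t ≠ 0 := by linarith
    have := hc h1 h2 (a := 1 - t⁻¹) (b := t⁻¹) (by simpa using inv_le_one_of_one_le₀ ht1)
      (by positivity) (by ring)
    convert this using 1
    rw [smul_add, smul_smul, inv_mul_cancel₀ ht0]
    module

lemma not_lt_of_extreme {F : Set (Fin d → ℝ)} (hF : Convex ℝ F) (hR : Convex ℝ R)
    (hFR : IsExtreme ℝ F R) {v : Fin d → ℝ} (hvF : v ∈ F) (hv : v ∉ R) {f f' : (Fin d → ℝ) →₀ ℝ}
    (hf : 0 ≤ f) (hf' : 0 ≤ f') (hd : deg f = 1) (hd' : deg f' = 1)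
    (hfR : ∀ w ∈ f.support, w ≠ v → w ∈ R) (hfF : ∀ w ∈ f'.support, w ∈ F)
    (h : lc f = lc f') : ¬ f v < f' v := by
  intro hlt
  have hsplit := Finsupp.single_add_erase v f
  have hsplit' := Finsupp.single_add_erase v f'
  have hg : ∀ {k : (Fin d → ℝ) →₀ ℝ}, 0 ≤ k → 0 ≤ k.erase v := fun {k} hk w => by
    rw [Finsupp.erase_apply]; split_ifs
    exacts [le_rfl, hk w]
  have hgd' : 0 ≤ deg (f'.erase v) := by
    rw [deg_eq_sum _ subset_rfl]; exact Finset.sum_nonneg fun w _ => hg hf' w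
  rw [← hsplit, map_add, deg_single] at hd
  rw [← hsplit', map_add, deg_single] at hd'
  rw [← hsplit, ← hsplit', map_add, map_add, lc_single, lc_single] at h
  set c := deg (f.erase v) with hc
  have hc0 : 0 < c := by linarith
  have hq : lc (c⁻¹ • f.erase v) ∈ R := by
    refine lc_mem_of_convex hR (fun w => mul_nonneg (inv_nonneg.2 hc0.le) (hg hf w)) ?_
      fun w hw => ?_
    · rw [map_smul, smul_eq_mul, ← hc, inv_mul_cancel₀ hc0.ne']
    · have := Finsupp.support_smul hw
      rw [Finsupp.support_erase, Finset.mem_erase] at this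
      exact hfR w this.2 this.1
  set k : (Fin d → ℝ) →₀ ℝ := c⁻¹ • (Finsupp.single v (f' v - f v) + f'.erase v) with hk
  have hkv : k v = c⁻¹ * (f' v - f v) := by simp [hk]
  have hkq : lc k = lc (c⁻¹ • f.erase v) := by
    rw [hk, map_smul, map_smul, map_add, lc_single, sub_smul]
    congr 1
    rw [sub_add_eq_add_sub, ← h, add_sub_cancel_left]
  refine hv (mem_of_isExtreme hF hFR (f := k) (fun w => ?_) ?_ (fun w hw => ?_)
    (hkq ▸ hq) v ?_)
  · refine mul_nonneg (inv_nonneg.2 hc0.le) (add_nonneg ?_ (hg hf' w))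
    rw [Finsupp.single_apply]; split_ifs <;> linarith
  · rw [hk, map_smul, map_add, deg_single, smul_eq_mul, inv_mul_eq_one₀ hc0.ne']
    linarith
  · by_cases hwv : w = v
    · exact hwv ▸ hvF
    · refine hfF w (Finsupp.mem_support_iff.2 fun h0 => Finsupp.mem_support_iff.1 hw ?_)
      simp [hk, Finsupp.erase_ne hwv, h0, Finsupp.single_eq_of_ne hwv]
  · rw [Finsupp.mem_support_iff, hkv]
    exact (mul_pos (inv_pos.2 hc0) (by linarith)).ne'

lemma Pulling.facet (hX : IsPolytopalComplex X) {f : (Fin d → ℝ) →₀ ℝ} (hf : 0 ≤ f)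
    (hd : deg f = 1) (hS : Pulling X Q f.support) {F : Set (Fin d → ℝ)} (hF : F ∈ X)
    (hp : lc f ∈ intrinsicInterior ℝ F) :
    apex F ∈ f.support ∧ (∀ v ∈ f.support, v ∈ F) ∧ ∃ R, Convex ℝ R ∧ IsExtreme ℝ F R ∧ apex F ∉ R ∧
      ∀ v ∈ f.support, v ≠ apex F → v ∈ R := by
  have hne : f.support.Nonempty := by
    rw [Finsupp.support_nonempty_iff]
    rintro rfl
    simp at hd
  obtain ⟨Q', hQ', R, S', hR, hQR, haR, hS'R, hSeq⟩ := hS.decompose hX hne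
  have hmem : ∀ v ∈ f.support, v ∈ Q' := by
    intro v hv
    rw [hSeq] at hv
    rcases Finset.mem_insert.1 hv with rfl | hv
    · exact apex_mem (hX.2.1 _ hQ')
    · exact hQR.subset (hS'R v hv)
  have hconv := IsPolytope.convex (hX.2.1 Q' hQ')
  have hext := isExtreme_of_mem hX hQ' hF hp (lc_mem_of_convex hconv hf hd hmem)
  have hmemF := mem_of_isExtreme hconv hext hf hd hmem (intrinsicInterior_subset hp)
  have hmem' : apex Q' ∈ f.support := by rw [hSeq]; simp
  have hapex : apex F = apex Q' := apex_eq hX hQ' hF hext.subset (hmemF _ hmem')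
  refine ⟨hapex ▸ hmem', hmemF, F ∩ R, (IsPolytope.convex (hX.2.1 F hF)).inter hR,
    (hext.inter hQR).mono hext.subset Set.inter_subset_left, fun h => haR (hapex ▸ h.2),
    fun v hv hva => ⟨hmemF v hv, ?_⟩⟩
  rw [hSeq] at hv
  exact hS'R v (Finset.mem_of_mem_insert_of_ne hv (hapex ▸ hva))

lemma Pulling.unique (hX : IsPolytopalComplex X) {f f' : (Fin d → ℝ) →₀ ℝ} (hf : 0 ≤ f)
    (hf' : 0 ≤ f') (hd : deg f = 1) (hd' : deg f' = 1) (hS : Pulling X Q f.support)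
    (hS' : Pulling X R f'.support) (h : lc f = lc f') : f = f' := by
  induction hn : f.support.card using Nat.strong_induction_on generalizing f f' with
  | _ n ih =>
  subst hn
  have hpQ : lc f ∈ Q := lc_mem_of_convex (IsPolytope.convex (hX.2.1 Q hS.mem)) hf hd
    fun v hv => (hS.extreme hX v hv).1
  obtain ⟨F, hF, -, hpF⟩ := exists_carrier hX hS.mem hpQ
  have hFc := IsPolytope.convex (hX.2.1 F hF)
  have haF := apex_mem (hX.2.1 F hF)
  obtain ⟨hvf, hfF, K, hK, hFK, haK, hfK⟩ := hS.facet hX hf hd hF hpF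
  obtain ⟨-, hfF', K', hK', hFK', haK', hfK'⟩ := hS'.facet hX hf' hd' hF (h ▸ hpF)
  set v := apex F
  have hv : f v = f' v := le_antisymm
    (not_lt.1 (not_lt_of_extreme hFc hK' hFK' haF haK' hf' hf hd' hd hfK' hfF h.symm))
    (not_lt.1 (not_lt_of_extreme hFc hK hFK haF haK hf hf' hd hd' hfK hfF' h))
  have hsplit := Finsupp.single_add_erase v f
  have hsplit' := Finsupp.single_add_erase v f'
  have hg : ∀ {k : (Fin d → ℝ) →₀ ℝ}, 0 ≤ k → 0 ≤ k.erase v := fun {k} hk w => by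
    rw [Finsupp.erase_apply]; split_ifs
    exacts [le_rfl, hk w]
  rw [← hsplit, map_add, deg_single] at hd
  rw [← hsplit', map_add, deg_single, ← hv] at hd'
  have hlc : lc (f.erase v) = lc (f'.erase v) := by
    rw [← hsplit, ← hsplit', map_add, map_add, lc_single, lc_single, hv] at h
    exact add_left_cancel h
  rw [← hsplit, ← hsplit', ← hv]
  congr 1
  set c := deg (f.erase v) with hc
  have hc' : deg (f'.erase v) = c := by linarith
  have hc0 : 0 ≤ c := by
    rw [hc, deg_eq_sum _ subset_rfl]; exact Finset.sum_nonneg fun w _ => hg hf w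
  rcases hc0.eq_or_lt with h0 | h0
  · rw [eq_zero_of_deg (hg hf) (hc ▸ h0.symm), eq_zero_of_deg (hg hf') (hc'.trans h0.symm)]
  have hsub : ∀ k : (Fin d → ℝ) →₀ ℝ, (c⁻¹ • k.erase v).support ⊆ k.support :=
    fun k => Finsupp.support_smul.trans (by
      rw [Finsupp.support_erase]; exact Finset.erase_subset _ _)
  have key := ih _ ?_ (f := c⁻¹ • f.erase v) (f' := c⁻¹ • f'.erase v)
    (fun w => mul_nonneg (inv_nonneg.2 h0.le) (hg hf w))
    (fun w => mul_nonneg (inv_nonneg.2 h0.le) (hg hf' w))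
    (by rw [map_smul, smul_eq_mul, ← hc, inv_mul_cancel₀ h0.ne'])
    (by rw [map_smul, smul_eq_mul, hc', inv_mul_cancel₀ h0.ne'])
    (hS.subset _ (hsub f)) (hS'.subset _ (hsub f')) (by rw [map_smul, map_smul, hlc]) rfl
  · exact smul_right_injective _ (inv_ne_zero h0.ne') key
  · refine Finset.card_lt_card (Finset.ssubset_iff_subset_ne.2 ⟨hsub f, fun heq => ?_⟩)
    rw [← heq] at hvf
    simp at hvf

end UnimodularTriangulation

namespace UnimodularTriangulation

open scoped Classical

variable {d : ℕ} {X : Set (Set (Fin d → ℝ))}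

/-- Points of `ℝ^d` with a height and auxiliary coordinates. -/
abbrev Ambient (d : ℕ) : Type := ((Fin d → ℝ) × ℝ) × (ℕ → ℝ)

/-- The points of the ambient space all of whose coordinates are integers. -/
def ambientLattice (d : ℕ) : AddSubgroup (Ambient d) where
  carrier := {x | IsLatticePt x.1.1 ∧ (∃ z : ℤ, x.1.2 = z) ∧ ∀ c, ∃ z : ℤ, x.2 c = z}
  zero_mem' := ⟨(intLattice d).zero_mem, ⟨0, by simp⟩, fun _ => ⟨0, by simp⟩⟩
  add_mem' := by
    rintro x y ⟨h1, ⟨z, hz⟩, h3⟩ ⟨h1', ⟨z', hz'⟩, h3'⟩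
    refine ⟨(intLattice d).add_mem h1 h1', ⟨z + z', by simp [hz, hz']⟩, fun c => ?_⟩
    obtain ⟨w, hw⟩ := h3 c
    obtain ⟨w', hw'⟩ := h3' c
    exact ⟨w + w', by simp [hw, hw']⟩
  neg_mem' := by
    rintro x ⟨h1, ⟨z, hz⟩, h3⟩
    refine ⟨(intLattice d).neg_mem h1, ⟨-z, by simp [hz]⟩, fun c => ?_⟩
    obtain ⟨w, hw⟩ := h3 c
    exact ⟨-w, by simp [hw]⟩

/-- The auxiliary coordinates grade the ambient space. -/
noncomputable def grading (d : ℕ) : Grading (ambientLattice d) where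
  co c := LinearMap.proj c ∘ₗ LinearMap.snd ℝ _ _
  e c := (0, Pi.single c 1)
  co_e c c' := by simp [Pi.single_apply]
  e_mem c := ⟨(intLattice d).zero_mem, ⟨0, by simp⟩, fun c' =>
    ⟨if c' = c then 1 else 0, by simp [Pi.single_apply]⟩⟩
  int c x hx := hx.2.2 c

/-- The height functional. -/
noncomputable def height (d : ℕ) : Ambient d →ₗ[ℝ] ℝ :=
  LinearMap.snd ℝ _ _ ∘ₗ LinearMap.fst ℝ _ _

/-- The cone over `Q` at height one, with all auxiliary coordinates allowed. -/
def coneOver (Q : Set (Fin d → ℝ)) : Set (Ambient d) :=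
  {x | 0 ≤ x.1.2 ∧ x.1.1 ∈ x.1.2 • Q}

/-- The points of height `s` above the members of `s • X`. -/
def floor (X : Set (Set (Fin d → ℝ))) (s : ℕ) : Set (Ambient d) :=
  {p | ∃ Q ∈ X, ∃ y ∈ (s : ℝ) • Q, p = ((y, (s : ℝ)), 0)}

lemma isCone_coneOver {Q : Set (Fin d → ℝ)} (hQ : IsPolytope Q) : IsCone (coneOver Q) := by
  intro f hf hfK
  rw [lc_eq_sum f subset_rfl]
  refine Finset.sum_induction _ (· ∈ coneOver Q) ?_ ?_ fun v hv => ?_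
  · rintro x y ⟨hx, hx'⟩ ⟨hy, hy'⟩
    refine ⟨add_nonneg hx hy, ?_⟩
    have := (IsPolytope.convex hQ).add_smul hx hy
    rw [Prod.fst_add, Prod.fst_add, Prod.snd_add, this]
    exact Set.add_mem_add hx' hy'
  · refine ⟨le_rfl, ?_⟩
    obtain ⟨q, hq⟩ := IsPolytope.nonempty hQ
    exact ⟨q, hq, by simp⟩
  · obtain ⟨h1, q, hq, hqv⟩ := hfK v hv
    exact ⟨mul_nonneg (hf v) h1, q, hq, by simp [← hqv, mul_smul]⟩

lemma coneSystem (hX : IsPolytopalComplex X) :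
    (grading d).ConeSystem (coneOver '' X) (height d) where
  cone := by
    rintro _ ⟨Q, hQ, rfl⟩
    exact isCone_coneOver (hX.2.1 Q hQ)
  line := by
    rintro _ ⟨Q, hQ, rfl⟩ c r
    obtain ⟨q, hq⟩ := IsPolytope.nonempty (hX.2.1 Q hQ)
    exact ⟨by simp [grading], q, hq, by simp [grading]⟩
  apply_e c := by simp [grading, height]

/-- The embedding of `ℝ^d` at height `s` and auxiliary coordinates those of `e c`. -/
noncomputable def lift (d : ℕ) (s : ℝ) (c : ℕ) : (Fin d → ℝ) ↪ Ambient d where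
  toFun v := ((v, s), Pi.single c 1)
  inj' v w h := by simpa using h

lemma lift_apply (s : ℝ) (c : ℕ) (v : Fin d → ℝ) : lift d s c v = ((v, s), Pi.single c 1) := rfl

lemma lc_embDomain_lift (s : ℝ) (c : ℕ) (g : (Fin d → ℝ) →₀ ℝ) :
    lc (g.embDomain (lift d s c)) = ((lc g, deg g * s), deg g • Pi.single c 1) := by
  induction g using Finsupp.induction_linear with
  | zero => simp only [Finsupp.embDomain_zero, map_zero, zero_mul, zero_smul, Prod.mk_zero_zero]
  | add f g hf hg => simp [Finsupp.embDomain_add, hf, hg, add_mul, add_smul]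
  | single v t =>
    rw [Finsupp.embDomain_single, lc_single, lc_single, deg_single, lift_apply]
    rfl

lemma exists_embDomain {α β : Type*} (ι : α ↪ β) {f : β →₀ ℝ} {S : Finset α}
    (h : f.support ⊆ S.map ι) : ∃ g : α →₀ ℝ, g.support ⊆ S ∧ f = g.embDomain ι := by
  refine ⟨f.comapDomain ι ι.injective.injOn, fun a ha => ?_, ?_⟩
  · rw [Finsupp.mem_support_iff, Finsupp.comapDomain_apply, ← Finsupp.mem_support_iff] at ha
    simpa using h ha
  · refine (Finsupp.embDomain_comapDomain fun b hb => ?_).symm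
    obtain ⟨a, -, rfl⟩ := Finset.mem_map.1 (h hb)
    exact ⟨a, rfl⟩

lemma nonneg_of_embDomain {α β : Type*} (ι : α ↪ β) {g : α →₀ ℝ} (h : 0 ≤ g.embDomain ι) :
    0 ≤ g := fun a => by
  have := h (ι a)
  rwa [Finsupp.embDomain_apply_self] at this

lemma embDomain_nonneg {α β : Type*} (ι : α ↪ β) {g : α →₀ ℝ} (h : 0 ≤ g) :
    0 ≤ g.embDomain ι := fun b => by
  by_cases hb : b ∈ Set.range ι
  · obtain ⟨a, rfl⟩ := hb
    rw [Finsupp.embDomain_apply_self]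
    exact h a
  · rw [Finsupp.embDomain_of_notMem_range _ _ _ hb]
    exact le_rfl

lemma exists_lc_of_mem_convexHull {V : Type*} [AddCommGroup V] [Module ℝ V] {S : Finset V} {q : V}
    (h : q ∈ convexHull ℝ (S : Set V)) :
    ∃ g : V →₀ ℝ, 0 ≤ g ∧ g.support ⊆ S ∧ deg g = 1 ∧ lc g = q := by
  obtain ⟨w, hw, hw1, hq⟩ := Finset.mem_convexHull'.1 h
  have hsub := Finsupp.support_indicator_subset S fun v _ => w v
  have hval : ∀ v ∈ S, Finsupp.indicator S (fun v _ => w v) v = w v := fun v hv =>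
    Finsupp.indicator_of_mem hv _
  refine ⟨Finsupp.indicator S fun v _ => w v, fun v => ?_, hsub, ?_, ?_⟩
  · rw [Finsupp.indicator_apply]
    split_ifs with hv
    exacts [hw v hv, le_rfl]
  · rw [deg_eq_sum _ hsub, ← hw1]
    exact Finset.sum_congr rfl hval
  · rw [lc_eq_sum _ hsub, ← hq]
    exact Finset.sum_congr rfl fun v hv => by rw [hval v hv]

/-- The pulling triangulation of a complex, at height one. -/
def initialFan (X : Set (Set (Fin d → ℝ))) : Set (Finset (Ambient d)) :=
  {T | ∃ Q S, Pulling X Q S ∧ T = S.map (lift d 1 0)}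

lemma isFan_initialFan (hX : IsPolytopalComplex X) (hint : ∀ Q ∈ X, IsIntegralPolytope Q) :
    IsFan (ambientLattice d) (initialFan X) where
  finite := by
    have hfin : (⋃ Q ∈ X, Q.extremePoints ℝ).Finite := by
      refine hX.1.biUnion fun Q hQ => ?_
      obtain ⟨V, -, rfl⟩ := hX.2.1 Q hQ
      exact V.finite_toSet.subset extremePoints_convexHull_subset
    refine (hfin.toFinset.powerset.finite_toSet.image fun S => S.map (lift d 1 0)).subset ?_
    rintro _ ⟨Q, S, hS, rfl⟩
    refine ⟨S, ?_, rfl⟩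
    simp only [Finset.coe_powerset, Set.mem_preimage, Set.mem_powerset_iff]
    intro v hv
    simpa using ⟨Q, hS.mem, hS.extreme hX v hv⟩
  down := by
    rintro _ ⟨Q, S, hS, rfl⟩ S' hS'
    obtain ⟨S'', h, rfl⟩ := Finset.subset_map_iff.1 hS'
    exact ⟨Q, S'', hS.subset _ h, rfl⟩
  uniq := by
    rintro _ ⟨Q, S, hS, rfl⟩ _ ⟨Q', S', hS', rfl⟩ f f' hf hf' hfS hfS' h
    obtain ⟨g, hg, rfl⟩ := exists_embDomain _ hfS
    obtain ⟨g', hg', rfl⟩ := exists_embDomain _ hfS'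
    rw [lc_embDomain_lift, lc_embDomain_lift] at h
    have h1 : lc g = lc g' := congrArg (fun x => x.1.1) h
    have h2 : deg g = deg g' := by simpa using congrArg (fun x => x.1.2) h
    have hg0 := nonneg_of_embDomain _ hf
    have hg0' := nonneg_of_embDomain _ hf'
    congr 1
    have hd : 0 ≤ deg g := by
      rw [deg_eq_sum _ subset_rfl]; exact Finset.sum_nonneg fun w _ => hg0 w
    rcases hd.eq_or_lt with h0 | h0
    · rw [eq_zero_of_deg hg0 h0.symm, eq_zero_of_deg hg0' (h0.trans h2).symm]
    · refine smul_right_injective _ (inv_ne_zero h0.ne') (Pulling.unique hX ?_ ?_ ?_ ?_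
        (hS.subset _ (Finsupp.support_smul.trans hg))
        (hS'.subset _ (Finsupp.support_smul.trans hg'))
        ?_)
      · exact fun w => mul_nonneg (inv_nonneg.2 h0.le) (hg0 w)
      · exact fun w => mul_nonneg (inv_nonneg.2 h0.le) (hg0' w)
      · rw [map_smul, smul_eq_mul, inv_mul_cancel₀ h0.ne']
      · rw [map_smul, smul_eq_mul, ← h2, inv_mul_cancel₀ h0.ne']
      · rw [map_smul, map_smul, h1]
  mem := by
    rintro _ ⟨Q, S, hS, rfl⟩ v hv
    obtain ⟨u, hu, rfl⟩ := Finset.mem_map.1 hv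
    refine ⟨IsIntegralPolytope.isLatticePt (hint Q hS.mem) (hS.extreme hX u hu),
      ⟨1, by simp [lift_apply]⟩, fun c => ⟨if c = 0 then 1 else 0, ?_⟩⟩
    simp [lift_apply, Pi.single_apply]

lemma finite_box (S : Finset (Fin d → ℝ)) :
    (box (ambientLattice d) (S.map (lift d 1 0))).Finite := by
  obtain ⟨B, hB⟩ := exists_nat_ge (∑ v ∈ S, (1 + ∑ i, |v i|))
  let F : (Fin d → ℤ) × ℤ → Ambient d := fun z =>
    ((fun i => (z.1 i : ℝ), (z.2 : ℝ)), (z.2 : ℝ) • Pi.single 0 1)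
  refine ((Set.finite_Icc (α := (Fin d → ℤ) × ℤ) (fun _ => -B, -B) (fun _ => B, B)).image F).subset
    ?_
  rintro x ⟨hx, β, hβ, hβ0, hβ1, rfl⟩
  obtain ⟨g, hg, rfl⟩ := exists_embDomain _ hβ
  have hg0 := nonneg_of_embDomain _ hβ0
  have hg1 : ∀ v, g v ≤ 1 := fun v => by
    simpa [Finsupp.embDomain_apply_self] using (hβ1 (lift d 1 0 v)).le
  rw [lc_embDomain_lift, mul_one] at hx ⊢
  obtain ⟨h, hh⟩ : ∃ h : ℤ, deg g = h := hx.2.1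
  have hx1 : ∀ i, ∃ z : ℤ, lc g i = z := hx.1
  choose z hz using hx1
  have hbd : ∀ i, |lc g i| ≤ B := fun i => by
    rw [lc_eq_sum g hg, Finset.sum_apply]
    refine (Finset.abs_sum_le_sum_abs _ _).trans ((Finset.sum_le_sum fun v _ => ?_).trans hB)
    rw [Pi.smul_apply, smul_eq_mul, abs_mul, abs_of_nonneg (hg0 v)]
    have h1 := Finset.single_le_sum (f := fun i => |v i|) (fun i _ => abs_nonneg _)
      (Finset.mem_univ i)
    have h2 := mul_le_mul_of_nonneg_right (hg1 v) (abs_nonneg (v i))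
    linarith
  have hbd' : |deg g| ≤ B := by
    rw [deg_eq_sum g hg]
    refine (Finset.abs_sum_le_sum_abs _ _).trans ((Finset.sum_le_sum fun v _ => ?_).trans hB)
    rw [abs_of_nonneg (hg0 v)]
    have := Finset.sum_nonneg fun i (_ : i ∈ Finset.univ) => abs_nonneg (v i)
    linarith [hg1 v]
  refine ⟨(z, h), ?_, ?_⟩
  · simp only [hz, hh, abs_le] at hbd hbd'
    refine ⟨⟨fun i => ?_, ?_⟩, ⟨fun i => ?_, ?_⟩⟩
    · have := (hbd i).1
      dsimp only
      exact_mod_cast this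
    · have := hbd'.1
      dsimp only
      exact_mod_cast this
    · have := (hbd i).2
      dsimp only
      exact_mod_cast this
    · have := hbd'.2
      dsimp only
      exact_mod_cast this
  · simp only [F, ← hh]
    congr 2
    ext i
    exact (hz i).symm

lemma leveled_initialFan (hX : IsPolytopalComplex X) (hint : ∀ Q ∈ X, IsIntegralPolytope Q) :
    ∃ N, (grading d).Leveled (coneOver '' X) (height d) 0 1 (N + 1) (fun _ => 1)
      (initialFan X) := by
  have hfan := isFan_initialFan hX hint
  obtain ⟨N, hN⟩ : ∃ N : ℕ, ∀ S ∈ initialFan X, (box (ambientLattice d) S).encard ≤ N := by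
    have hfin := hfan.finite
    refine ⟨∑ S ∈ hfin.toFinset, (box (ambientLattice d) S).ncard, fun S hS => ?_⟩
    obtain ⟨Q, S₀, hS₀, rfl⟩ := id hS
    rw [← (finite_box S₀).cast_ncard_eq]
    exact_mod_cast Finset.single_le_sum (f := fun S => (box (ambientLattice d) S).ncard)
      (fun _ _ => Nat.zero_le _) (hfin.mem_toFinset.2 hS)
  refine ⟨N, hfan, ?_, fun S hS => (hN S hS).trans (by exact_mod_cast N.le_succ), ?_⟩
  · rintro _ ⟨Q, S, hS, rfl⟩ v hv
    obtain ⟨u, hu, rfl⟩ := Finset.mem_map.1 hv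
    exact ⟨0, one_pos, fun c => by simp [grading, lift_apply, Pi.single_apply]⟩
  · rintro _ ⟨Q, S, hS, rfl⟩
    refine ⟨coneOver Q, ⟨Q, hS.mem, rfl⟩, fun v hv => ?_⟩
    obtain ⟨u, hu, rfl⟩ := Finset.mem_map.1 hv
    refine ⟨⟨zero_le_one, ?_⟩, fun _ _ _ => rfl⟩
    simpa [lift_apply] using (hS.extreme hX u hu).1

lemma adequate_initialFan (hX : IsPolytopalComplex X) :
    (grading d).Adequate (floor X) 0 1 (initialFan X) := by
  intro C
  refine ⟨C, fun s hs => ⟨fun _ => s, fun i hi => ?_, ?_⟩⟩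
  · obtain rfl : i = 0 := by omega
    simpa using hs
  · rintro _ ⟨Q, hQ, _, ⟨q, hq, rfl⟩, rfl⟩
    obtain ⟨S, hS, hqS⟩ := exists_pulling hX hQ hq
    obtain ⟨g, hg0, hgS, hgd, rfl⟩ := exists_lc_of_mem_convexHull hqS
    refine ⟨((s : ℝ) • g).embDomain (lift d 1 0), ?_, ?_, ?_⟩
    · rw [Finsupp.support_embDomain]
      exact ⟨Q, _, hS.subset _ (Finsupp.support_smul.trans hgS), rfl⟩
    · exact embDomain_nonneg _ fun v => mul_nonneg (Nat.cast_nonneg s) (hg0 v)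
    · rw [lc_embDomain_lift]
      simp [hgd, grading, Nat.cast_smul_eq_nsmul]

end UnimodularTriangulation

namespace UnimodularTriangulation

open scoped Classical

variable {d : ℕ}

/-- A finite simplicial complex, given by the vertex sets of its simplices, all of whose
simplices are unimodular. -/
structure IsUnimodularComplex (K : Set (Finset (Fin d → ℝ))) : Prop where
  finite : K.Finite
  down : ∀ S ∈ K, ∀ S' ⊆ S, S' ∈ K
  uniq : ∀ S ∈ K, ∀ S' ∈ K, ∀ f f' : (Fin d → ℝ) →₀ ℝ, 0 ≤ f → 0 ≤ f' → f.support ⊆ S →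
    f'.support ⊆ S' → lc f = lc f' → deg f = deg f' → f = f'
  mem : ∀ S ∈ K, ∀ v ∈ S, IsLatticePt v
  box : ∀ S ∈ K, ∀ f : (Fin d → ℝ) →₀ ℝ, 0 ≤ f → (∀ v, f v < 1) → f.support ⊆ S →
    IsLatticePt (lc f) → (∃ z : ℤ, deg f = z) → f = 0

/-- The simplices with the given vertex sets. -/
def geometricSimplices (K : Set (Finset (Fin d → ℝ))) : Set (Set (Fin d → ℝ)) :=
  {P | ∃ S ∈ K, S.Nonempty ∧ P = convexHull ℝ (S : Set (Fin d → ℝ))}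

namespace IsUnimodularComplex

variable {K : Set (Finset (Fin d → ℝ))} {S S' : Finset (Fin d → ℝ)}

lemma eq_zero (hK : IsUnimodularComplex K) (hS : S ∈ K) {k : (Fin d → ℝ) →₀ ℝ}
    (hk : k.support ⊆ S) (hk0 : lc k = 0) (hkd : deg k = 0) : k = 0 := by
  let p : (Fin d → ℝ) →₀ ℝ := k.mapRange (fun t => max t 0) (by simp)
  let q : (Fin d → ℝ) →₀ ℝ := k.mapRange (fun t => max (-t) 0) (by simp)
  have hpq : k = p - q := by
    ext v
    simp only [p, q, Finsupp.sub_apply, Finsupp.mapRange_apply]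
    rcases le_total (k v) 0 with h | h <;> simp [h]
  have : p = q := by
    apply hK.uniq S hS S hS p q
    · intro v; simp [p]
    · intro v; simp [q]
    · exact (Finsupp.support_mapRange).trans hk
    · exact (Finsupp.support_mapRange).trans hk
    · rw [hpq, map_sub] at hk0
      exact sub_eq_zero.1 hk0
    · rw [hpq, map_sub] at hkd
      exact sub_eq_zero.1 hkd
  rw [hpq, this, sub_self]

lemma eq_zero_of_sum (hK : IsUnimodularComplex K) (hS : S ∈ K)
    (s : Finset ↥(S : Set (Fin d → ℝ))) (w : ↥(S : Set (Fin d → ℝ)) → ℝ)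
    (hw : ∑ e ∈ s, w e • (e : Fin d → ℝ) = 0) (hw' : ∑ e ∈ s, w e = 0) : ∀ e ∈ s, w e = 0 := by
  let k : (Fin d → ℝ) →₀ ℝ := ∑ e ∈ s, Finsupp.single (e : Fin d → ℝ) (w e)
  have hk : k = 0 := by
    refine hK.eq_zero hS (Finsupp.support_finsetSum.trans ?_) ?_ ?_
    · refine Finset.biUnion_subset.2 fun e _ => Finsupp.support_single_subset.trans ?_
      simp
    · simpa only [k, map_sum, lc_single] using hw
    · simpa only [k, map_sum, deg_single] using hw'
  intro e he
  have := DFunLike.congr_fun hk (e : Fin d → ℝ)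
  simp only [k, Finsupp.finsetSum_apply, Finsupp.single_apply, Finsupp.coe_zero,
    Pi.zero_apply, ← Subtype.ext_iff] at this
  simpa [he] using this

lemma affineIndependent (hK : IsUnimodularComplex K) (hS : S ∈ K) :
    AffineIndependent ℝ (Subtype.val : ↥(S : Set (Fin d → ℝ)) → (Fin d → ℝ)) :=
  affineIndependent_iff.2 fun s w hw' hw => hK.eq_zero_of_sum hS s w hw hw'

/-- Prescribed values at the vertices of a simplex. -/
lemma exists_functional (hK : IsUnimodularComplex K) (hS : S ∈ K) (u : (Fin d → ℝ) → ℝ) :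
    ∃ (φ : (Fin d → ℝ) →ₗ[ℝ] ℝ) (c : ℝ), ∀ v ∈ S, φ v = u v - c := by
  let x : ↥(S : Set (Fin d → ℝ)) → (Fin d → ℝ) × ℝ := fun v => (v, 1)
  have hli : LinearIndependent ℝ x := by
    rw [linearIndependent_iff']
    intro s w hw e he
    have h1 : ∑ e ∈ s, w e • (e : Fin d → ℝ) = 0 := by
      have := congrArg Prod.fst hw
      simpa [x, Prod.fst_sum] using this
    have h2 : ∑ e ∈ s, w e = 0 := by
      have := congrArg Prod.snd hw
      simpa [x, Prod.snd_sum] using this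
    exact hK.eq_zero_of_sum hS s w h1 h2 e he
  obtain ⟨Ψ, hΨ⟩ := LinearMap.exists_extend
    ((Module.Basis.span hli).constr ℝ fun v => u v)
  refine ⟨Ψ ∘ₗ LinearMap.inl ℝ _ _, Ψ (0, 1), fun v hv => ?_⟩
  have h1 : Ψ (x ⟨v, hv⟩) = u v := by
    have h2 := congrArg (fun l => l (Module.Basis.span hli ⟨v, hv⟩)) hΨ
    rw [Module.Basis.constr_basis, LinearMap.comp_apply, Submodule.subtype_apply,
      Module.Basis.span_apply] at h2
    exact h2
  rw [← h1, eq_sub_iff_add_eq, LinearMap.comp_apply, LinearMap.inl_apply, ← map_add]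
  simp [x]

lemma isFaceOf (hK : IsUnimodularComplex K) (hS : S ∈ K) (hS' : S' ⊆ S) (hne : S'.Nonempty) :
    IsFaceOf (convexHull ℝ (S' : Set (Fin d → ℝ))) (convexHull ℝ (S : Set (Fin d → ℝ))) := by
  refine ⟨convexHull_nonempty_iff.2 (Finset.coe_nonempty.2 hne), ?_⟩
  obtain ⟨φ, c, hφ⟩ := hK.exists_functional hS fun v => if v ∈ S' then 1 else 0
  have hle : ∀ y ∈ convexHull ℝ (S : Set (Fin d → ℝ)), φ y ≤ 1 - c := by
    refine convexHull_min (fun v hv => ?_) (convex_halfSpace_le φ.isLinear _)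
    change φ v ≤ 1 - c
    rw [hφ v (Finset.mem_coe.1 hv)]
    split_ifs <;> linarith
  have heq : ∀ y ∈ convexHull ℝ (S' : Set (Fin d → ℝ)), φ y = 1 - c := by
    refine convexHull_min (fun v hv => ?_) (convex_hyperplane φ.isLinear _)
    change φ v = 1 - c
    rw [hφ v (hS' hv), if_pos (Finset.mem_coe.1 hv)]
  refine ⟨φ, Set.Subset.antisymm (fun x hx => ?_) fun x hx => ?_⟩
  · exact ⟨convexHull_mono (Finset.coe_subset.2 hS') hx, fun y hy =>
      (hle y hy).trans_eq (heq x hx).symm⟩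
  · obtain ⟨f, hf0, hfS, hfd, rfl⟩ := exists_lc_of_mem_convexHull hx.1
    have hmem := mem_of_isExtreme (convex_convexHull ℝ _) (isExtreme_maximizers φ) hf0 hfd
      (fun v hv => subset_convexHull ℝ _ (hfS hv)) hx
    refine lc_mem_of_convex (convex_convexHull ℝ _) hf0 hfd fun v hv => subset_convexHull ℝ _ ?_
    obtain ⟨v', hv'⟩ := hne
    have := (hmem v hv).2 v' (subset_convexHull ℝ _ (hS' hv'))
    rw [hφ _ (hS' hv'), hφ _ (hfS hv), if_pos hv'] at this
    by_contra hcon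
    rw [if_neg fun h => hcon (Finset.mem_coe.2 h)] at this
    linarith

lemma extremePoints (hK : IsUnimodularComplex K) (hS : S ∈ K) :
    (convexHull ℝ (S : Set (Fin d → ℝ))).extremePoints ℝ = S := by
  refine extremePoints_convexHull_subset.antisymm fun v hv => ?_
  obtain ⟨-, φ, hφ⟩ := hK.isFaceOf hS (Finset.singleton_subset_iff.2 hv)
    (Finset.singleton_nonempty v)
  rw [Finset.coe_singleton, convexHull_singleton] at hφ
  rw [← isExtreme_singleton, hφ]
  exact isExtreme_maximizers φ

lemma exists_lc_of_mem_span_sub {x : Fin d → ℝ}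
    (hx : x ∈ Submodule.span ℝ {w | ∃ u ∈ S, ∃ v ∈ S, w = u - v}) :
    ∃ f : (Fin d → ℝ) →₀ ℝ, f.support ⊆ S ∧ deg f = 0 ∧ lc f = x := by
  induction hx using Submodule.span_induction with
  | mem x h =>
    obtain ⟨u, hu, v, hv, rfl⟩ := h
    refine ⟨Finsupp.single u 1 - Finsupp.single v 1, Finsupp.support_sub.trans
      (Finset.union_subset (Finsupp.support_single_subset.trans (by simpa using hu))
      (Finsupp.support_single_subset.trans (by simpa using hv))), ?_, ?_⟩
    · simp [deg_single]
    · simp [lc_single]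
  | zero => exact ⟨0, by simp⟩
  | add x y _ _ hx hy =>
    obtain ⟨f, hfS, hfd, rfl⟩ := hx
    obtain ⟨g, hgS, hgd, rfl⟩ := hy
    exact ⟨f + g, Finsupp.support_add.trans (Finset.union_subset hfS hgS),
      by rw [map_add, hfd, hgd, add_zero], map_add _ _ _⟩
  | smul a x _ hx =>
    obtain ⟨f, hfS, hfd, rfl⟩ := hx
    exact ⟨a • f, Finsupp.support_smul.trans hfS, by rw [map_smul, hfd, smul_zero],
      map_smul _ _ _⟩

lemma sum_zsmul_mem_closure {a : (Fin d → ℝ) → ℤ} (ha : ∑ v ∈ S, a v = 0) :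
    ∑ v ∈ S, a v • v ∈ AddSubgroup.closure {w | ∃ u ∈ S, ∃ v ∈ S, w = u - v} := by
  rcases S.eq_empty_or_nonempty with rfl | ⟨v₀, hv₀⟩
  · simp
  have : ∑ v ∈ S, a v • v = ∑ v ∈ S, a v • (v - v₀) := by
    simp only [smul_sub, Finset.sum_sub_distrib, ← Finset.sum_smul, ha, zero_smul, sub_zero]
  rw [this]
  refine AddSubgroup.sum_mem _ fun v hv => AddSubgroup.zsmul_mem _ ?_ _
  exact AddSubgroup.subset_closure ⟨v, hv, v₀, hv₀, rfl⟩

lemma polyIndex_eq_one (hK : IsUnimodularComplex K) (hS : S ∈ K) :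
    polyIndex (convexHull ℝ (S : Set (Fin d → ℝ))) = 1 := by
  have hvd : vertexDiffs (convexHull ℝ (S : Set (Fin d → ℝ))) =
      {w | ∃ u ∈ S, ∃ v ∈ S, w = u - v} := by
    rw [vertexDiffs, hK.extremePoints hS]; rfl
  rw [polyIndex, AddSubgroup.index_eq_one, AddSubgroup.addSubgroupOf_eq_top]
  rintro x ⟨hx, hxL⟩
  rw [latL, hvd]
  have hx' : x ∈ Submodule.span ℝ (vertexDiffs (convexHull ℝ (S : Set (Fin d → ℝ)))) := hx
  rw [hvd] at hx'
  obtain ⟨f, hfS, hfd, rfl⟩ := exists_lc_of_mem_span_sub hx'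
  have hfr : ∀ v, fr f v = f v - ⌊f v⌋ := fun v => by
    rw [fr, Finsupp.mapRange_apply, Int.fract]
  have hfrS : (fr f).support ⊆ S := Finsupp.support_mapRange.trans hfS
  have hlc : lc (fr f) = lc f - ∑ v ∈ S, ⌊f v⌋ • v := by
    rw [lc_eq_sum _ hfrS, lc_eq_sum _ hfS, ← Finset.sum_sub_distrib]
    refine Finset.sum_congr rfl fun v _ => ?_
    rw [hfr, sub_smul, Int.cast_smul_eq_zsmul]
  have hdeg : deg (fr f) = ((-∑ v ∈ S, ⌊f v⌋ : ℤ) : ℝ) := by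
    rw [Int.cast_neg, ← zero_sub, ← hfd, deg_eq_sum _ hfrS, deg_eq_sum _ hfS, Int.cast_sum,
      ← Finset.sum_sub_distrib]
    exact Finset.sum_congr rfl fun v _ => hfr v
  have hsum : ∑ v ∈ S, ⌊f v⌋ • v ∈ intLattice d :=
    AddSubgroup.sum_mem _ fun v hv => AddSubgroup.zsmul_mem _ (hK.mem S hS v hv) _
  have h0 : fr f = 0 := by
    refine hK.box S hS (fr f) (fun v => ?_) (fun v => ?_) hfrS ?_ ⟨_, hdeg⟩
    · exact Int.fract_nonneg _
    · exact Int.fract_lt_one _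
    · rw [hlc]
      exact (intLattice d).sub_mem hxL hsum
  rw [h0, map_zero, eq_comm, sub_eq_zero] at hlc
  rw [hlc]
  refine sum_zsmul_mem_closure (S := S) (a := fun v => ⌊f v⌋) ?_
  rw [h0, map_zero] at hdeg
  exact neg_eq_zero.1 (by exact_mod_cast hdeg.symm)

lemma isUnimodularSimplex (hK : IsUnimodularComplex K) (hS : S ∈ K) (hne : S.Nonempty) :
    IsUnimodularSimplex (convexHull ℝ (S : Set (Fin d → ℝ))) :=
  ⟨⟨S, hne, hK.mem S hS, hK.affineIndependent hS, rfl⟩, hK.polyIndex_eq_one hS⟩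

lemma exists_of_isFaceOf {F : Set (Fin d → ℝ)}
    (hF : IsFaceOf F (convexHull ℝ (S : Set (Fin d → ℝ)))) :
    ∃ S' ⊆ S, S'.Nonempty ∧ F = convexHull ℝ (S' : Set (Fin d → ℝ)) := by
  obtain ⟨hne, φ, hφ⟩ := hF
  have hext : IsExtreme ℝ (convexHull ℝ (S : Set (Fin d → ℝ))) F := hφ ▸ isExtreme_maximizers φ
  have hconv : Convex ℝ F := by
    rw [hφ]
    rintro x ⟨hx, hx'⟩ y ⟨hy, hy'⟩ a b ha hb hab
    refine ⟨convex_convexHull ℝ _ hx hy ha hb hab, fun z hz => ?_⟩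
    have h1 := mul_le_mul_of_nonneg_left (hx' z hz) ha
    have h2 := mul_le_mul_of_nonneg_left (hy' z hz) hb
    rw [map_add, map_smul, map_smul, smul_eq_mul, smul_eq_mul]
    calc φ z = a * φ z + b * φ z := by rw [← add_mul, hab, one_mul]
      _ ≤ _ := add_le_add h1 h2
  have heq : F = convexHull ℝ ((S.filter (· ∈ F) : Finset (Fin d → ℝ)) : Set (Fin d → ℝ)) := by
    refine Set.Subset.antisymm (fun x hx => ?_)
      (convexHull_min (fun v hv => (Finset.mem_filter.1 hv).2) hconv)
    obtain ⟨f, hf0, hfS, hfd, rfl⟩ := exists_lc_of_mem_convexHull (hext.subset hx)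
    have hmem := mem_of_isExtreme (convex_convexHull ℝ _) hext hf0 hfd
      (fun v hv => subset_convexHull ℝ _ (hfS hv)) hx
    exact lc_mem_of_convex (convex_convexHull ℝ _) hf0 hfd fun v hv => subset_convexHull ℝ _
      (Finset.mem_filter.2 ⟨hfS hv, hmem v hv⟩)
  refine ⟨_, Finset.filter_subset _ _, ?_, heq⟩
  rw [heq, convexHull_nonempty_iff] at hne
  exact Finset.coe_nonempty.1 hne

lemma convexHull_inter (hK : IsUnimodularComplex K) (hS : S ∈ K) (hS' : S' ∈ K) :
    convexHull ℝ (S : Set (Fin d → ℝ)) ∩ convexHull ℝ (S' : Set (Fin d → ℝ)) =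
      convexHull ℝ ((S ∩ S' : Finset (Fin d → ℝ)) : Set (Fin d → ℝ)) := by
  refine Set.Subset.antisymm ?_ (Set.subset_inter
    (convexHull_mono (Finset.coe_subset.2 Finset.inter_subset_left))
    (convexHull_mono (Finset.coe_subset.2 Finset.inter_subset_right)))
  rintro x ⟨hx, hx'⟩
  obtain ⟨f, hf0, hfS, hfd, rfl⟩ := exists_lc_of_mem_convexHull hx
  obtain ⟨f', hf0', hfS', hfd', h⟩ := exists_lc_of_mem_convexHull hx'
  obtain rfl := hK.uniq S hS S' hS' f f' hf0 hf0' hfS hfS' h.symm (hfd.trans hfd'.symm)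
  exact lc_mem_of_convex (convex_convexHull ℝ _) hf0 hfd fun v hv => subset_convexHull ℝ _
    (Finset.mem_inter.2 ⟨hfS hv, hfS' hv⟩)

theorem isUnimodularTriangulation (hK : IsUnimodularComplex K) :
    IsUnimodularTriangulation (geometricSimplices K) (⋃₀ geometricSimplices K) := by
  have huni : ∀ P ∈ geometricSimplices K, IsUnimodularSimplex P := by
    rintro _ ⟨S, hS, hne, rfl⟩
    exact hK.isUnimodularSimplex hS hne
  refine ⟨⟨?_, fun P hP => ?_, rfl, ?_, ?_⟩, huni⟩
  · refine (hK.finite.image fun S : Finset (Fin d → ℝ) =>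
      convexHull ℝ (S : Set (Fin d → ℝ))).subset ?_
    rintro _ ⟨S, hS, -, rfl⟩
    exact ⟨S, hS, rfl⟩
  · obtain ⟨S, hne, -, h⟩ := (huni P hP).1
    exact ⟨S, hne, h⟩
  · rintro _ ⟨S, hS, hne, rfl⟩ F hF
    obtain ⟨S', hS', hne', rfl⟩ := exists_of_isFaceOf hF
    exact ⟨S', hK.down S hS S' hS', hne', rfl⟩
  · rintro _ ⟨S, hS, hne, rfl⟩ _ ⟨S', hS', hne', rfl⟩
    rw [hK.convexHull_inter hS hS']
    rcases (S ∩ S').eq_empty_or_nonempty with h | h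
    · left; simp [h]
    · exact .inr ⟨hK.isFaceOf hS Finset.inter_subset_left h,
        hK.isFaceOf hS' Finset.inter_subset_right h⟩

end IsUnimodularComplex

end UnimodularTriangulation

namespace UnimodularTriangulation

open scoped Classical

variable {d : ℕ} {X : Set (Set (Fin d → ℝ))} {b s : ℕ} {a : ℕ → ℝ} {T : Set (Finset (Ambient d))}

lemma IsUnimodularComplex.of_subset {K K' : Set (Finset (Fin d → ℝ))} (hK : IsUnimodularComplex K)
    (h : K' ⊆ K) (hdown : ∀ S ∈ K', ∀ S' ⊆ S, S' ∈ K') : IsUnimodularComplex K' where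
  finite := hK.finite.subset h
  down := hdown
  uniq S hS S' hS' := hK.uniq S (h hS) S' (h hS')
  mem S hS := hK.mem S (h hS)
  box S hS := hK.box S (h hS)

lemma isExtreme_smul {t : ℝ} (ht : t ≠ 0) {Q F : Set (Fin d → ℝ)} (h : IsExtreme ℝ Q F) :
    IsExtreme ℝ (t • Q) (t • F) := by
  refine ⟨Set.smul_set_mono h.subset, ?_⟩
  rintro _ ⟨x, hx, rfl⟩ _ ⟨y, hy, rfl⟩ _ ⟨z, hz, rfl⟩ ⟨α, β, hα, hβ, hαβ, he⟩
  refine ⟨x, h.left_mem_of_mem_openSegment hx hy hz ⟨α, β, hα, hβ, hαβ, ?_⟩, rfl⟩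
  refine smul_right_injective _ ht ?_
  simpa only [smul_add, smul_comm t] using he

/-- The simplices whose copies at height `s` and auxiliary coordinate `b` span cones of `T`. -/
def slice (b s : ℕ) (T : Set (Finset (Ambient d))) : Set (Finset (Fin d → ℝ)) :=
  {S | S.map (lift d s b) ∈ T}

lemma exists_eq_map_lift
    (hT : (grading d).Leveled (coneOver '' X) (height d) b 1 1 a T) {S : Finset (Ambient d)}
    (hS : S ∈ T) : ∃ S' : Finset (Fin d → ℝ), S = S'.map (lift d (a 0) b) := by
  have key : ∀ v ∈ S, lift d (a 0) b v.1.1 = v := by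
    intro v hv
    obtain ⟨i, hi, hvi⟩ := hT.part S hS v hv
    obtain ⟨C, -, hC⟩ := hT.refines S hS
    obtain rfl : i = 0 := by omega
    refine Prod.ext (Prod.ext rfl ((hC v hv).2 0 hi hvi).symm) (funext fun c => ?_)
    change Pi.single b 1 c = _
    rw [Pi.single_apply]
    exact (hvi c).symm
  refine ⟨S.image fun v => v.1.1, Finset.ext fun v => ?_⟩
  rw [Finset.mem_map]
  refine ⟨fun hv => ⟨v.1.1, Finset.mem_image_of_mem _ hv, key v hv⟩, ?_⟩
  rintro ⟨u, hu, rfl⟩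
  obtain ⟨w, hw, rfl⟩ := Finset.mem_image.1 hu
  rwa [key w hw]

lemma exists_lift_rep (hT : (grading d).Leveled (coneOver '' X) (height d) b 1 1 a T)
    {y : Fin d → ℝ} {t : ℝ} (hy : InFan T (((y, t), 0) + (grading d).e b)) :
    a 0 = t ∧ ∃ g : (Fin d → ℝ) →₀ ℝ,
      0 ≤ g ∧ g.support.map (lift d (a 0) b) ∈ T ∧ deg g = 1 ∧ lc g = y := by
  obtain ⟨f, hfT, hf, hlc⟩ := hy
  obtain ⟨S, hS⟩ := exists_eq_map_lift hT hfT
  obtain ⟨g, -, rfl⟩ := exists_embDomain _ hS.subset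
  have he : (((y, t), 0) + (grading d).e b : Ambient d) = ((y, t), Pi.single b 1) := by
    simp [grading]
  rw [lc_embDomain_lift, he] at hlc
  have h1 : lc g = y := congrArg (fun x => x.1.1) hlc
  have h2 : deg g * a 0 = t := congrArg (fun x => x.1.2) hlc
  have h3 : deg g = 1 := by simpa using congrArg (fun x => x.2 b) hlc
  rw [h3, one_mul] at h2
  rw [Finsupp.support_embDomain] at hfT
  exact ⟨h2, g, nonneg_of_embDomain _ hf, hfT, h3, h1⟩

lemma isUnimodularComplex_slice
    (hT : (grading d).Leveled (coneOver '' X) (height d) b 1 1 a T) :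
    IsUnimodularComplex (slice b s T) where
  finite := hT.fan.finite.preimage (Finset.map_injective _).injOn
  down S hS S' hS' := hT.fan.down _ hS _ (Finset.map_subset_map.2 hS')
  uniq S hS S' hS' f f' hf hf' hfS hfS' hlc hdeg := by
    refine Finsupp.embDomain_injective (lift d s b) (hT.fan.uniq _ hS _ hS' _ _
      (embDomain_nonneg _ hf) (embDomain_nonneg _ hf') ?_ ?_ ?_)
    · rw [Finsupp.support_embDomain]
      exact Finset.map_subset_map.2 hfS
    · rw [Finsupp.support_embDomain]
      exact Finset.map_subset_map.2 hfS'
    · rw [lc_embDomain_lift, lc_embDomain_lift, hlc, hdeg]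
  mem S hS v hv := (hT.fan.mem _ hS _ (Finset.mem_map_of_mem _ hv)).1
  box S hS f hf hf1 hfS hlc := by
    rintro ⟨z, hz⟩
    have hsupp : (f.embDomain (lift d s b)).support ⊆ S.map (lift d s b) := by
      rw [Finsupp.support_embDomain]
      exact Finset.map_subset_map.2 hfS
    have hbox : lc (f.embDomain (lift d s b)) ∈ box (ambientLattice d) (S.map (lift d s b)) := by
      refine ⟨?_, _, hsupp, embDomain_nonneg _ hf, fun v => ?_, rfl⟩
      · rw [lc_embDomain_lift, hz]
        refine ⟨hlc, ⟨z * s, by push_cast; rfl⟩, fun c => ⟨if c = b then z else 0, ?_⟩⟩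
        simp [Pi.single_apply]
      · by_cases hv : v ∈ Set.range (lift d s b)
        · obtain ⟨u, rfl⟩ := hv
          rw [Finsupp.embDomain_apply_self]
          exact hf1 u
        · rw [Finsupp.embDomain_of_notMem_range _ _ _ hv]
          exact one_pos
    have h0 : (0 : Ambient d) ∈ box (ambientLattice d) (S.map (lift d s b)) :=
      ⟨zero_mem _, 0, by simp, le_rfl, fun _ => one_pos, map_zero _⟩
    have heq := Set.encard_le_one_iff.1 (hT.box_le _ hS) _ _ hbox h0
    refine Finsupp.embDomain_injective (lift d s b) ?_
    rw [Finsupp.embDomain_zero]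
    exact hT.fan.linInd hS hsupp (by simp) (by rw [heq, map_zero])

lemma exists_subset_of_mem_slice
    (hT : (grading d).Leveled (coneOver '' X) (height d) b 1 1 a T) {S : Finset (Fin d → ℝ)}
    (hS : S ∈ slice b s T) : ∃ Q ∈ X, (S : Set (Fin d → ℝ)) ⊆ (s : ℝ) • Q := by
  obtain ⟨_, ⟨Q, hQ, rfl⟩, h⟩ := hT.refines _ hS
  exact ⟨Q, hQ, fun v hv => (h _ (Finset.mem_map_of_mem _ hv)).1.2⟩

lemma exists_slice_rep (hT : (grading d).Leveled (coneOver '' X) (height d) b 1 1 a T)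
    (hcov : ∀ p ∈ floor X s, InFan T (p + (grading d).e b)) {Q : Set (Fin d → ℝ)} (hQ : Q ∈ X)
    {y : Fin d → ℝ} (hy : y ∈ (s : ℝ) • Q) :
    ∃ g : (Fin d → ℝ) →₀ ℝ, 0 ≤ g ∧ g.support ∈ slice b s T ∧ deg g = 1 ∧ lc g = y := by
  obtain ⟨h, g, hg⟩ := exists_lift_rep hT (hcov _ ⟨Q, hQ, y, hy, rfl⟩)
  rw [h] at hg
  exact ⟨g, hg⟩

lemma convex_smul (hX : IsPolytopalComplex X) {Q : Set (Fin d → ℝ)} (hQ : Q ∈ X) :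
    Convex ℝ ((s : ℝ) • Q) :=
  (IsPolytope.convex (hX.2.1 Q hQ)).smul _

lemma support_subset_smul (hX : IsPolytopalComplex X) (hs : s ≠ 0)
    (hT : (grading d).Leveled (coneOver '' X) (height d) b 1 1 a T) {Q : Set (Fin d → ℝ)}
    (hQ : Q ∈ X) {g : (Fin d → ℝ) →₀ ℝ} (hg : 0 ≤ g) (hgT : g.support ∈ slice b s T)
    (hgd : deg g = 1) (hgQ : lc g ∈ (s : ℝ) • Q) :
    (g.support : Set (Fin d → ℝ)) ⊆ (s : ℝ) • Q := by
  have hs' : (s : ℝ) ≠ 0 := Nat.cast_ne_zero.2 hs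
  obtain ⟨Q', hQ', hgQ'⟩ := exists_subset_of_mem_slice hT hgT
  obtain ⟨q', hq', hqq'⟩ := lc_mem_of_convex (convex_smul hX hQ') hg hgd hgQ'
  obtain ⟨q, hq, hqy⟩ := hgQ
  obtain rfl : q' = q := smul_right_injective _ hs' (hqq'.trans hqy.symm)
  obtain ⟨F, hF, hFQ, hqF⟩ := exists_carrier hX hQ hq
  have hFQ' := isExtreme_of_mem hX hQ' hF hqF hq'
  have := mem_of_isExtreme (convex_smul hX hQ') (isExtreme_smul hs' hFQ') hg hgd hgQ'
    ⟨q', intrinsicInterior_subset hqF, hqy⟩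
  exact fun v hv => Set.smul_set_mono hFQ.subset (this v hv)

lemma mem_sUnion_geometricSimplices {K : Set (Finset (Fin d → ℝ))} {g : (Fin d → ℝ) →₀ ℝ}
    (hg : 0 ≤ g) (hgK : g.support ∈ K) (hgd : deg g = 1) : lc g ∈ ⋃₀ geometricSimplices K := by
  refine ⟨_, ⟨g.support, hgK, ?_, rfl⟩, lc_mem_of_convex (convex_convexHull ℝ _) hg hgd
    (subset_convexHull ℝ _)⟩
  rw [Finset.nonempty_iff_ne_empty, Ne, Finsupp.support_eq_empty]
  rintro rfl
  simp at hgd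

theorem exists_unimodular_triangulation (hX : IsPolytopalComplex X) (hs : s ≠ 0)
    (hT : (grading d).Leveled (coneOver '' X) (height d) b 1 1 a T)
    (hcov : ∀ p ∈ floor X s, InFan T (p + (grading d).e b)) :
    ∃ 𝒯 : Set (Set (Fin d → ℝ)),
      IsUnimodularTriangulation 𝒯 (⋃ Q ∈ X, (s : ℝ) • Q) ∧
      (∀ P ∈ 𝒯, ∃ Q ∈ X, P ⊆ (s : ℝ) • Q) ∧
      ∀ Q ∈ X, IsUnimodularTriangulation {P ∈ 𝒯 | P ⊆ (s : ℝ) • Q} ((s : ℝ) • Q) := by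
  have hK := isUnimodularComplex_slice (s := s) hT
  have hsub : ∀ P ∈ geometricSimplices (slice b s T), ∃ Q ∈ X, P ⊆ (s : ℝ) • Q := by
    rintro _ ⟨S, hS, -, rfl⟩
    obtain ⟨Q, hQ, h⟩ := exists_subset_of_mem_slice hT hS
    exact ⟨Q, hQ, convexHull_min h (convex_smul hX hQ)⟩
  refine ⟨geometricSimplices (slice b s T), ?_, hsub, fun Q hQ => ?_⟩
  · convert hK.isUnimodularTriangulation using 1
    refine Set.Subset.antisymm ?_ ?_
    · intro y hy
      obtain ⟨Q, hQ, hy⟩ := Set.mem_iUnion₂.1 hy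
      obtain ⟨g, hg, hgT, hgd, rfl⟩ := exists_slice_rep hT hcov hQ hy
      exact mem_sUnion_geometricSimplices hg hgT hgd
    · rintro y ⟨P, hP, hy⟩
      obtain ⟨Q, hQ, h⟩ := hsub P hP
      exact Set.mem_iUnion₂.2 ⟨Q, hQ, h hy⟩
  · have hK' : IsUnimodularComplex
        {S ∈ slice b s T | (S : Set (Fin d → ℝ)) ⊆ (s : ℝ) • Q} :=
      hK.of_subset (fun S hS => hS.1) fun S hS S' hS' =>
        ⟨hK.down S hS.1 S' hS', (Finset.coe_subset.2 hS').trans hS.2⟩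
    have heq : {P ∈ geometricSimplices (slice b s T) | P ⊆ (s : ℝ) • Q} =
        geometricSimplices {S ∈ slice b s T | (S : Set (Fin d → ℝ)) ⊆ (s : ℝ) • Q} := by
      ext P
      constructor
      · rintro ⟨⟨S, hS, hne, rfl⟩, h⟩
        exact ⟨S, ⟨hS, (subset_convexHull ℝ _).trans h⟩, hne, rfl⟩
      · rintro ⟨S, ⟨hS, h⟩, hne, rfl⟩
        exact ⟨⟨S, hS, hne, rfl⟩, convexHull_min h (convex_smul hX hQ)⟩
    rw [heq]
    convert hK'.isUnimodularTriangulation using 1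
    refine Set.Subset.antisymm (fun y hy => ?_) ?_
    · obtain ⟨g, hg, hgT, hgd, rfl⟩ := exists_slice_rep hT hcov hQ hy
      exact mem_sUnion_geometricSimplices hg
        ⟨hgT, support_subset_smul hX hs hT hQ hg hgT hgd hy⟩ hgd
    · rintro y ⟨_, ⟨S, ⟨-, h⟩, -, rfl⟩, hy⟩
      exact convexHull_min h (convex_smul hX hQ) hy

end UnimodularTriangulation

theorem statement3 (d : ℕ) (hd : 0 < d) (X : Set (Set (Fin d → ℝ)))
    (hX : IsPolytopalComplex X) (hint : ∀ Q ∈ X, IsIntegralPolytope Q) :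
    ∃ c : ℕ, 0 < c ∧ ∀ c' : ℕ, c ≤ c' →
      ∃ T : Set (Set (Fin d → ℝ)),
        IsTriangulation T (⋃ Q ∈ X, (c' : ℝ) • Q) ∧
        (∀ S ∈ T, IsUnimodularSimplex S) ∧
        (∀ S ∈ T, ∃ Q ∈ X, S ⊆ (c' : ℝ) • Q) ∧
        (∀ Q ∈ X, IsUnimodularTriangulation {S | S ∈ T ∧ S ⊆ (c' : ℝ) • Q} ((c' : ℝ) • Q)) := by
  obtain ⟨N, hN⟩ := UnimodularTriangulation.leveled_initialFan hX hint
  obtain ⟨s₀, hs₀⟩ := UnimodularTriangulation.Grading.exists_single_level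
    (UnimodularTriangulation.coneSystem hX) (by rintro s _ ⟨Q, -, y, -, rfl⟩ c; rfl) hN
    (UnimodularTriangulation.adequate_initialFan hX)
  refine ⟨max s₀ 1, by omega, fun s hs => ?_⟩
  obtain ⟨b, a, T', hT, hcov⟩ := hs₀ s (by omega)
  obtain ⟨T, h, hsub, hQ⟩ :=
    UnimodularTriangulation.exists_unimodular_triangulation hX (by omega) hT hcov
  exact ⟨T, h.1, h.2, hsub, hQ⟩
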